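/- arXiv:0709.2463 — 5 statements merged into one kernel-verified Lean document; each statement's English description precedes it below -/
import Mathlib

section
/- Let F be an algebraically closed field of characteristic not 2, fix ε ∈ {1,−1}, and for a matrix X put X^▽ := [[0,X],[εXᵀ,0]]. For n×n matrices A, B over F define the triple of (342+8n)×(342+8n) matrices T(A,B) := (I_{100},0_{100},0_{100})^▽ ⊕ (0_{50},I_{50},0_{50})^▽ ⊕ (0_{20},0_{20},I_{20})^▽ ⊕ (I_1,I_1,I_1)^▽ ⊕ G(A,B)^▽, where G(A,B) := (I_{4n}, J_4(0_n), diag(I_n,A,B,0_n)). Then for pairs (A,B) and (C,D) of n×n matrices over F: (A,B) is similar to (C,D) if and only if T(C,D) can be obtained from T(A,B) by a substitution (M₁,M₂,M₃) ↦ (Σ_j γ_{1j}M_j, Σ_j γ_{2j}M_j, Σ_j γ_{3j}M_j) with nonsingular [γ_{ij}] followed by a congruence (N₁,N₂,N₃) ↦ (SᵀN₁S, SᵀN₂S, SᵀN₃S) with nonsingular S. (All matrices of T(A,B) are symmetric if ε=1 and skew-symmetric if ε=−1.) -/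
open Matrix

variable {F : Type} [Field F]

/-- `X^▽ = [[0, X],[εXᵀ, 0]]` for a square matrix `X`. -/
def nab {I : Type} (ε : F) (X : Matrix I I F) : Matrix (I ⊕ I) (I ⊕ I) F :=
  Matrix.fromBlocks 0 X (ε • Xᵀ) 0

/-- The 4n×4n block matrix `J₄(0ₙ)` with `Iₙ` on the first block superdiagonal. -/
def J4 (F : Type) [Field F] (n : ℕ) : Matrix (Fin 4 × Fin n) (Fin 4 × Fin n) F :=
  fun p q => if (p.1 : ℕ) + 1 = (q.1 : ℕ) ∧ p.2 = q.2 then 1 else 0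

/-- The 4n×4n block-diagonal matrix with given n×n diagonal blocks. -/
def blkDiag4 {n : ℕ} (M : Fin 4 → Matrix (Fin n) (Fin n) F) :
    Matrix (Fin 4 × Fin n) (Fin 4 × Fin n) F :=
  fun p q => if p.1 = q.1 then M p.1 p.2 q.2 else 0

/-- The index type of the (342+8n)×(342+8n) matrices of the triple `T(A,B)`. -/
abbrev BigIdx (n : ℕ) : Type :=
  ((Fin 100 ⊕ Fin 100) ⊕ (Fin 50 ⊕ Fin 50)) ⊕
    (((Fin 20 ⊕ Fin 20) ⊕ (Fin 1 ⊕ Fin 1)) ⊕ ((Fin 4 × Fin n) ⊕ (Fin 4 × Fin n)))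

/-- The triple `T(A,B) = (I₁₀₀,0,0)^▽ ⊕ (0,I₅₀,0)^▽ ⊕ (0,0,I₂₀)^▽ ⊕ (I₁,I₁,I₁)^▽ ⊕ G(A,B)^▽`
where `G(A,B) = (I_{4n}, J₄(0ₙ), diag(Iₙ,A,B,0ₙ))`. -/
def bigT (ε : F) {n : ℕ} (A B : Matrix (Fin n) (Fin n) F) :
    Fin 3 → Matrix (BigIdx n) (BigIdx n) F :=
  fun i =>
    Matrix.fromBlocks
      (Matrix.fromBlocks
        (nab ε ((![1, 0, 0] : Fin 3 → Matrix (Fin 100) (Fin 100) F) i)) 0 0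
        (nab ε ((![0, 1, 0] : Fin 3 → Matrix (Fin 50) (Fin 50) F) i))) 0 0
      (Matrix.fromBlocks
        (Matrix.fromBlocks
          (nab ε ((![0, 0, 1] : Fin 3 → Matrix (Fin 20) (Fin 20) F) i)) 0 0
          (nab ε ((![1, 1, 1] : Fin 3 → Matrix (Fin 1) (Fin 1) F) i))) 0 0
        (nab ε ((![1, J4 F n, blkDiag4 ![1, A, B, 0]] :
            Fin 3 → Matrix (Fin 4 × Fin n) (Fin 4 × Fin n) F) i)))

/-- The entrywise direct sum of two triples of matrices. -/
def dsum {I J K L : Type} (M : Fin 3 → Matrix I J F) (N : Fin 3 → Matrix K L F) :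
    Fin 3 → Matrix (I ⊕ K) (J ⊕ L) F :=
  fun i => Matrix.fromBlocks (M i) 0 0 (N i)

/-- The multiplicity of the one-dimensional triple `p` as a summand of `M` under equivalence is
at most `m`, measured by the rank of the pairing of morphisms from and to `p`. -/
def MultLE {I J : Type} [Fintype I] [Fintype J] (p : Fin 3 → F) (m : ℕ)
    (M : Fin 3 → Matrix I J F) : Prop :=
  ∀ (r : Type) [Fintype r] [DecidableEq r] (X : Matrix J r F) (Z : Matrix I r F)
    (Y : Matrix r I F) (W : Matrix r J F), (∀ i, M i * X = p i • Z) → (∀ i, Y * M i = p i • W) →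
    (Y * Z).rank ≤ m

/-- The direct sum of copies of the one-dimensional triple `p` indexed by `r` is a summand
of `M` under equivalence. -/
def HasCopies {I J : Type} [Fintype I] [Fintype J] (p : Fin 3 → F) (r : Type) [Fintype r]
    [DecidableEq r] (M : Fin 3 → Matrix I J F) : Prop :=
  ∃ (X : Matrix J r F) (Z : Matrix I r F) (Y : Matrix r I F) (W : Matrix r J F),
    (∀ i, M i * X = p i • Z) ∧ (∀ i, Y * M i = p i • W) ∧ Y * Z = 1

lemma matrix_rank_add_le {I J : Type} [Fintype J] (M N : Matrix I J F) : (M + N).rank ≤ M.rank + N.rank := by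
  rw [Matrix.rank, Matrix.rank, Matrix.rank, Matrix.mulVecLin_add]
  exact (Submodule.finrank_mono (LinearMap.range_add_le _ _)).trans
    (Submodule.finrank_add_le_finrank_add_finrank _ _)

section Multiplicity

variable {I J K L : Type} [Fintype I] [Fintype J] [Fintype K] [Fintype L]

lemma HasCopies.card_le {p : Fin 3 → F} {r : Type} [Fintype r] [DecidableEq r] {m : ℕ}
    {M : Fin 3 → Matrix I J F} (h : HasCopies p r M) (h' : MultLE p m M) :
    Fintype.card r ≤ m := by
  obtain ⟨X, Z, Y, W, h1, h2, h3⟩ := h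
  have := h' r X Z Y W h1 h2
  rwa [h3, Matrix.rank_one] at this

lemma HasCopies.dsum_left {p : Fin 3 → F} {r : Type} [Fintype r] [DecidableEq r]
    {M : Fin 3 → Matrix I J F} (N : Fin 3 → Matrix K L F) (h : HasCopies p r M) :
    HasCopies p r (dsum M N) := by
  obtain ⟨X, Z, Y, W, h1, h2, h3⟩ := h
  refine ⟨fromRows X 0, fromRows Z 0, fromCols Y 0, fromCols W 0, fun i => ?_, fun i => ?_, ?_⟩
  · rw [dsum, fromBlocks_mul_fromRows, h1]
    ext (a | a) b <;> simp
  · rw [dsum, fromCols_mul_fromBlocks, h2]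
    ext a (b | b) <;> simp
  · rw [fromCols_mul_fromRows, h3]
    simp

lemma HasCopies.dsum_right {p : Fin 3 → F} {r : Type} [Fintype r] [DecidableEq r]
    (M : Fin 3 → Matrix I J F) {N : Fin 3 → Matrix K L F} (h : HasCopies p r N) :
    HasCopies p r (dsum M N) := by
  obtain ⟨X, Z, Y, W, h1, h2, h3⟩ := h
  refine ⟨fromRows 0 X, fromRows 0 Z, fromCols 0 Y, fromCols 0 W, fun i => ?_, fun i => ?_, ?_⟩
  · rw [dsum, fromBlocks_mul_fromRows, h1]
    ext (a | a) b <;> simp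
  · rw [dsum, fromCols_mul_fromBlocks, h2]
    ext a (b | b) <;> simp
  · rw [fromCols_mul_fromRows, h3]
    simp

lemma hasCopies_nab [DecidableEq I] {ε : F} (hε : ε * ε = 1) (q : Fin 3 → F) :
    HasCopies q (I ⊕ I) (fun i => nab ε (q i • (1 : Matrix I I F))) := by
  have h : ∀ c : F, nab ε (c • (1 : Matrix I I F)) = c • nab ε 1 := fun c => by
    simp [nab, fromBlocks_smul, smul_comm c ε]
  have h2 : (ε • nab ε 1) * nab ε (1 : Matrix I I F) = 1 := by
    simp [nab, fromBlocks_multiply, fromBlocks_smul, smul_smul, hε]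
  refine ⟨1, nab ε 1, ε • nab ε 1, 1, fun i => ?_, fun i => ?_, h2⟩
  · simp only [h, Matrix.mul_one]
  · simp only [h, Matrix.mul_smul (_ • _), h2]

lemma HasCopies.transform [DecidableEq I] [DecidableEq J] {p : Fin 3 → F} {r : Type} [Fintype r]
    [DecidableEq r] {M N : Fin 3 → Matrix I J F} (h : HasCopies p r M) (γ : Matrix (Fin 3) (Fin 3) F)
    {R : Matrix I I F} {S : Matrix J J F} (hR : IsUnit R) (hS : IsUnit S)
    (hN : ∀ i, R * (∑ j, γ i j • M j) * S = N i) : HasCopies (γ *ᵥ p) r N := by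
  obtain ⟨X, Z, Y, W, h1, h2, h3⟩ := h
  have hR' : R⁻¹ * R = 1 := Matrix.nonsing_inv_mul _ ((Matrix.isUnit_iff_isUnit_det _).1 hR)
  have hS' : S * S⁻¹ = 1 := Matrix.mul_nonsing_inv _ ((Matrix.isUnit_iff_isUnit_det _).1 hS)
  refine ⟨S⁻¹ * X, R * Z, Y * R⁻¹, W * S, fun i => ?_, fun i => ?_, ?_⟩
  · calc N i * (S⁻¹ * X) = R * ((∑ j, γ i j • M j) * ((S * S⁻¹) * X)) := by
          rw [← hN]; simp only [Matrix.mul_assoc]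
      _ = _ := by
          rw [hS', Matrix.one_mul, Matrix.sum_mul]
          simp only [Matrix.smul_mul, h1, smul_smul, ← Finset.sum_smul, Matrix.mul_smul]
          rfl
  · calc Y * R⁻¹ * N i = Y * (R⁻¹ * R) * (∑ j, γ i j • M j) * S := by
          rw [← hN]; simp only [Matrix.mul_assoc]
      _ = _ := by
          rw [hR', Matrix.mul_one, Matrix.mul_sum]
          simp only [Matrix.mul_smul, h2, smul_smul, ← Finset.sum_smul, Matrix.smul_mul]
          rfl
  · rw [Matrix.mul_assoc, ← Matrix.mul_assoc _ R, hR', Matrix.one_mul, h3]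

lemma MultLE.dsum {p : Fin 3 → F} {m k : ℕ} {M : Fin 3 → Matrix I J F}
    {N : Fin 3 → Matrix K L F} (hM : MultLE p m M) (hN : MultLE p k N) :
    MultLE p (m + k) (dsum M N) := by
  intro r _ _ X Z Y W h1 h2
  obtain ⟨X1, X2, rfl⟩ : ∃ X1 X2, X = fromRows X1 X2 := ⟨_, _, (fromRows_toRows X).symm⟩
  obtain ⟨Z1, Z2, rfl⟩ : ∃ X1 X2, Z = fromRows X1 X2 := ⟨_, _, (fromRows_toRows Z).symm⟩
  obtain ⟨Y1, Y2, rfl⟩ : ∃ X1 X2, Y = fromCols X1 X2 := ⟨_, _, (fromCols_toCols Y).symm⟩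
  obtain ⟨W1, W2, rfl⟩ : ∃ X1 X2, W = fromCols X1 X2 := ⟨_, _, (fromCols_toCols W).symm⟩
  rw [fromCols_mul_fromRows]
  refine (matrix_rank_add_le _ _).trans (add_le_add (hM r X1 Z1 Y1 W1 ?_ ?_)
    (hN r X2 Z2 Y2 W2 ?_ ?_)) <;> intro i
  · ext a b
    simpa [_root_.dsum, fromBlocks_mul_fromRows] using congrFun (congrFun (h1 i) (Sum.inl a)) b
  · ext a b
    simpa [_root_.dsum, fromCols_mul_fromBlocks] using congrFun (congrFun (h2 i) a) (Sum.inl b)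
  · ext a b
    simpa [_root_.dsum, fromBlocks_mul_fromRows] using congrFun (congrFun (h1 i) (Sum.inr a)) b
  · ext a b
    simpa [_root_.dsum, fromCols_mul_fromBlocks] using congrFun (congrFun (h2 i) a) (Sum.inr b)

lemma MultLE.nab {p : Fin 3 → F} (hp : p ≠ 0) {ε : F} (hε : ε * ε = 1) {m : ℕ}
    {M : Fin 3 → Matrix I I F} (hM : MultLE p m M) :
    MultLE p (m + m) (fun i => nab ε (M i)) := by
  intro r _ _ X Z Y W h1 h2
  obtain ⟨X1, X2, rfl⟩ : ∃ X1 X2, X = fromRows X1 X2 := ⟨_, _, (fromRows_toRows X).symm⟩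
  obtain ⟨Z1, Z2, rfl⟩ : ∃ X1 X2, Z = fromRows X1 X2 := ⟨_, _, (fromRows_toRows Z).symm⟩
  obtain ⟨Y1, Y2, rfl⟩ : ∃ X1 X2, Y = fromCols X1 X2 := ⟨_, _, (fromCols_toCols Y).symm⟩
  obtain ⟨W1, W2, rfl⟩ : ∃ X1 X2, W = fromCols X1 X2 := ⟨_, _, (fromCols_toCols W).symm⟩
  have a1 : ∀ i, M i * X2 = p i • Z1 := fun i => by
    ext a b
    simpa [_root_.nab, fromBlocks_mul_fromRows] using congrFun (congrFun (h1 i) (Sum.inl a)) b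
  have a2 : ∀ i, Y1 * M i = p i • W2 := fun i => by
    ext a b
    simpa [_root_.nab, fromCols_mul_fromBlocks] using congrFun (congrFun (h2 i) a) (Sum.inr b)
  have a3 : ∀ i, ε • ((M i)ᵀ * X1) = p i • Z2 := fun i => by
    ext a b
    simpa [_root_.nab, fromBlocks_mul_fromRows] using congrFun (congrFun (h1 i) (Sum.inr a)) b
  have a4 : ∀ i, ε • (Y2 * (M i)ᵀ) = p i • W1 := fun i => by
    ext a b
    simpa [_root_.nab, fromCols_mul_fromBlocks] using congrFun (congrFun (h2 i) a) (Sum.inl b)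
  have b3 : ∀ i, X1ᵀ * M i = p i • (ε • Z2)ᵀ := fun i => by
    rw [← Matrix.transpose_smul, smul_comm, ← a3, smul_smul, hε, one_smul]
    simp
  have b4 : ∀ i, M i * Y2ᵀ = p i • (ε • W1)ᵀ := fun i => by
    rw [← Matrix.transpose_smul, smul_comm, ← a4, smul_smul, hε, one_smul]
    simp
  have hYZ : Y2 * Z2 = W1 * X1 := by
    obtain ⟨i, hi⟩ := Function.ne_iff.1 hp
    refine smul_right_injective _ hi ?_
    change p i • (Y2 * Z2) = p i • (W1 * X1)
    rw [← Matrix.mul_smul, ← Matrix.smul_mul, ← a3, ← a4]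
    simp [Matrix.mul_assoc]
  have hrank : (Y2 * Z2).rank ≤ m := by
    have h := hM r Y2ᵀ (ε • W1)ᵀ X1ᵀ (ε • Z2)ᵀ b4 b3
    rw [← Matrix.transpose_mul, Matrix.rank_transpose, Matrix.smul_mul] at h
    have hε0 : ε ≠ 0 := fun h0 => by simp [h0] at hε
    rw [hYZ]
    refine le_trans (le_of_eq ?_) h
    exact (Matrix.rank_smul_of_mem_nonZeroDivisors _ (mem_nonZeroDivisors_of_ne_zero hε0)).symm
  rw [fromCols_mul_fromRows]
  exact (matrix_rank_add_le _ _).trans (add_le_add (hM r X2 Z1 Y1 W2 a1 a2) hrank)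

lemma multLE_card (p : Fin 3 → F) (M : Fin 3 → Matrix I J F) :
    MultLE p (Fintype.card I) M := fun _ _ _ _ Z Y _ _ _ =>
  (Matrix.rank_mul_le_left Y Z).trans (Matrix.rank_le_card_width Y)

lemma multLE_zero_of_not_proportional [DecidableEq I] {p q : Fin 3 → F} {i j : Fin 3}
    (h : q i * p j ≠ q j * p i) : MultLE p 0 (fun i => q i • (1 : Matrix I I F)) := by
  intro r _ _ X Z Y W h1 _
  have hi := h1 i
  have hj := h1 j
  simp only [Matrix.smul_mul, Matrix.one_mul] at hi hj
  have h0 : (q i * p j - q j * p i) • Z = 0 := by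
    rw [sub_smul, mul_smul, mul_smul, ← hi, ← hj, smul_comm, sub_self]
  have hZ : Z = 0 := (smul_eq_zero.1 h0).resolve_left (sub_ne_zero.2 h)
  simp [hZ]

end Multiplicity

section Blocks

variable {n : ℕ}

lemma J4_mulVec (x : Fin 4 × Fin n → F) (a : Fin n) :
    (J4 F n *ᵥ x) (0, a) = x (1, a) ∧ (J4 F n *ᵥ x) (1, a) = x (2, a) ∧
      (J4 F n *ᵥ x) (2, a) = x (3, a) ∧ (J4 F n *ᵥ x) (3, a) = 0 := by
  simp [Matrix.mulVec, dotProduct, J4, Fintype.sum_prod_type, Fin.sum_univ_four]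

lemma J4_transpose_mulVec (x : Fin 4 × Fin n → F) (a : Fin n) :
    ((J4 F n)ᵀ *ᵥ x) (0, a) = 0 ∧ ((J4 F n)ᵀ *ᵥ x) (1, a) = x (0, a) ∧
      ((J4 F n)ᵀ *ᵥ x) (2, a) = x (1, a) ∧ ((J4 F n)ᵀ *ᵥ x) (3, a) = x (2, a) := by
  simp [Matrix.mulVec, dotProduct, J4, Fintype.sum_prod_type, Fin.sum_univ_four]

lemma blkDiag4_mulVec (M : Fin 4 → Matrix (Fin n) (Fin n) F) (x : Fin 4 × Fin n → F)
    (k : Fin 4) (a : Fin n) :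
    (blkDiag4 M *ᵥ x) (k, a) = (M k *ᵥ fun b => x (k, b)) a := by
  simp [Matrix.mulVec, dotProduct, blkDiag4, Fintype.sum_prod_type]

lemma blkDiag4_transpose (M : Fin 4 → Matrix (Fin n) (Fin n) F) :
    (blkDiag4 M)ᵀ = blkDiag4 (fun k => (M k)ᵀ) := by
  ext ⟨k, a⟩ ⟨l, b⟩
  by_cases h : k = l
  · subst h; simp [blkDiag4]
  · simp [blkDiag4, h, Ne.symm h]

lemma blkDiag4_mul (M N : Fin 4 → Matrix (Fin n) (Fin n) F) :
    blkDiag4 M * blkDiag4 N = blkDiag4 (fun k => M k * N k) := by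
  ext ⟨k, a⟩ ⟨l, b⟩
  by_cases h : k = l
  · subst h; simp [blkDiag4, Matrix.mul_apply, Fintype.sum_prod_type]
  · simp [blkDiag4, Matrix.mul_apply, Fintype.sum_prod_type, h]

lemma blkDiag4_one : blkDiag4 (fun _ => (1 : Matrix (Fin n) (Fin n) F)) = 1 := by
  ext ⟨k, a⟩ ⟨l, b⟩
  by_cases h : k = l
  · subst h; simp [blkDiag4, Matrix.one_apply]
  · simp [blkDiag4, h]

lemma J4_mul_blkDiag4 (S : Matrix (Fin n) (Fin n) F) :
    J4 F n * blkDiag4 (fun _ => S) = blkDiag4 (fun _ => S) * J4 F n := by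
  ext ⟨k, a⟩ ⟨l, b⟩
  fin_cases k <;> fin_cases l <;>
    simp [blkDiag4, J4, Matrix.mul_apply, Fintype.sum_prod_type, Fin.sum_univ_four]

lemma J4_mul_eq_smul {r : Type} {c : F} {X : Matrix (Fin 4 × Fin n) r F}
    (h : J4 F n * X = c • X) (k : Fin 4) (hk : k ≠ 0) : ∀ a b, X (k, a) b = 0 := by
  intro a b
  have h' : J4 F n *ᵥ (fun x => X x b) = c • fun x => X x b := by
    ext x; exact congrFun (congrFun h x) b
  obtain ⟨e0, e1, e2, e3⟩ := J4_mulVec (fun x => X x b) a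
  rw [h'] at e0 e1 e2 e3
  simp only [Pi.smul_apply, smul_eq_mul] at e0 e1 e2 e3
  rcases mul_eq_zero.1 e3 with hc | hX
  · simp only [hc, zero_mul] at e0 e1 e2
    fin_cases k <;> simp_all
  · simp only [hX] at e2
    rcases mul_eq_zero.1 e2 with hc | hX2
    · simp only [hc, zero_mul] at e0 e1
      fin_cases k <;> simp_all
    · simp only [hX2] at e1
      rcases mul_eq_zero.1 e1 with hc | hX1
      · simp only [hc, zero_mul] at e0
        fin_cases k <;> simp_all
      · fin_cases k <;> simp_all

lemma mul_J4_eq_smul {r : Type} {c : F} {Y : Matrix r (Fin 4 × Fin n) F}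
    (h : Y * J4 F n = c • Y) (a : Fin n) (b : r) : Y b (0, a) = 0 := by
  have h' : (J4 F n)ᵀ *ᵥ (Y b) = c • Y b := by
    ext x
    simpa [Matrix.mul_apply, Matrix.mulVec, dotProduct, mul_comm] using congrFun (congrFun h b) x
  obtain ⟨e0, e1, e2, e3⟩ := J4_transpose_mulVec (Y b) a
  rw [h'] at e0 e1 e2 e3
  simp only [Pi.smul_apply, smul_eq_mul] at e0 e1 e2 e3
  rcases mul_eq_zero.1 e0 with hc | hX
  · simpa [hc] using e1.symm
  · exact hX

/-- A triple starting with `1` and `J₄(0ₙ)` has no one-dimensional summands. -/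
lemma multLE_J4 {p : Fin 3 → F} (hp : p ≠ 0)
    (D : Matrix (Fin 4 × Fin n) (Fin 4 × Fin n) F) : MultLE p 0 ![1, J4 F n, D] := by
  intro r _ _ X Z Y W h1 h2
  have x0 := h1 0
  have x1 := h1 1
  have y0 := h2 0
  have y1 := h2 1
  simp at x0 x1 y0 y1
  by_cases hp0 : p 0 = 0
  · obtain ⟨i, hi⟩ := Function.ne_iff.1 hp
    have hX : X = 0 := by simpa [hp0] using x0
    have := h1 i
    rw [hX, Matrix.mul_zero] at this
    have hZ : Z = 0 := (smul_eq_zero.1 this.symm).resolve_left hi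
    simp [hZ]
  · have hZ : Z = (p 0)⁻¹ • X := by rw [x0, smul_smul, inv_mul_cancel₀ hp0, one_smul]
    have hW : W = (p 0)⁻¹ • Y := by rw [y0, smul_smul, inv_mul_cancel₀ hp0, one_smul]
    rw [hZ, smul_smul] at x1
    rw [hW, smul_smul] at y1
    have hX := J4_mul_eq_smul x1
    have hY := mul_J4_eq_smul y1
    have hYX : Y * X = 0 := by
      ext a b
      rw [Matrix.mul_apply]
      refine Finset.sum_eq_zero fun ⟨k, c⟩ _ => ?_
      by_cases hk : k = 0
      · subst hk; rw [hY, zero_mul]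
      · rw [hX k hk, mul_zero]
    rw [hZ, Matrix.mul_smul, hYX]
    simp

end Blocks

/-- The triple `G(A,B)`. -/
def bigG {n : ℕ} (A B : Matrix (Fin n) (Fin n) F) :
    Fin 3 → Matrix (Fin 4 × Fin n) (Fin 4 × Fin n) F :=
  ![1, J4 F n, blkDiag4 ![1, A, B, 0]]

section BigT

variable {n : ℕ}

lemma bigT_eq_dsum (ε : F) (A B : Matrix (Fin n) (Fin n) F) :
    bigT ε A B = dsum
      (dsum (fun i => nab ε ((![1, 0, 0] : Fin 3 → F) i • (1 : Matrix (Fin 100) (Fin 100) F)))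
        (fun i => nab ε ((![0, 1, 0] : Fin 3 → F) i • (1 : Matrix (Fin 50) (Fin 50) F))))
      (dsum
        (dsum (fun i => nab ε ((![0, 0, 1] : Fin 3 → F) i • (1 : Matrix (Fin 20) (Fin 20) F)))
          (fun i => nab ε ((![1, 1, 1] : Fin 3 → F) i • (1 : Matrix (Fin 1) (Fin 1) F))))
        (fun i => nab ε (bigG A B i))) := by
  funext i
  fin_cases i <;> simp [bigT, dsum, bigG]

lemma bigT_multLE {ε : F} (hε : ε * ε = 1) (A B : Matrix (Fin n) (Fin n) F) {g : Fin 3 → F}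
    (hg : g ≠ 0) {a b c d : ℕ}
    (ha : MultLE g a fun i => (![1, 0, 0] : Fin 3 → F) i • (1 : Matrix (Fin 100) (Fin 100) F))
    (hb : MultLE g b fun i => (![0, 1, 0] : Fin 3 → F) i • (1 : Matrix (Fin 50) (Fin 50) F))
    (hc : MultLE g c fun i => (![0, 0, 1] : Fin 3 → F) i • (1 : Matrix (Fin 20) (Fin 20) F))
    (hd : MultLE g d fun i => (![1, 1, 1] : Fin 3 → F) i • (1 : Matrix (Fin 1) (Fin 1) F)) :
    MultLE g ((a + a) + (b + b) + ((c + c) + (d + d) + (0 + 0))) (bigT ε A B) := by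
  rw [bigT_eq_dsum]
  exact ((ha.nab hg hε).dsum (hb.nab hg hε)).dsum
    (((hc.nab hg hε).dsum (hd.nab hg hε)).dsum ((multLE_J4 hg _).nab hg hε))

end BigT

lemma multLE_scalar (g q : Fin 3 → F) (m : ℕ) :
    MultLE g m (fun i => q i • (1 : Matrix (Fin m) (Fin m) F)) := by
  simpa using multLE_card g (fun i => q i • (1 : Matrix (Fin m) (Fin m) F))

/-- A substitution followed by an equivalence between two triples `T(A,B)` and `T(C,D)` rescales
all three matrices by the same factor. -/
lemma substitution_scalar {n : ℕ} {ε : F} (hε : ε * ε = 1) (A B C D : Matrix (Fin n) (Fin n) F)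
    {γ : Matrix (Fin 3) (Fin 3) F} (hγ : IsUnit γ) {R S : Matrix (BigIdx n) (BigIdx n) F}
    (hR : IsUnit R) (hS : IsUnit S)
    (hN : ∀ i, R * (∑ j, γ i j • bigT ε A B j) * S = bigT ε C D i) :
    ∃ c : F, c ≠ 0 ∧ γ = c • 1 := by
  have hdet : γ.det ≠ 0 := ((Matrix.isUnit_iff_isUnit_det _).1 hγ).ne_zero
  have tr : ∀ (p g : Fin 3 → F) (r : Type) [Fintype r] [DecidableEq r],
      HasCopies p r (bigT ε A B) → γ *ᵥ p = g → HasCopies g r (bigT ε C D) := by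
    rintro p g r _ _ h rfl
    exact h.transform γ hR hS hN
  have k0 := tr ![1, 0, 0] (fun i => γ i 0) (Fin 100 ⊕ Fin 100)
    (by rw [bigT_eq_dsum]; exact ((hasCopies_nab hε _).dsum_left _).dsum_left _)
    (by ext i; simp [Matrix.mulVec, dotProduct, Fin.sum_univ_three])
  have k1 := tr ![0, 1, 0] (fun i => γ i 1) (Fin 50 ⊕ Fin 50)
    (by rw [bigT_eq_dsum]; exact ((hasCopies_nab hε _).dsum_right _).dsum_left _)
    (by ext i; simp [Matrix.mulVec, dotProduct, Fin.sum_univ_three])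
  have k2 := tr ![0, 0, 1] (fun i => γ i 2) (Fin 20 ⊕ Fin 20)
    (by rw [bigT_eq_dsum]
        exact (((hasCopies_nab hε _).dsum_left _).dsum_left _).dsum_right _)
    (by ext i; simp [Matrix.mulVec, dotProduct, Fin.sum_univ_three])
  have k3 := tr ![1, 1, 1] (fun i => γ i 0 + γ i 1 + γ i 2) (Fin 1 ⊕ Fin 1)
    (by rw [bigT_eq_dsum]
        exact (((hasCopies_nab hε _).dsum_right _).dsum_left _).dsum_right _)
    (by ext i; simp [Matrix.mulVec, dotProduct, Fin.sum_univ_three])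
  have ne : ∀ {g : Fin 3 → F} (i : Fin 3), g i ≠ 0 → g ≠ 0 := fun i h h0 => h (by simp [h0])
  have z01 : ∀ {g : Fin 3 → F}, g 1 ≠ 0 → MultLE g 0 fun i =>
      (![1, 0, 0] : Fin 3 → F) i • (1 : Matrix (Fin 100) (Fin 100) F) := fun h =>
    multLE_zero_of_not_proportional (i := 0) (j := 1) (by simpa using h)
  have z02 : ∀ {g : Fin 3 → F}, g 2 ≠ 0 → MultLE g 0 fun i =>
      (![1, 0, 0] : Fin 3 → F) i • (1 : Matrix (Fin 100) (Fin 100) F) := fun h =>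
    multLE_zero_of_not_proportional (i := 0) (j := 2) (by simpa using h)
  have z10 : ∀ {g : Fin 3 → F}, g 0 ≠ 0 → MultLE g 0 fun i =>
      (![0, 1, 0] : Fin 3 → F) i • (1 : Matrix (Fin 50) (Fin 50) F) := fun h =>
    multLE_zero_of_not_proportional (i := 1) (j := 0) (by simpa using h)
  have z12 : ∀ {g : Fin 3 → F}, g 2 ≠ 0 → MultLE g 0 fun i =>
      (![0, 1, 0] : Fin 3 → F) i • (1 : Matrix (Fin 50) (Fin 50) F) := fun h =>
    multLE_zero_of_not_proportional (i := 1) (j := 2) (by simpa using h)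
  have z20 : ∀ {g : Fin 3 → F}, g 0 ≠ 0 → MultLE g 0 fun i =>
      (![0, 0, 1] : Fin 3 → F) i • (1 : Matrix (Fin 20) (Fin 20) F) := fun h =>
    multLE_zero_of_not_proportional (i := 2) (j := 0) (by simpa using h)
  have z21 : ∀ {g : Fin 3 → F}, g 1 ≠ 0 → MultLE g 0 fun i =>
      (![0, 0, 1] : Fin 3 → F) i • (1 : Matrix (Fin 20) (Fin 20) F) := fun h =>
    multLE_zero_of_not_proportional (i := 2) (j := 1) (by simpa using h)
  have c10 : γ 1 0 = 0 := by
    by_contra h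
    simpa using k0.card_le (bigT_multLE hε C D (ne 1 h) (z01 h) (multLE_scalar _ _ _)
      (multLE_scalar _ _ _) (multLE_scalar _ _ _))
  have c20 : γ 2 0 = 0 := by
    by_contra h
    simpa using k0.card_le (bigT_multLE hε C D (ne 2 h) (z02 h) (multLE_scalar _ _ _)
      (multLE_scalar _ _ _) (multLE_scalar _ _ _))
  have c21 : γ 2 1 = 0 := by
    by_contra h
    simpa using k1.card_le (bigT_multLE hε C D (ne 2 h) (z02 h) (z12 h)
      (multLE_scalar _ _ _) (multLE_scalar _ _ _))
  rw [Matrix.det_fin_three, c10, c20, c21] at hdet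
  simp only [mul_zero, sub_zero, zero_mul, add_zero, mul_ne_zero_iff] at hdet
  obtain ⟨⟨h0, h1⟩, h2⟩ := hdet
  have c01 : γ 0 1 = 0 := by
    by_contra h
    simpa using k1.card_le (bigT_multLE hε C D (ne 0 h) (z01 h1) (z10 h)
      (multLE_scalar _ _ _) (multLE_scalar _ _ _))
  have c02 : γ 0 2 = 0 := by
    by_contra h
    simpa using k2.card_le (bigT_multLE hε C D (ne 0 h) (z02 h2) (z12 h2) (z20 h)
      (multLE_scalar _ _ _))
  have c12 : γ 1 2 = 0 := by
    by_contra h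
    simpa using k2.card_le (bigT_multLE hε C D (ne 1 h) (z02 h2) (z12 h2) (z21 h)
      (multLE_scalar _ _ _))
  obtain ⟨g, hg⟩ : ∃ g : Fin 3 → F, g = fun i => γ i 0 + γ i 1 + γ i 2 := ⟨_, rfl⟩
  rw [← hg] at k3
  have g0 : g 0 = γ 0 0 := by simp [hg, c01, c02]
  have g1 : g 1 = γ 1 1 := by simp [hg, c10, c12]
  have g2 : g 2 = γ 2 2 := by simp [hg, c20, c21]
  rw [← g0] at h0
  rw [← g1] at h1
  rw [← g2] at h2
  have eq : ∀ i, g 0 = g i := fun i => by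
    by_contra h
    simpa using k3.card_le (bigT_multLE hε C D (ne 0 h0) (z01 h1) (z10 h0) (z20 h0)
      (multLE_zero_of_not_proportional (i := i) (j := 0)
        (by fin_cases i; exacts [absurd rfl h, by simpa using h, by simpa using h])))
  refine ⟨g 0, h0, ?_⟩
  ext i j
  fin_cases i <;> fin_cases j <;> simp [c01, c02, c10, c12, c20, c21, g0]
  · rw [← g0, ← g1, ← eq 1]
  · rw [← g0, ← g2, ← eq 2]

/-- The vector `v` is killed by the second matrix of a triple and has the same image under the
first and the third. On `G(A,B)` this singles out the vectors supported in the first block. -/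
def InTopBlock {I J : Type} [Fintype J] (M : Fin 3 → Matrix I J F) (v : J → F) : Prop :=
  M 0 *ᵥ v = M 2 *ᵥ v ∧ M 1 *ᵥ v = 0

section Top

variable {I J K L : Type} [Fintype J] [Fintype L]

lemma InTopBlock.of_dsum {M : Fin 3 → Matrix I J F} {N : Fin 3 → Matrix K L F} {v : J ⊕ L → F}
    (h : InTopBlock (dsum M N) v) : InTopBlock M (v ∘ Sum.inl) ∧ InTopBlock N (v ∘ Sum.inr) := by
  obtain ⟨h1, h2⟩ := h
  refine ⟨⟨?_, ?_⟩, ?_, ?_⟩ <;> ext x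
  · simpa [dsum, fromBlocks_mulVec] using congrFun h1 (Sum.inl x)
  · simpa [dsum, fromBlocks_mulVec] using congrFun h2 (Sum.inl x)
  · simpa [dsum, fromBlocks_mulVec] using congrFun h1 (Sum.inr x)
  · simpa [dsum, fromBlocks_mulVec] using congrFun h2 (Sum.inr x)

variable [Fintype I]

lemma InTopBlock.of_nab {ε : F} (hε : ε ≠ 0) {M : Fin 3 → Matrix I I F} {v : I ⊕ I → F}
    (h : InTopBlock (fun i => nab ε (M i)) v) :
    InTopBlock (fun i => (M i)ᵀ) (v ∘ Sum.inl) ∧ InTopBlock M (v ∘ Sum.inr) := by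
  obtain ⟨h1, h2⟩ := h
  refine ⟨⟨?_, ?_⟩, ?_, ?_⟩ <;> ext x
  · simpa [nab, fromBlocks_mulVec, smul_mulVec, hε] using congrFun h1 (Sum.inr x)
  · simpa [nab, fromBlocks_mulVec, smul_mulVec, hε] using congrFun h2 (Sum.inr x)
  · simpa [nab, fromBlocks_mulVec] using congrFun h1 (Sum.inl x)
  · simpa [nab, fromBlocks_mulVec] using congrFun h2 (Sum.inl x)

lemma InTopBlock.scalar_eq_zero [DecidableEq I] {q : Fin 3 → F} (hq : q 0 ≠ q 2 ∨ q 1 ≠ 0) {v : I → F}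
    (h : InTopBlock (fun i => q i • (1 : Matrix I I F)) v) : v = 0 := by
  obtain ⟨h1, h2⟩ := h
  simp only [smul_mulVec, one_mulVec] at h1 h2
  rcases hq with hq | hq
  · have h3 : (q 0 - q 2) • v = 0 := by rw [sub_smul, h1, sub_self]
    exact (smul_eq_zero.1 h3).resolve_left (sub_ne_zero.2 hq)
  · exact (smul_eq_zero.1 h2).resolve_left hq

lemma InTopBlock.nab_scalar_eq_zero [DecidableEq I] {ε : F} (hε : ε ≠ 0) {q : Fin 3 → F}
    (hq : q 0 ≠ q 2 ∨ q 1 ≠ 0) {v : I ⊕ I → F}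
    (h : InTopBlock (fun i => nab ε (q i • (1 : Matrix I I F))) v) : v = 0 := by
  obtain ⟨h1, h2⟩ := h.of_nab hε
  simp only [transpose_smul, transpose_one] at h1
  ext (x | x)
  · exact congrFun (InTopBlock.scalar_eq_zero hq h1) x
  · exact congrFun (InTopBlock.scalar_eq_zero hq h2) x

end Top

section Extraction

variable {n : ℕ}

/-- The vector with `a` in block `k` and zeros elsewhere. -/
def blkVec (k : Fin 4) (a : Fin n → F) : Fin 4 × Fin n → F :=
  fun p => if p.1 = k then a p.2 else 0

/-- Extension of a vector by zero from the column space of `G(A,B)` to that of `T(A,B)`. -/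
def inU (x : Fin 4 × Fin n → F) : BigIdx n → F :=
  Sum.elim 0 (Sum.elim 0 (Sum.elim 0 x))

/-- Extension of a vector by zero from the row space of `G(A,B)` to that of `T(A,B)`. -/
def inV (y : Fin 4 × Fin n → F) : BigIdx n → F :=
  Sum.elim 0 (Sum.elim 0 (Sum.elim y 0))

/-- Restriction of a vector from the column space of `T(A,B)` to that of `G(A,B)`. -/
def prU (v : BigIdx n → F) : Fin 4 × Fin n → F :=
  fun q => v (Sum.inr (Sum.inr (Sum.inr q)))

lemma bigT_mulVec_inU (ε : F) (A B : Matrix (Fin n) (Fin n) F) (i : Fin 3)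
    (x : Fin 4 × Fin n → F) :
    bigT ε A B i *ᵥ inU x = inV (bigG A B i *ᵥ x) := by
  simp only [bigT_eq_dsum, dsum, inU, inV, nab, fromBlocks_mulVec, Sum.elim_comp_inl,
    Sum.elim_comp_inr, mulVec_zero, zero_mulVec, add_zero, zero_add]

lemma bigT_mulVec_apply (ε : F) (A B : Matrix (Fin n) (Fin n) F) (i : Fin 3)
    (v : BigIdx n → F) (q : Fin 4 × Fin n) :
    (bigT ε A B i *ᵥ v) (Sum.inr (Sum.inr (Sum.inl q))) = (bigG A B i *ᵥ prU v) q := by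
  simp only [bigT_eq_dsum, dsum, nab, fromBlocks_mulVec, zero_mulVec, add_zero, zero_add,
    Sum.elim_inr, Sum.elim_inl]
  rfl

lemma J4_mulVec_blkVec_zero (a : Fin n → F) : J4 F n *ᵥ blkVec 0 a = 0 := by
  ext ⟨k, b⟩
  obtain ⟨e0, e1, e2, e3⟩ := J4_mulVec (blkVec 0 a) b
  fin_cases k <;> simp_all [blkVec]

lemma J4_mulVec_blkVec_one (a : Fin n → F) : J4 F n *ᵥ blkVec 1 a = blkVec 0 a := by
  ext ⟨k, b⟩
  obtain ⟨e0, e1, e2, e3⟩ := J4_mulVec (blkVec 1 a) b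
  fin_cases k <;> simp_all [blkVec]

lemma J4_mulVec_blkVec_two (a : Fin n → F) : J4 F n *ᵥ blkVec 2 a = blkVec 1 a := by
  ext ⟨k, b⟩
  obtain ⟨e0, e1, e2, e3⟩ := J4_mulVec (blkVec 2 a) b
  fin_cases k <;> simp_all [blkVec]

lemma blkDiag4_mulVec_blkVec (M : Fin 4 → Matrix (Fin n) (Fin n) F) (k : Fin 4) (a : Fin n → F) :
    blkDiag4 M *ᵥ blkVec k a = blkVec k (M k *ᵥ a) := by
  ext ⟨l, b⟩
  rw [blkDiag4_mulVec]
  by_cases h : l = k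
  · subst h; simp [blkVec]
  · simp only [blkVec, h, if_false]
    exact congrFun (mulVec_zero _) b

lemma inTopBlock_bigT_blkVec (ε : F) (A B : Matrix (Fin n) (Fin n) F) (a : Fin n → F) :
    InTopBlock (bigT ε A B) (inU (blkVec 0 a)) := by
  simp only [InTopBlock, bigT_mulVec_inU]
  refine ⟨by simp [bigG, blkDiag4_mulVec_blkVec], ?_⟩
  ext ((x | x) | ((x | x) | (x | x))) <;> simp [bigG, inV, J4_mulVec_blkVec_zero]

lemma InTopBlock.eq_blkVec {ε : F} (hε : ε ≠ 0) {A B : Matrix (Fin n) (Fin n) F} {v : BigIdx n → F}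
    (h : InTopBlock (bigT ε A B) v) : v = inU (blkVec 0 fun b => prU v (0, b)) := by
  rw [bigT_eq_dsum] at h
  obtain ⟨h1, h2⟩ := h.of_dsum
  obtain ⟨h11, h12⟩ := h1.of_dsum
  obtain ⟨h21, h22⟩ := h2.of_dsum
  obtain ⟨h211, h212⟩ := h21.of_dsum
  obtain ⟨h3, h4⟩ := h22.of_nab hε
  replace h11 := h11.nab_scalar_eq_zero hε (Or.inl (by simp))
  replace h12 := h12.nab_scalar_eq_zero hε (Or.inr (by simp))
  replace h211 := h211.nab_scalar_eq_zero hε (Or.inl (by simp))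
  replace h212 := h212.nab_scalar_eq_zero hε (Or.inr (by simp))
  have h5 : ∀ k b, v (Sum.inr (Sum.inr (Sum.inl (k, b)))) = 0 := fun k b => by
    obtain ⟨a1, a2⟩ := h3
    simp only [bigG, Matrix.cons_val, transpose_one, one_mulVec, blkDiag4_transpose] at a1 a2
    obtain ⟨e0, e1, e2, e3⟩ := J4_transpose_mulVec (((v ∘ Sum.inr) ∘ Sum.inr) ∘ Sum.inl) b
    have e4 := congrFun a1 (3, b)
    rw [blkDiag4_mulVec] at e4
    rw [a2] at e0 e1 e2 e3
    fin_cases k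
    · exact e1.symm
    · exact e2.symm
    · exact e3.symm
    · simpa using e4
  have h6 : ∀ k b, k ≠ 0 → v (Sum.inr (Sum.inr (Sum.inr (k, b)))) = 0 := fun k b hk => by
    obtain ⟨a1, a2⟩ := h4
    simp only [bigG, Matrix.cons_val] at a2
    obtain ⟨e0, e1, e2, e3⟩ := J4_mulVec (((v ∘ Sum.inr) ∘ Sum.inr) ∘ Sum.inr) b
    rw [a2] at e0 e1 e2 e3
    fin_cases k
    · exact absurd rfl hk
    · exact e0.symm
    · exact e1.symm
    · exact e2.symm
  ext ((x | x) | ((x | x) | (⟨k, b⟩ | ⟨k, b⟩)))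
  · exact congrFun h11 x
  · exact congrFun h12 x
  · exact congrFun h211 x
  · exact congrFun h212 x
  · exact h5 k b
  · by_cases hk : k = 0
    · subst hk; rfl
    · rw [h6 k b hk]
      simp [inU, blkVec, hk]

lemma similar_of_equivalence {ε : F} (hε : ε ≠ 0) {A B C D : Matrix (Fin n) (Fin n) F}
    {R S : Matrix (BigIdx n) (BigIdx n) F} (hR : IsUnit R) (hS : IsUnit S)
    (hN : ∀ i, R * bigT ε A B i * S = bigT ε C D i) :
    ∃ S₀ : Matrix (Fin n) (Fin n) F, IsUnit S₀ ∧ A * S₀ = S₀ * C ∧ B * S₀ = S₀ * D := by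
  have hRinj := Matrix.mulVec_injective_of_isUnit hR
  have hSinj := Matrix.mulVec_injective_of_isUnit hS
  have move : ∀ i v, bigT ε C D i *ᵥ v = R *ᵥ (bigT ε A B i *ᵥ (S *ᵥ v)) := fun i v => by
    rw [← hN, mulVec_mulVec, mulVec_mulVec]
  have transport : ∀ i j v w, bigT ε C D i *ᵥ v = bigT ε C D j *ᵥ w →
      bigT ε A B i *ᵥ (S *ᵥ v) = bigT ε A B j *ᵥ (S *ᵥ w) := fun i j v w h => by
    rw [move, move] at h
    exact hRinj h
  obtain ⟨P, hP⟩ : ∃ P : Fin 4 → (Fin n → F) → Fin 4 × Fin n → F,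
      P = fun k a => prU (S *ᵥ inU (blkVec k a)) := ⟨_, rfl⟩
  have step : ∀ i k l (a b : Fin n → F), bigG C D i *ᵥ blkVec k a = blkVec l b →
      bigG A B i *ᵥ P k a = P l b := fun i k l a b h => by
    have h' : bigT ε C D i *ᵥ inU (blkVec k a) = bigT ε C D 0 *ᵥ inU (blkVec l b) := by
      rw [bigT_mulVec_inU, bigT_mulVec_inU, h]
      simp [bigG]
    have ht := transport _ _ _ _ h'
    ext q
    have hq := congrFun ht (Sum.inr (Sum.inr (Sum.inl q)))
    rw [bigT_mulVec_apply, bigT_mulVec_apply] at hq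
    simpa [hP, bigG] using hq
  obtain ⟨S₀, hS₀⟩ : ∃ S₀ : Matrix (Fin n) (Fin n) F, ∀ a b, (S₀ *ᵥ a) b = P 0 a (0, b) :=
    ⟨S.submatrix (fun b => Sum.inr (Sum.inr (Sum.inr (0, b))))
      (fun b => Sum.inr (Sum.inr (Sum.inr (0, b)))), fun a b => by
        simp [hP, prU, inU, blkVec, mulVec, dotProduct, Fintype.sum_prod_type]⟩
  have p1 : ∀ a, (fun b => P 1 a (1, b)) = S₀ *ᵥ a := fun a => by
    ext b
    rw [hS₀, ← step 1 1 0 a a (by simp [bigG, J4_mulVec_blkVec_one])]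
    exact (J4_mulVec _ _).1.symm
  have p2 : ∀ a, (fun b => P 2 a (2, b)) = S₀ *ᵥ a := fun a => by
    ext b
    rw [← p1, ← step 1 2 1 a a (by simp [bigG, J4_mulVec_blkVec_two])]
    exact (J4_mulVec _ _).2.1.symm
  refine ⟨S₀, ?_, ?_, ?_⟩
  · rw [← Matrix.mulVec_injective_iff_isUnit]
    change Function.Injective (Matrix.mulVecLin S₀)
    rw [injective_iff_map_eq_zero]
    intro a ha
    have htop : InTopBlock (bigT ε A B) (S *ᵥ inU (blkVec 0 a)) := by
      obtain ⟨t1, t2⟩ := inTopBlock_bigT_blkVec ε C D a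
      refine ⟨transport _ _ _ _ t1, ?_⟩
      rw [move] at t2
      exact hRinj (t2.trans (mulVec_zero _).symm)
    have h0 : S *ᵥ inU (blkVec 0 a) = 0 := by
      have hz : (fun b => prU (S *ᵥ inU (blkVec 0 a)) (0, b)) = 0 := by
        ext b
        have := hS₀ a b
        rw [hP] at this
        exact this.symm.trans (congrFun ha b)
      rw [htop.eq_blkVec hε, hz]
      ext ((x | x) | ((x | x) | (x | x))) <;> simp [inU, blkVec]
    have h1 := hSinj (h0.trans (mulVec_zero _).symm)
    ext b
    simpa [inU, blkVec] using congrFun h1 (Sum.inr (Sum.inr (Sum.inr (0, b))))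
  · refine Matrix.ext_of_mulVec_single fun c => ?_
    obtain ⟨a, ha⟩ : ∃ a : Fin n → F, a = Pi.single c 1 := ⟨_, rfl⟩
    rw [← ha, ← mulVec_mulVec, ← mulVec_mulVec, ← p1, ← p1]
    ext b
    refine Eq.trans ?_ (congrFun (step 2 1 1 a (C *ᵥ a) (by simp [bigG, blkDiag4_mulVec_blkVec])) _)
    exact (blkDiag4_mulVec ![1, A, B, 0] (P 1 a) 1 b).symm
  · refine Matrix.ext_of_mulVec_single fun c => ?_
    obtain ⟨a, ha⟩ : ∃ a : Fin n → F, a = Pi.single c 1 := ⟨_, rfl⟩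
    rw [← ha, ← mulVec_mulVec, ← mulVec_mulVec, ← p2, ← p2]
    ext b
    refine Eq.trans ?_ (congrFun (step 2 2 2 a (D *ᵥ a) (by simp [bigG, blkDiag4_mulVec_blkVec])) _)
    exact (blkDiag4_mulVec ![1, A, B, 0] (P 2 a) 2 b).symm

end Extraction

lemma congruence_of_similar {n : ℕ} (ε : F) {A B C D S S' : Matrix (Fin n) (Fin n) F}
    (hSS : S' * S = 1) (hA : S' * A * S = C) (hB : S' * B * S = D) :
    ∃ T : Matrix (BigIdx n) (BigIdx n) F, IsUnit T ∧
      ∀ i, Tᵀ * bigT ε A B i * T = bigT ε C D i := by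
  have hSS' : S * S' = 1 := mul_eq_one_comm.1 hSS
  obtain ⟨P, hP⟩ : ∃ P : Matrix (Fin 4 × Fin n) (Fin 4 × Fin n) F,
      P = blkDiag4 (fun _ => S') := ⟨_, rfl⟩
  obtain ⟨Q, hQ⟩ : ∃ Q : Matrix (Fin 4 × Fin n) (Fin 4 × Fin n) F,
      Q = blkDiag4 (fun _ => S) := ⟨_, rfl⟩
  have hPQ : P * Q = 1 := by rw [hP, hQ, blkDiag4_mul, hSS, blkDiag4_one]
  have hQP : Q * P = 1 := mul_eq_one_comm.1 hPQ
  have hG : ∀ i, P * bigG A B i * Q = bigG C D i := by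
    intro i
    fin_cases i
    · simpa [bigG] using hPQ
    · simp only [bigG, Fin.mk_one, Matrix.cons_val]
      rw [Matrix.mul_assoc, hQ, J4_mul_blkDiag4, ← hQ, ← Matrix.mul_assoc, hPQ, Matrix.one_mul]
    · simp only [bigG, Fin.reduceFinMk, Matrix.cons_val]
      rw [hP, hQ, blkDiag4_mul, blkDiag4_mul]
      congr 1
      funext k
      fin_cases k <;> simp [hSS, hA, hB]
  have hG' : ∀ i, Qᵀ * ((bigG A B i)ᵀ * Pᵀ) = (bigG C D i)ᵀ := fun i => by
    rw [← hG, Matrix.transpose_mul, Matrix.transpose_mul]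
  refine ⟨fromBlocks 1 0 0 (fromBlocks 1 0 0 (fromBlocks Pᵀ 0 0 Q)),
    IsUnit.of_mul_eq_one (fromBlocks 1 0 0 (fromBlocks 1 0 0 (fromBlocks Qᵀ 0 0 P))) ?_,
    fun i => ?_⟩
  · simp [fromBlocks_multiply, ← Matrix.transpose_mul, hQP]
  · simp [bigT_eq_dsum, dsum, nab, fromBlocks_multiply, fromBlocks_transpose, hG, hG',
      Matrix.mul_assoc]

/-- Lemma 8: pairs (A,B) and (C,D) of n×n matrices are similar iff `T(C,D)` is obtained from
`T(A,B)` by a nonsingular linear substitution of the three matrices followed by a congruence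
transformation. -/
theorem stmt13 [IsAlgClosed F] (hchar : ringChar F ≠ 2)
    (ε : F) (hε : ε = 1 ∨ ε = -1)
    (n : ℕ) (A B C D : Matrix (Fin n) (Fin n) F) :
    (∃ S : (Matrix (Fin n) (Fin n) F)ˣ,
        (↑S⁻¹ : Matrix (Fin n) (Fin n) F) * A * (↑S : Matrix (Fin n) (Fin n) F) = C ∧
        (↑S⁻¹ : Matrix (Fin n) (Fin n) F) * B * (↑S : Matrix (Fin n) (Fin n) F) = D) ↔
    (∃ γ : Matrix (Fin 3) (Fin 3) F, IsUnit γ ∧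
      ∃ S : Matrix (BigIdx n) (BigIdx n) F, IsUnit S ∧
        ∀ i, Sᵀ * (∑ j, γ i j • bigT ε A B j) * S = bigT ε C D i) := by
  have hεε : ε * ε = 1 := by rcases hε with rfl | rfl <;> simp
  have hε0 : ε ≠ 0 := fun h => by simp [h] at hεε
  constructor
  · rintro ⟨S, hA, hB⟩
    obtain ⟨T, hT, h⟩ := congruence_of_similar ε (Units.inv_mul S) hA hB
    refine ⟨1, isUnit_one, T, hT, fun i => ?_⟩
    rw [← h i]
    simp [Matrix.one_apply]
  · rintro ⟨γ, hγ, S, hS, h⟩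
    have hSt : IsUnit Sᵀ := (Matrix.isUnit_transpose S).2 hS
    obtain ⟨c, hc, rfl⟩ := substitution_scalar hεε A B C D hγ hSt hS h
    have hR : IsUnit (c • Sᵀ) := hSt.smul (Units.mk0 c hc)
    obtain ⟨S₀, hS₀, hA, hB⟩ := similar_of_equivalence hε0 (A := A) (B := B) (C := C) (D := D)
      hR hS fun i => by
        rw [← h i]
        simp [Matrix.one_apply]
    obtain ⟨S₀, rfl⟩ := hS₀
    refine ⟨S₀, ?_, ?_⟩
    · rw [Matrix.mul_assoc, hA, ← Matrix.mul_assoc, Units.inv_mul, Matrix.one_mul]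
    · rw [Matrix.mul_assoc, hB, ← Matrix.mul_assoc, Units.inv_mul, Matrix.one_mul]
end

section
/- Let F be an algebraically closed field of characteristic not 2, let l ≥ 1, λ ∈ F, and α, β, γ, δ ∈ F with α + βλ ≠ 0 and αδ − βγ ≠ 0. Then, taking ε = −1 in the ▽-construction, the pair (αI_l + βJ_l(λ), γI_l + δJ_l(λ))^▽ of skew-symmetric 2l×2l matrices is congruent to the pair (I_l, J_l(μ))^▽, where μ := (γ + δλ)/(α + βλ). -/
open Matrix

variable {F : Type} [Field F]

/-- `X^▽ = [[0, X],[−Xᵀ, 0]]` (the case ε = −1). -/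
def nabSkew {I J : Type} (X : Matrix I J F) : Matrix (I ⊕ J) (I ⊕ J) F :=
  Matrix.fromBlocks 0 X (-Xᵀ) 0

/-- The l×l upper-triangular Jordan block with eigenvalue λ. -/
def Jord (F : Type) [Field F] (l : ℕ) (lam : F) : Matrix (Fin l) (Fin l) F :=
  fun i j => if i = j then lam else if (i : ℕ) + 1 = (j : ℕ) then 1 else 0

theorem Jord_eq_smul_one_add (l : ℕ) (lam : F) :
    Jord F l lam = lam • (1 : Matrix (Fin l) (Fin l) F) + Jord F l 0 := by
  ext i j
  by_cases h : i = j <;> simp [Jord, h]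

theorem Jord_blockTriangular (l : ℕ) (lam : F) : (Jord F l lam).BlockTriangular id := by
  intro i j hij
  have hij' : (j : ℕ) < i := hij
  have h₁ : i ≠ j := by rintro rfl; omega
  have h₂ : (i : ℕ) + 1 ≠ j := by omega
  simp [Jord, h₁, h₂]

theorem mul_Jord_zero_apply {l : ℕ} (M : Matrix (Fin l) (Fin l) F) (i j k : Fin l)
    (h : (k : ℕ) + 1 = j) : (M * Jord F l 0) i j = M i k := by
  rw [Matrix.mul_apply, Finset.sum_eq_single k]
  · have hk : k ≠ j := by rintro rfl; omega
    simp [Jord, h, hk]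
  · intro b _ hb
    have : (b : ℕ) + 1 ≠ j := fun hb' => hb (Fin.ext (by omega))
    simp [Jord, this]
  · simp

theorem mul_Jord_zero_apply_zero {l : ℕ} (M : Matrix (Fin l) (Fin l) F) (i j : Fin l)
    (h : (j : ℕ) = 0) : (M * Jord F l 0) i j = 0 := by
  rw [Matrix.mul_apply]
  refine Finset.sum_eq_zero fun b _ => ?_
  have : (b : ℕ) + 1 ≠ j := by omega
  simp [Jord, this]

theorem blockTriangular_smul {l : ℕ} {M : Matrix (Fin l) (Fin l) F} (hM : M.BlockTriangular id)
    (c : F) : (c • M).BlockTriangular id := fun i j hij => by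
  simp [hM hij]

theorem isUnit_iff_diag_ne_zero {l : ℕ} {U : Matrix (Fin l) (Fin l) F}
    (hU : U.BlockTriangular id) : IsUnit U ↔ ∀ i, U i i ≠ 0 := by
  rw [Matrix.isUnit_iff_isUnit_det, Matrix.det_of_isUpperTriangular hU, isUnit_iff_ne_zero,
    Finset.prod_ne_zero_iff]
  simp

/-- An invertible upper-triangular multiple `U N` of the nilpotent Jordan block `N`, with `U`
commuting with `N`, is similar to `N`. -/
theorem exists_isUnit_mul_Jord_zero_mul {l : ℕ} {U : Matrix (Fin l) (Fin l) F}
    (hU : U.BlockTriangular id) (hunit : IsUnit U) (hcomm : Commute U (Jord F l 0)) :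
    ∃ T : Matrix (Fin l) (Fin l) F, IsUnit T ∧ U * Jord F l 0 * T = T * Jord F l 0 := by
  let T : Matrix (Fin l) (Fin l) F := fun i j => (U ^ (l - 1 - (j : ℕ))) i j
  have hT : T.BlockTriangular id := fun i j hij => hU.pow _ hij
  refine ⟨T, (isUnit_iff_diag_ne_zero hT).2 fun i =>
    (isUnit_iff_diag_ne_zero (hU.pow _)).1 (hunit.pow _) i, ?_⟩
  ext i j
  have key : (U * Jord F l 0 * T) i j = (U ^ (l - 1 - (j : ℕ) + 1) * Jord F l 0) i j := by
    have h : (U * Jord F l 0 * T) i j = (U * Jord F l 0 * U ^ (l - 1 - (j : ℕ))) i j := by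
      rw [Matrix.mul_apply, Matrix.mul_apply]
    rw [h, mul_assoc, ← (hcomm.pow_left _).eq, ← mul_assoc, ← pow_succ']
  rw [key]
  by_cases hj : (j : ℕ) = 0
  · rw [mul_Jord_zero_apply_zero _ _ _ hj, mul_Jord_zero_apply_zero _ _ _ hj]
  · let k : Fin l := ⟨j - 1, by omega⟩
    have hk : (k : ℕ) + 1 = j := by simp only [k]; omega
    rw [mul_Jord_zero_apply _ _ _ k hk, mul_Jord_zero_apply _ _ _ k hk]
    have : l - 1 - (j : ℕ) + 1 = l - 1 - (k : ℕ) := by omega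
    simp only [T, this]

theorem fromBlocks_transpose_mul_nabSkew_mul {l : ℕ} (P Q X : Matrix (Fin l) (Fin l) F) :
    (Matrix.fromBlocks Pᵀ 0 0 Q)ᵀ * nabSkew X * Matrix.fromBlocks Pᵀ 0 0 Q
      = nabSkew (P * X * Q) := by
  simp [nabSkew, Matrix.fromBlocks_transpose, Matrix.fromBlocks_multiply, Matrix.mul_assoc]

/-- If `α + βλ ≠ 0` and `αδ − βγ ≠ 0`, then the pair of skew-symmetric matrices
`(αI + βJ_l(λ), γI + δJ_l(λ))^▽` is congruent to `(I, J_l(μ))^▽` with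
`μ = (γ + δλ)/(α + βλ)`. -/
theorem stmt15 [IsAlgClosed F] (hchar : ringChar F ≠ 2)
    (l : ℕ) (hl : 1 ≤ l) (lam α β γ δ : F)
    (h1 : α + β * lam ≠ 0) (h2 : α * δ - β * γ ≠ 0) :
    ∃ S : Matrix (Fin l ⊕ Fin l) (Fin l ⊕ Fin l) F, IsUnit S ∧
      Sᵀ * nabSkew (α • (1 : Matrix (Fin l) (Fin l) F) + β • Jord F l lam) * S
        = nabSkew (1 : Matrix (Fin l) (Fin l) F) ∧
      Sᵀ * nabSkew (γ • (1 : Matrix (Fin l) (Fin l) F) + δ • Jord F l lam) * S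
        = nabSkew (Jord F l ((γ + δ * lam) / (α + β * lam))) := by
  set N := Jord F l 0 with hN
  set A := α • (1 : Matrix (Fin l) (Fin l) F) + β • Jord F l lam with hA
  set μ := (γ + δ * lam) / (α + β * lam) with hμ
  have hAtri : A.BlockTriangular id :=
    (blockTriangular_smul Matrix.blockTriangular_one α).add
      (blockTriangular_smul (Jord_blockTriangular l lam) β)
  have hAunit : IsUnit A := (isUnit_iff_diag_ne_zero hAtri).2 fun i => by
    simpa [hA, Jord] using h1
  have hAcomm : Commute A N := by
    rw [hA, Jord_eq_smul_one_add l lam]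
    exact ((Commute.one_left N).smul_left α).add_left
      ((((Commute.one_left N).smul_left lam).add_left (Commute.refl N)).smul_left β)
  have hdet : IsUnit A.det := (Matrix.isUnit_iff_isUnit_det A).1 hAunit
  have hinv : A⁻¹ * A = 1 := Matrix.nonsing_inv_mul A hdet
  have hinv' : A * A⁻¹ = 1 := Matrix.mul_nonsing_inv A hdet
  have hb : μ * (α + β * lam) = γ + δ * lam := div_mul_cancel₀ _ h1
  have hc : δ - μ * β ≠ 0 := by
    have : δ - μ * β = (α * δ - β * γ) / (α + β * lam) := by
      rw [eq_div_iff h1]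
      linear_combination -β * hb
    rw [this]
    exact div_ne_zero h2 h1
  have hB : γ • (1 : Matrix (Fin l) (Fin l) F) + δ • Jord F l lam
      = μ • A + (δ - μ * β) • N := by
    rw [hA, Jord_eq_smul_one_add l lam]
    have : γ = μ * (α + β * lam) - δ * lam := by rw [hb]; ring
    rw [this]
    module
  have hAinvtri : A⁻¹.BlockTriangular id := by
    have := hAunit.invertible
    exact Matrix.blockTriangular_inv_of_blockTriangular hAtri
  have hAinvunit : IsUnit A⁻¹ := IsUnit.of_mul_eq_one A hinv
  have hAinvcomm : Commute A⁻¹ N := by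
    calc A⁻¹ * N = A⁻¹ * (N * A) * A⁻¹ := by
          rw [mul_assoc, mul_assoc, hinv', mul_one]
      _ = N * A⁻¹ := by rw [← hAcomm.eq, ← mul_assoc, hinv, one_mul]
  obtain ⟨T, hT, hTN⟩ := exists_isUnit_mul_Jord_zero_mul (U := (δ - μ * β) • A⁻¹)
    (blockTriangular_smul hAinvtri _) (hAinvunit.smul (Units.mk0 _ hc)) (hAinvcomm.smul_left _)
  have hTinv : T⁻¹ * T = 1 :=
    Matrix.nonsing_inv_mul T ((Matrix.isUnit_iff_isUnit_det T).1 hT)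
  have hPunit : IsUnit (T⁻¹ * A⁻¹) := (IsUnit.of_mul_eq_one T hTinv).mul hAinvunit
  refine ⟨Matrix.fromBlocks (T⁻¹ * A⁻¹)ᵀ 0 0 T, ?_, ?_, ?_⟩
  · rw [Matrix.isUnit_iff_isUnit_det, Matrix.det_fromBlocks_zero₂₁, Matrix.det_transpose]
    exact ((Matrix.isUnit_iff_isUnit_det _).1 hPunit).mul ((Matrix.isUnit_iff_isUnit_det _).1 hT)
  · rw [fromBlocks_transpose_mul_nabSkew_mul, mul_assoc T⁻¹, hinv, mul_one, hTinv]
  · rw [fromBlocks_transpose_mul_nabSkew_mul, hB, Jord_eq_smul_one_add l μ]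
    congr 1
    calc T⁻¹ * A⁻¹ * (μ • A + (δ - μ * β) • N) * T
        = μ • (T⁻¹ * (A⁻¹ * A) * T) + T⁻¹ * ((δ - μ * β) • A⁻¹ * N * T) := by
          simp only [mul_add, add_mul, mul_smul_comm, smul_mul_assoc, mul_assoc]
      _ = μ • 1 + N := by
          rw [hTN, hinv, mul_one, ← mul_assoc, hTinv, one_mul]
end

section
/- Let F be an algebraically closed field of characteristic not 2 and let L be a Lie algebra over F of dimension n whose commutator subalgebra L² is central ([[a,b],c] = 0 for all a,b,c ∈ L) and has dimension 2. Then L is isomorphic to the Lie algebra on F^n with bracket [u,v] := (uᵀ[[0₂,0],[0,A]]v, uᵀ[[0₂,0],[0,B]]v, 0,…,0)ᵀ, where (A,B) is a pair of skew-symmetric (n−2)×(n−2) matrices of the form ⊕_{i=1}^{p}(I_{l_i}, J_{l_i}(λ_i))^▽ ⊕ ⊕_{j=1}^{q}(F_{r_j}, G_{r_j})^▽ (with ε = −1 in the ▽-construction, p,q ≥ 0), excluding the degenerate case in which λ₁ = ⋯ = λ_p and l₁ = ⋯ = l_p = r₁ = ⋯ = r_q = 1. -/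
open Matrix

variable {F : Type} [Field F]

/-- The (m−1)×m matrix `F_m = [I_{m−1} | 0]`. -/
def Fmat (F : Type) [Field F] (m : ℕ) : Matrix (Fin (m - 1)) (Fin m) F :=
  fun i j => if (i : ℕ) = (j : ℕ) then 1 else 0

/-- The (m−1)×m matrix `G_m = [0 | I_{m−1}]`. -/
def Gmat (F : Type) [Field F] (m : ℕ) : Matrix (Fin (m - 1)) (Fin m) F :=
  fun i j => if (i : ℕ) + 1 = (j : ℕ) then 1 else 0

/-- Index type of the canonical pair
`⊕ᵢ (I_{lᵢ}, J_{lᵢ}(λᵢ))^▽ ⊕ ⊕ⱼ (F_{rⱼ}, G_{rⱼ})^▽` of skew-symmetric matrices. -/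
abbrev CIdx (p q : ℕ) (l : Fin p → ℕ) (r : Fin q → ℕ) : Type :=
  (Σ i : Fin p, (Fin (l i) ⊕ Fin (l i))) ⊕ (Σ j : Fin q, (Fin (r j - 1) ⊕ Fin (r j)))

/-- First matrix `A = ⊕ᵢ I_{lᵢ}^▽ ⊕ ⊕ⱼ F_{rⱼ}^▽` of the canonical pair. -/
def canA (F : Type) [Field F] (p q : ℕ) (l : Fin p → ℕ) (r : Fin q → ℕ) :
    Matrix (CIdx p q l r) (CIdx p q l r) F :=
  Matrix.fromBlocks
    (Matrix.blockDiagonal' (fun i => nabSkew (1 : Matrix (Fin (l i)) (Fin (l i)) F))) 0 0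
    (Matrix.blockDiagonal' (fun j => nabSkew (Fmat F (r j))))

/-- Second matrix `B = ⊕ᵢ J_{lᵢ}(λᵢ)^▽ ⊕ ⊕ⱼ G_{rⱼ}^▽` of the canonical pair. -/
def canB (F : Type) [Field F] (p q : ℕ) (l : Fin p → ℕ) (r : Fin q → ℕ)
    (lam : Fin p → F) : Matrix (CIdx p q l r) (CIdx p q l r) F :=
  Matrix.fromBlocks
    (Matrix.blockDiagonal' (fun i => nabSkew (Jord F (l i) (lam i)))) 0 0
    (Matrix.blockDiagonal' (fun j => nabSkew (Gmat F (r j))))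

/-- The Lie bracket on `F^n` (coordinates indexed by `Fin 2 ⊕ CIdx`):
`[u,v] = (uᵀ[[0,0],[0,A]]v, uᵀ[[0,0],[0,B]]v, 0, …, 0)ᵀ` for the canonical pair `(A,B)`. -/
def canBr (F : Type) [Field F] (p q : ℕ) (l : Fin p → ℕ) (r : Fin q → ℕ)
    (lam : Fin p → F) (u v : (Fin 2 ⊕ CIdx p q l r) → F) :
    (Fin 2 ⊕ CIdx p q l r) → F :=
  Sum.elim
    (fun k : Fin 2 => ∑ x, ∑ y,
      u (Sum.inr x) * (![canA F p q l r, canB F p q l r lam] k) x y * v (Sum.inr y))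
    (fun _ => 0)

section PencilChains

variable {V : Type} [AddCommGroup V] [Module F V]

/-- Every vector in the kernel of `A` starts a finite chain `x₀, x₁, …` with `A xₖ₊₁ = B xₖ`,
i.e. it extends to a polynomial vector in the kernel of the pencil; equivalently the pencil
spanned by `A` and `B` has no elementary divisor at infinity. -/
def KernelChains (A B : V →ₗ[F] V →ₗ[F] F) : Prop :=
  ∀ v, A v = 0 → ∃ x : ℕ → V, x 0 = v ∧ (∀ k, A (x (k + 1)) = B (x k)) ∧
    ∃ N, ∀ k, N ≤ k → x k = 0

open Polynomial in
theorem exists_kernelChains_add_smul [Infinite F] [Module.Finite F V]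
    (A B : V →ₗ[F] V →ₗ[F] F) : ∃ c : F, KernelChains (A + c • B) B := by
  classical
  by_contra hcon
  simp only [KernelChains] at hcon
  push Not at hcon
  choose v hv hbad using hcon
  set d := Module.finrank F V with hd
  obtain ⟨c⟩ : Nonempty (Fin (d + 1) ↪ F) :=
    ⟨Fin.valEmbedding.trans (Infinite.natEmbedding F)⟩
  have hdep : ¬ LinearIndependent F (fun i => B (v (c i))) := by
    intro h
    have := h.fintype_card_le_finrank
    have h2 : Module.finrank F (V →ₗ[F] F) = d := Subspace.dual_finrank_eq
    simp [h2] at this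
  obtain ⟨a, ha, i, hi⟩ := Fintype.not_linearIndependent_iff.1 hdep
  let q : Fin (d + 1) → F[X] := fun j => ∏ k ∈ Finset.univ.erase j, (C (c i - c k) - X)
  have hq : ∀ j, (C (c i - c j) - X) * q j = ∏ k, (C (c i - c k) - X) := fun j =>
    Finset.mul_prod_erase Finset.univ (fun k => (C (c i - c k) - X : F[X])) (Finset.mem_univ j)
  have hq0 : ∀ j, j ≠ i → (q j).coeff 0 = 0 := by
    intro j hj
    rw [coeff_zero_eq_eval_zero, eval_prod]
    exact Finset.prod_eq_zero (i := i) (by simp [hj.symm]) (by simp)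
  have hqi : (q i).coeff 0 ≠ 0 := by
    rw [coeff_zero_eq_eval_zero, eval_prod, Finset.prod_ne_zero_iff]
    intro k hk
    have : c i ≠ c k := fun h => (Finset.ne_of_mem_erase hk) (c.injective h).symm
    simpa using sub_ne_zero.2 this
  have hA : ∀ j, (A + c i • B) (v (c j)) = (c i - c j) • B (v (c j)) := by
    intro j
    have h := hv (c j)
    simp only [LinearMap.add_apply, LinearMap.smul_apply] at h ⊢
    rw [eq_neg_of_add_eq_zero_left h]
    module
  let s := a i * (q i).coeff 0
  have hs : s ≠ 0 := mul_ne_zero hi hqi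
  let x : ℕ → V := fun k => s⁻¹ • ∑ j, (a j * (q j).coeff k) • v (c j)
  have hx0 : x 0 = v (c i) := by
    simp only [x]
    rw [Finset.sum_eq_single i]
    · rw [smul_smul, inv_mul_cancel₀ hs, one_smul]
    · intro j _ hj
      simp [hq0 j hj]
    · simp
  have hx : ∀ k, (A + c i • B) (x (k + 1)) = B (x k) := by
    intro k
    simp only [x]
    simp only [map_smul, map_sum, hA]
    congr 1
    rw [← sub_eq_zero, ← Finset.sum_sub_distrib]
    have : ∀ j, (a j * (q j).coeff (k + 1)) • (c i - c j) • B (v (c j)) -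
        (a j * (q j).coeff k) • B (v (c j)) =
        (∏ k, (C (c i - c k) - X) : F[X]).coeff (k + 1) • (a j • B (v (c j))) := by
      intro j
      rw [← hq j, sub_mul, coeff_sub, coeff_C_mul, coeff_X_mul]
      module
    rw [Finset.sum_congr rfl fun j _ => this j, ← Finset.smul_sum, ha, smul_zero]
  obtain ⟨k, hk, hne⟩ := hbad (c i) x hx0 hx (Finset.univ.sup (fun j => (q j).natDegree) + 1)
  refine hne ?_
  simp only [x]
  rw [Finset.sum_eq_zero, smul_zero]
  intro j _
  have : (q j).natDegree ≤ Finset.univ.sup (fun j => (q j).natDegree) :=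
    Finset.le_sup (f := fun j => (q j).natDegree) (Finset.mem_univ j)
  rw [coeff_eq_zero_of_natDegree_lt (by omega), mul_zero, zero_smul]

end PencilChains

section OrthogonalBlocks

variable {V : Type} [AddCommGroup V] [Module F V] {K : Type} [Fintype K] [DecidableEq K]

/-- The family `c` spans a subspace on which `A`, `B` have Gram matrices `M`, `N`, and which is
orthogonal for both forms to the complement cut out by the dual functionals `φ`. -/
structure IsOrthogonalBlock (A B : V →ₗ[F] V →ₗ[F] F) (M N : Matrix K K F)
    (c : K → V) (φ : K → V →ₗ[F] F) : Prop where
  dual : ∀ i j, φ i (c j) = if i = j then 1 else 0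
  gram_left : ∀ i j, A (c i) (c j) = M i j
  gram_right : ∀ i j, B (c i) (c j) = N i j
  orth_left : ∀ k u, (∀ i, φ i u = 0) → A (c k) u = 0
  orth_right : ∀ k u, (∀ i, φ i u = 0) → B (c k) u = 0

/-- The projection onto the common kernel of `φ` along the span of the dual family `c`. -/
noncomputable def kerProj (c : K → V) (φ : K → V →ₗ[F] F)
    (h : ∀ i j, φ i (c j) = if i = j then 1 else 0) :
    V →ₗ[F] LinearMap.ker (LinearMap.pi φ) :=
  LinearMap.codRestrict _ (LinearMap.id - ∑ k, (φ k).smulRight (c k)) (by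
    intro v
    rw [LinearMap.mem_ker]
    ext i
    simp [h])

theorem coe_kerProj (c : K → V) (φ : K → V →ₗ[F] F)
    (h : ∀ i j, φ i (c j) = if i = j then 1 else 0) (v : V) :
    (kerProj c φ h v : V) = v - ∑ k, φ k v • c k := by
  simp [kerProj]

theorem apply_eq_zero_of_mem_ker {J : Type} {φ : J → V →ₗ[F] F}
    (u : LinearMap.ker (LinearMap.pi φ)) (i : J) : φ i (u : V) = 0 :=
  congrFun (LinearMap.mem_ker.1 u.2) i

/-- The decomposition of `V` as the span of `c` plus the common kernel of `φ`. -/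
noncomputable def kerSplit (c : K → V) (φ : K → V →ₗ[F] F)
    (h : ∀ i j, φ i (c j) = if i = j then 1 else 0) :
    V ≃ₗ[F] (K → F) × LinearMap.ker (LinearMap.pi φ) :=
  LinearEquiv.ofLinearMap ((LinearMap.pi φ).prod (kerProj c φ h))
    (LinearMap.coprod (Fintype.linearCombination F c) (Submodule.subtype _))
    (by
      refine LinearMap.ext fun ⟨f, u⟩ => ?_
      have hu := apply_eq_zero_of_mem_ker u
      have hf : ∀ i, φ i (∑ k, f k • c k + u) = f i := by simp [h, hu]
      refine Prod.ext (funext fun i => ?_) (Subtype.ext ?_)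
      · simpa [Fintype.linearCombination_apply, hu] using hf i
      · change (kerProj c φ h (Fintype.linearCombination F c f + u) : V) = u
        simp only [coe_kerProj, Fintype.linearCombination_apply, hf]
        abel)
    (by
      refine LinearMap.ext fun v => ?_
      simp [Fintype.linearCombination_apply, coe_kerProj])

theorem kerSplit_symm_apply (c : K → V) (φ : K → V →ₗ[F] F)
    (h : ∀ i j, φ i (c j) = if i = j then 1 else 0) (f : K → F)
    (u : LinearMap.ker (LinearMap.pi φ)) :
    (kerSplit c φ h).symm (f, u) = ∑ k, f k • c k + u := by
  simp [kerSplit, Fintype.linearCombination_apply]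

theorem exists_basis_sum (c : K → V) (φ : K → V →ₗ[F] F)
    (h : ∀ i j, φ i (c j) = if i = j then 1 else 0) {J : Type}
    (b : Module.Basis J F (LinearMap.ker (LinearMap.pi φ))) :
    ∃ b' : Module.Basis (K ⊕ J) F V, (∀ k, b' (Sum.inl k) = c k) ∧
      ∀ j, b' (Sum.inr j) = b j := by
  refine ⟨((Pi.basisFun F K).prod b).map (kerSplit c φ h).symm, fun k => ?_, fun j => ?_⟩
  · rw [Module.Basis.map_apply, Module.Basis.prod_apply]
    simp [kerSplit_symm_apply, Pi.single_apply]
  · rw [Module.Basis.map_apply, Module.Basis.prod_apply]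
    simp [kerSplit_symm_apply]

theorem finrank_ker_lt [Module.Finite F V] [Nonempty K] (c : K → V) (φ : K → V →ₗ[F] F)
    (h : ∀ i j, φ i (c j) = if i = j then 1 else 0) :
    Module.finrank F (LinearMap.ker (LinearMap.pi φ)) < Module.finrank F V := by
  rw [(kerSplit c φ h).finrank_eq, Module.finrank_prod, Module.finrank_fintype_fun_eq_card]
  have := Fintype.card_pos (α := K)
  omega

theorem IsOrthogonalBlock.kernelChains {A B : V →ₗ[F] V →ₗ[F] F} {M N : Matrix K K F}
    {c : K → V} {φ : K → V →ₗ[F] F} (H : IsOrthogonalBlock A B M N c φ) (hA : A.IsAlt)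
    (hG : KernelChains A B) :
    KernelChains (A.domRestrict₁₂ (LinearMap.ker (LinearMap.pi φ)) (LinearMap.ker (LinearMap.pi φ)))
      (B.domRestrict₁₂ (LinearMap.ker (LinearMap.pi φ)) (LinearMap.ker (LinearMap.pi φ))) := by
  intro u hu
  have hAu : A u = 0 := by
    ext v
    obtain ⟨⟨f, w⟩, rfl⟩ := (kerSplit c φ H.dual).symm.surjective v
    have h1 : A (u : V) (w : V) = 0 := LinearMap.congr_fun hu w
    have h2 : ∀ k, A (u : V) (c k) = 0 := fun k => by
      rw [← hA.neg, H.orth_left k u (apply_eq_zero_of_mem_ker u), neg_zero]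
    rw [kerSplit_symm_apply]
    simp [h1, h2]
  obtain ⟨x, hx0, hx, n, hn⟩ := hG u hAu
  refine ⟨fun k => kerProj c φ H.dual (x k), ?_, fun k => ?_, n, fun k hk => ?_⟩
  · refine Subtype.ext ?_
    rw [coe_kerProj, hx0]
    simp [apply_eq_zero_of_mem_ker u]
  · ext w
    have hw := apply_eq_zero_of_mem_ker w
    have := LinearMap.congr_fun (hx k) w
    change A (kerProj c φ H.dual (x (k + 1)) : V) w = B (kerProj c φ H.dual (x k) : V) w
    simp [coe_kerProj, H.orth_left _ _ hw, H.orth_right _ _ hw, this]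
  · simp [hn k hk]

end OrthogonalBlocks
section SingularBlock

variable {V : Type} [AddCommGroup V] [Module F V]

/-- A chain `x₀, …, x_{N-1}` of coefficients of a polynomial vector in the kernel of the pencil
spanned by `A` and `B`. -/
structure IsNullChain (A B : V →ₗ[F] V →ₗ[F] F) (N : ℕ) (x : ℕ → V) : Prop where
  head : A (x 0) = 0
  step : ∀ k, A (x (k + 1)) = B (x k)
  tail : ∀ k, N ≤ k → x k = 0

theorem exists_functional_of_ker_le {W W' : Type} [AddCommGroup W] [Module F W] [AddCommGroup W']
    [Module F W'] (Φ : W →ₗ[F] W') (ψ : W →ₗ[F] F) (h : LinearMap.ker Φ ≤ LinearMap.ker ψ) :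
    ∃ θ : W' →ₗ[F] F, ∀ w, ψ w = θ (Φ w) := by
  have h1 : ψ ∈ (LinearMap.ker Φ).dualAnnihilator := by
    rw [Submodule.mem_dualAnnihilator]
    exact fun w hw => h hw
  rw [← LinearMap.range_dualMap_eq_dualAnnihilator_ker] at h1
  obtain ⟨θ, rfl⟩ := h1
  exact ⟨θ, fun w => rfl⟩

theorem exists_representing_vectors [Module.Finite F V] {m : ℕ}
    (θ : (Fin m → (V →ₗ[F] F)) →ₗ[F] F) :
    ∃ u : ℕ → V, (∀ k, m ≤ k → u k = 0) ∧
      ∀ f : ℕ → (V →ₗ[F] F), θ (fun j => f j) = ∑ j ∈ Finset.range m, f j (u j) := by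
  classical
  refine ⟨fun k => if h : k < m then (Module.evalEquiv F V).symm
    (θ ∘ₗ LinearMap.single F (fun _ => V →ₗ[F] F) ⟨k, h⟩) else 0, fun k hk => ?_, fun f => ?_⟩
  · simp [Nat.not_lt.2 hk]
  · have h : ∀ j : Fin m, θ (Pi.single j (f j)) =
        f j (if h : (j : ℕ) < m then (Module.evalEquiv F V).symm
          (θ ∘ₗ LinearMap.single F (fun _ => V →ₗ[F] F) ⟨j, h⟩) else 0) := by
      intro j
      rw [dif_pos j.2]
      exact (Module.apply_evalEquiv_symm_apply F V (f j)
        (θ ∘ₗ LinearMap.single F (fun _ => V →ₗ[F] F) j)).symm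
    rw [← Fin.sum_univ_eq_sum_range (fun j => f j (if h : j < m then (Module.evalEquiv F V).symm
          (θ ∘ₗ LinearMap.single F (fun _ => V →ₗ[F] F) ⟨j, h⟩) else 0)) m,
      ← Finset.sum_congr rfl fun j _ => h j, ← map_sum, Finset.univ_sum_single]

theorem IsNullChain.exists_dual_chain [Module.Finite F V] {A B : V →ₗ[F] V →ₗ[F] F}
    (hA : A.IsAlt) (hB : B.IsAlt) {m : ℕ} {x₀ : V} (hx₀ : A x₀ = 0)
    (hmin : ∀ x, IsNullChain A B (m + 1) x → x 0 ≠ x₀) :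
    ∃ y : ℕ → V, (∀ j < m, B (y (j + 1)) = A (y j)) ∧ B (y 0) x₀ = 1 := by
  classical
  suffices ∃ y : ℕ → V, (∀ j < m, B (y (j + 1)) = A (y j)) ∧ B (y 0) x₀ ≠ 0 by
    obtain ⟨y, hy, h0⟩ := this
    refine ⟨fun k => (B (y 0) x₀)⁻¹ • y k, fun j hj => ?_, ?_⟩
    · simp [hy j hj]
    · simp [h0]
  by_contra hcon
  push Not at hcon
  let Φ : (ℕ → V) →ₗ[F] (Fin m → (V →ₗ[F] F)) := LinearMap.pi fun j =>
    B ∘ₗ LinearMap.proj ((j : ℕ) + 1) - A ∘ₗ LinearMap.proj (j : ℕ)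
  let ψ : (ℕ → V) →ₗ[F] F := (LinearMap.applyₗ x₀) ∘ₗ B ∘ₗ LinearMap.proj 0
  obtain ⟨θ, hθ⟩ := exists_functional_of_ker_le Φ ψ (by
    intro y hy
    refine hcon y fun j hj => ?_
    exact sub_eq_zero.1 (congrFun (LinearMap.mem_ker.1 hy) ⟨j, hj⟩))
  obtain ⟨u, hu, hθu⟩ := exists_representing_vectors θ
  have key : ∀ y : ℕ → V, B (y 0) x₀ =
      ∑ j ∈ Finset.range m, (B (y (j + 1)) (u j) - A (y j) (u j)) := fun y =>
    (hθ y).trans (hθu fun j => B (y (j + 1)) - A (y j))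
  have key0 : ∀ z, B z x₀ = -A z (u 0) := by
    intro z
    have := key (Pi.single 0 z)
    rcases Nat.eq_zero_or_pos m with rfl | hm
    · simpa [hu] using this
    · rw [Finset.sum_eq_single 0] at this
      · simpa using this
      · intro j _ hj
        simp [hj]
      · simp [hm.ne']
  have keyS : ∀ k z, k < m → B z (u k) = A z (u (k + 1)) := by
    intro k z hk
    have := key (Pi.single (k + 1) z)
    simp only [Finset.sum_sub_distrib] at this
    rw [Finset.sum_eq_single k, Finset.sum_eq_single (k + 1)] at this
    · simpa [sub_eq_zero] using this.symm
    · intro j _ hj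
      simp [hj]
    · intro hj
      simp [hu (k + 1) (by simpa using hj)]
    · intro j _ hj
      simp [hj]
    · simp [hk]
  refine hmin (fun k => Nat.casesOn k x₀ fun k => -u k) ⟨hx₀, fun k => ?_, fun k hk => ?_⟩ rfl
  · ext z
    rcases k with _ | k
    · change A (-u 0) z = B x₀ z
      rw [← hB.neg, key0, ← hA.neg]
      simp
    · change A (-u (k + 1)) z = B (-u k) z
      rcases lt_or_ge k m with hk | hk
      · rw [← hA.neg, ← hB.neg]
        simp [keyS k z hk]
      · simp [hu k hk, hu (k + 1) (by omega)]
  · rcases k with _ | k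
    · omega
    · change -u k = 0
      rw [hu k (by omega), neg_zero]

theorem IsNullChain.left_apply_eq_zero {A B : V →ₗ[F] V →ₗ[F] F} (hA : A.IsAlt) (hB : B.IsAlt)
    {N : ℕ} {x : ℕ → V} (hx : IsNullChain A B N x) : ∀ i j, A (x i) (x j) = 0 := by
  intro i
  induction i with
  | zero => simp [hx.head]
  | succ i ih =>
    intro j
    rw [hx.step, ← hB.neg, ← hx.step, hA.neg, ih]

theorem left_apply_eq_zero_of_chain {A B : V →ₗ[F] V →ₗ[F] F} (hA : A.IsAlt) (hB : B.IsAlt)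
    {m : ℕ} {y : ℕ → V} (hy : ∀ j < m, B (y (j + 1)) = A (y j)) :
    ∀ i j, i ≤ m → j ≤ m → A (y i) (y j) = 0 := by
  have shift : ∀ i j, j < m → A (y (i + 1)) (y j) = -B (y (j + 1)) (y (i + 1)) := by
    intro i j hj
    rw [hy j hj, hA.neg]
  have key : ∀ d j, j + d ≤ m → A (y (j + d)) (y j) = 0 := by
    intro d
    induction d using Nat.strong_induction_on with
    | _ d ih =>
      intro j hj
      rcases d with _ | _ | d
      · exact hA.self_eq_zero _
      · rw [shift j j (by omega), hB.self_eq_zero, neg_zero]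
      · have h1 := ih d (by omega) (j + 1) (by omega)
        rw [← add_assoc, ← add_assoc, shift (j + d + 1) j (by omega), hB.neg,
          hy (j + d + 1) (by omega), show j + d + 1 = j + 1 + d by omega, h1]
  intro i j hi hj
  rcases le_total j i with h | h
  · obtain ⟨d, rfl⟩ := Nat.exists_eq_add_of_le h
    exact key d j hi
  · obtain ⟨d, rfl⟩ := Nat.exists_eq_add_of_le h
    rw [← hA.neg, key d i hj, neg_zero]

theorem isOrthogonalBlock_one {A B : V →ₗ[F] V →ₗ[F] F} {v : V} (hA : A v = 0) (hB : B v = 0)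
    {f : V →ₗ[F] F} (hf : f v = 1) :
    IsOrthogonalBlock A B (nabSkew (Fmat F 1)) (nabSkew (Gmat F 1)) (fun _ => v) (fun _ => f) where
  dual := by
    rintro (i | i) (j | j)
    · exact i.elim0
    · exact i.elim0
    · exact j.elim0
    · simp [hf, Subsingleton.elim i j]
  gram_left := by
    rintro (i | i) (j | j)
    · exact i.elim0
    · exact i.elim0
    · exact j.elim0
    · simp [hA, nabSkew]
  gram_right := by
    rintro (i | i) (j | j)
    · exact i.elim0
    · exact i.elim0
    · exact j.elim0
    · simp [hB, nabSkew]
  orth_left := by simp [hA]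
  orth_right := by simp [hB]

theorem IsNullChain.isOrthogonalBlock {A B : V →ₗ[F] V →ₗ[F] F} (hA : A.IsAlt) (hB : B.IsAlt)
    {m : ℕ} {x y : ℕ → V} (hx : IsNullChain A B (m + 2) x)
    (hy : ∀ j < m, B (y (j + 1)) = A (y j)) (h0 : B (y 0) (x 0) = 1) :
    IsOrthogonalBlock A B (nabSkew (Fmat F (m + 2))) (nabSkew (Gmat F (m + 2)))
      (Sum.elim (fun i : Fin (m + 2 - 1) => y (m - i)) (fun j : Fin (m + 2) => x (m + 1 - j)))
      (Sum.elim (fun i : Fin (m + 2 - 1) => -B (x (m - i)))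
        (fun j : Fin (m + 2) => if (j : ℕ) = 0 then A (y m) else B (y (m + 1 - j)))) := by
  have hAxx := hx.left_apply_eq_zero hA hB
  have hBxx : ∀ i j, B (x i) (x j) = 0 := fun i j => by rw [← hx.step, hAxx]
  have hAyy := left_apply_eq_zero_of_chain hA hB hy
  have hByy : ∀ i j, i ≤ m → j ≤ m → B (y i) (y j) = 0 := by
    intro i j hi hj
    rcases i with _ | i
    · rcases j with _ | j
      · exact hB.self_eq_zero _
      · rw [← hB.neg, hy j (by omega), hAyy _ _ (by omega) hi, neg_zero]
    · rw [hy i (by omega), hAyy _ _ (by omega) hj]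
  have hAyx : ∀ j i, A (y j) (x (i + 1)) = B (y j) (x i) := by
    intro j i
    rw [← hA.neg, hx.step, hB.neg]
  have hAyx0 : ∀ j, A (y j) (x 0) = 0 := by
    intro j
    rw [← hA.neg, hx.head, LinearMap.zero_apply, neg_zero]
  have hBx : B (x (m + 1)) = 0 := by rw [← hx.step, hx.tail _ le_rfl, map_zero]
  have hByx : ∀ j, j ≤ m → ∀ i, i ≤ m + 1 → B (y j) (x i) = if i = j then 1 else 0 := by
    have hdiag : ∀ k j i, j + k ≤ m → B (y j) (x i) = B (y (j + k)) (x (i + k)) := by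
      intro k
      induction k with
      | zero => intros; rfl
      | succ k ih =>
        intro j i hj
        rw [ih j i (by omega), ← add_assoc, ← add_assoc, hy _ (by omega), hAyx]
    intro j hj i hi
    rcases lt_trichotomy i j with h | rfl | h
    · obtain ⟨k, rfl⟩ : ∃ k, j = k + 1 + i := ⟨j - i - 1, by omega⟩
      have := hdiag i (k + 1) 0 hj
      rw [zero_add] at this
      rw [if_neg (by omega), ← this, hy k (by omega), hAyx0]
    · have := hdiag i 0 0 (by omega)
      rw [zero_add] at this
      rw [if_pos rfl, ← this, h0]
    · obtain ⟨k, rfl⟩ : ∃ k, i = j + 1 + k := ⟨i - j - 1, by omega⟩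
      rw [if_neg (by omega), hdiag (m - j - k) j _ (by omega),
        show j + 1 + k + (m - j - k) = m + 1 by omega, ← hB.neg, hBx, LinearMap.zero_apply,
        neg_zero]
  have hAyx' : ∀ j, j ≤ m → ∀ i, i ≤ m + 1 → A (y j) (x i) = if i = j + 1 then 1 else 0 := by
    intro j hj i hi
    rcases i with _ | i
    · rw [hAyx0, if_neg (by omega)]
    · rw [hAyx, hByx j hj i (by omega)]
      simp
  have hφy : ∀ u, (∀ j : Fin (m + 2), (if (j : ℕ) = 0 then A (y m) else B (y (m + 1 - j))) u = 0) →
      ∀ k, k ≤ m → A (y k) u = 0 ∧ B (y k) u = 0 := by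
    intro u hu
    have h1 : ∀ k, k ≤ m → B (y k) u = 0 := by
      intro k hk
      have := hu ⟨m + 1 - k, by omega⟩
      rw [if_neg (by simp; omega)] at this
      simpa [show m + 1 - (m + 1 - k) = k by omega] using this
    intro k hk
    refine ⟨?_, h1 k hk⟩
    rcases hk.lt_or_eq with h | rfl
    · rw [← hy k h, h1 _ h]
    · simpa using hu 0
  have hφx : ∀ u, (∀ i : Fin (m + 2 - 1), (-B (x (m - i))) u = 0) →
      ∀ k, k ≤ m + 1 → A (x k) u = 0 ∧ B (x k) u = 0 := by
    intro u hu
    have h1 : ∀ k, k ≤ m + 1 → B (x k) u = 0 := by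
      intro k hk
      rcases hk.lt_or_eq with h | rfl
      · have := hu ⟨m - k, by omega⟩
        simpa [show m - (m - k) = k by omega] using this
      · simp [hBx]
    intro k hk
    refine ⟨?_, h1 k hk⟩
    rcases k with _ | k
    · simp [hx.head]
    · rw [hx.step, h1 _ (by omega)]
  constructor
  · rintro (⟨i, hi⟩ | ⟨i, hi⟩) (⟨j, hj⟩ | ⟨j, hj⟩)
    · simp only [Sum.elim_inl, LinearMap.neg_apply, hB.neg, Sum.inl.injEq, Fin.mk.injEq]
      rw [hByx _ (by omega) _ (by omega)]
      exact if_congr (by omega) rfl rfl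
    · simp [hBxx]
    · simp only [Sum.elim_inl, Sum.elim_inr, reduceCtorEq, if_false]
      split_ifs
      · exact hAyy _ _ le_rfl (by omega)
      · exact hByy _ _ (by omega) (by omega)
    · simp only [Sum.elim_inr, Sum.inr.injEq, Fin.mk.injEq]
      split_ifs with h1 h2 h2
      · rw [hAyx' _ le_rfl _ (by omega), if_pos (by omega)]
      · rw [hAyx' _ le_rfl _ (by omega), if_neg (by omega)]
      · rw [hByx _ (by omega) _ (by omega), if_pos (by omega)]
      · rw [hByx _ (by omega) _ (by omega), if_neg (by omega)]
  · rintro (⟨i, hi⟩ | ⟨i, hi⟩) (⟨j, hj⟩ | ⟨j, hj⟩)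
    · simp [nabSkew, hAyy (m - i) (m - j) (by omega) (by omega)]
    · simp only [nabSkew, Fmat, Sum.elim_inl, Sum.elim_inr, Matrix.fromBlocks_apply₁₂]
      rw [hAyx' _ (by omega) _ (by omega)]
      exact if_congr (by omega) rfl rfl
    · simp only [nabSkew, Fmat, Sum.elim_inl, Sum.elim_inr, Matrix.fromBlocks_apply₂₁,
        Matrix.neg_apply, Matrix.transpose_apply]
      rw [← hA.neg, hAyx' _ (by omega) _ (by omega)]
      exact congrArg _ (if_congr (by omega) rfl rfl)
    · simp [nabSkew, hAxx]
  · rintro (⟨i, hi⟩ | ⟨i, hi⟩) (⟨j, hj⟩ | ⟨j, hj⟩)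
    · simp [nabSkew, hByy (m - i) (m - j) (by omega) (by omega)]
    · simp only [nabSkew, Gmat, Sum.elim_inl, Sum.elim_inr, Matrix.fromBlocks_apply₁₂]
      rw [hByx _ (by omega) _ (by omega)]
      exact if_congr (by omega) rfl rfl
    · simp only [nabSkew, Gmat, Sum.elim_inl, Sum.elim_inr, Matrix.fromBlocks_apply₂₁,
        Matrix.neg_apply, Matrix.transpose_apply]
      rw [← hB.neg, hByx _ (by omega) _ (by omega)]
      exact congrArg _ (if_congr (by omega) rfl rfl)
    · simp [nabSkew, hBxx]
  · rintro (i | i) u hu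
    · exact (hφy u (fun j => hu (Sum.inr j)) _ (by omega)).1
    · exact (hφx u (fun j => hu (Sum.inl j)) _ (by omega)).1
  · rintro (i | i) u hu
    · exact (hφy u (fun j => hu (Sum.inr j)) _ (by omega)).2
    · exact (hφx u (fun j => hu (Sum.inl j)) _ (by omega)).2

theorem KernelChains.exists_singular_block [Module.Finite F V] {A B : V →ₗ[F] V →ₗ[F] F}
    (hA : A.IsAlt) (hB : B.IsAlt) (hG : KernelChains A B) {v : V} (hv : v ≠ 0) (hAv : A v = 0) :
    ∃ (r : ℕ) (c : Fin (r - 1) ⊕ Fin r → V) (φ : Fin (r - 1) ⊕ Fin r → V →ₗ[F] F), 1 ≤ r ∧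
      IsOrthogonalBlock A B (nabSkew (Fmat F r)) (nabSkew (Gmat F r)) c φ := by
  classical
  have hex : ∃ N x, IsNullChain A B N x ∧ x 0 ≠ 0 := by
    obtain ⟨x, rfl, hx, N, hN⟩ := hG v hAv
    exact ⟨N, x, ⟨hAv, hx, hN⟩, hv⟩
  obtain ⟨x, hx, hx0⟩ := Nat.find_spec hex
  have hmin := fun k => Nat.find_min hex (m := k)
  generalize Nat.find hex = N at hx hmin
  rcases N with _ | _ | m
  · exact absurd (hx.tail 0 le_rfl) hx0
  · have hBx : B (x 0) = 0 := by rw [← hx.step, hx.tail _ le_rfl, map_zero]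
    obtain ⟨f, hf⟩ := Module.Projective.exists_dual_eq_one F hx0
    exact ⟨1, _, _, le_rfl, isOrthogonalBlock_one hx.head hBx hf⟩
  · obtain ⟨y, hy, h0⟩ := IsNullChain.exists_dual_chain hA hB hx.head
      fun z hz h => hmin (m + 1) (by omega) ⟨z, hz, h ▸ hx0⟩
    exact ⟨m + 2, _, _, by omega, hx.isOrthogonalBlock hA hB hy h0⟩

end SingularBlock
section JordanBlock

variable {V : Type} [AddCommGroup V] [Module F V]

theorem apply_pow_comm {A : V →ₗ[F] V →ₗ[F] F} {N : Module.End F V}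
    (hN : ∀ u v, A (N u) v = A u (N v)) (k : ℕ) : ∀ u v, A ((N ^ k) u) v = A u ((N ^ k) v) := by
  induction k with
  | zero => simp
  | succ k ih =>
    intro u v
    rw [pow_succ, Module.End.mul_apply, ih, hN, ← Module.End.mul_apply, ← pow_succ', pow_succ]

theorem apply_pow_self_eq_zero {A : V →ₗ[F] V →ₗ[F] F} (h2 : (2 : F) ≠ 0) (hA : A.IsAlt)
    {N : Module.End F V} (hN : ∀ u v, A (N u) v = A u (N v)) (x : V) (i j : ℕ) :
    A ((N ^ i) x) ((N ^ j) x) = 0 := by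
  have h : ∀ k, A ((N ^ k) x) x = 0 := by
    intro k
    have h1 : A ((N ^ k) x) x = -A ((N ^ k) x) x := by rw [hA.neg, apply_pow_comm hN]
    have h3 : 2 * A ((N ^ k) x) x = 0 := by linear_combination h1
    exact (mul_eq_zero.1 h3).resolve_left h2
  rw [← apply_pow_comm hN, ← Module.End.mul_apply, ← pow_add, h]

/-- A vector of maximal height under `N` together with a vector pairing with its Krylov
sequence like the last coordinate. -/
theorem exists_dual_pair {A : V →ₗ[F] V →ₗ[F] F} (hA : Function.Bijective A) (halt : A.IsAlt)
    {N : Module.End F V}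
    (hN : ∀ u v, A (N u) v = A u (N v)) {m : ℕ} {x : V} (hx : (N ^ (m + 1)) x = 0)
    (hx' : (N ^ m) x ∉ LinearMap.range (N ^ (m + 1))) :
    ∃ y, (N ^ (m + 1)) y = 0 ∧ ∀ s, A ((N ^ s) x) y = if s = m then 1 else 0 := by
  have hzero : ∀ s, m < s → (N ^ s) x = 0 := by
    intro s hs
    obtain ⟨k, rfl⟩ := Nat.exists_eq_add_of_le' (Nat.succ_le_of_lt hs)
    rw [pow_add, Module.End.mul_apply, hx, map_zero]
  suffices ∀ k, k ≤ m → ∃ y, (N ^ (m + 1)) y = 0 ∧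
      ∀ s, m - k ≤ s → A ((N ^ s) x) y = if s = m then 1 else 0 by
    obtain ⟨y, hy, h⟩ := this m le_rfl
    exact ⟨y, hy, fun s => h s (by omega)⟩
  intro k
  induction k with
  | zero =>
    intro _
    obtain ⟨f, hf, hker⟩ := Submodule.exists_le_ker_of_notMem hx'
    obtain ⟨y, hy⟩ := hA.2 ((-(f ((N ^ m) x))⁻¹) • f)
    refine ⟨y, hA.1 (LinearMap.ext fun v => ?_), fun s hs => ?_⟩
    · have hv : f ((N ^ (m + 1)) v) = 0 := hker ⟨v, rfl⟩
      rw [apply_pow_comm hN, hy, LinearMap.smul_apply, hv, smul_zero, map_zero,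
        LinearMap.zero_apply]
    · rcases (show m ≤ s from hs).eq_or_lt with rfl | h
      · rw [← halt.neg, hy, if_pos rfl]
        simp [hf]
      · rw [hzero s h, if_neg h.ne']
        simp
  | succ k ih =>
    intro hk
    obtain ⟨y, hy, h⟩ := ih (by omega)
    refine ⟨y - A ((N ^ (m - (k + 1))) x) y • (N ^ (k + 1)) y, ?_, fun s hs => ?_⟩
    · rw [map_sub, map_smul, hy, ← Module.End.mul_apply, ← pow_add, add_comm (m + 1), pow_add,
        Module.End.mul_apply, hy]
      simp
    · rw [map_sub, map_smul, ← apply_pow_comm hN, ← Module.End.mul_apply, ← pow_add,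
        h (k + 1 + s) (by omega)]
      rcases hs.lt_or_eq with hlt | rfl
      · rw [h s (by omega), if_neg (show ¬k + 1 + s = m by omega)]
        simp
      · rw [if_pos (by omega), if_neg (by omega)]
        simp

theorem isOrthogonalBlock_jordan {A B : V →ₗ[F] V →ₗ[F] F} (h2 : (2 : F) ≠ 0) (hA : A.IsAlt)
    (hB : B.IsAlt) {N : Module.End F V} (hN : ∀ u v, A (N u) v = A u (N v)) {lam : F}
    (hBN : ∀ u, B u = lam • A u + A (N u)) {m : ℕ} {x y : V} (hx : (N ^ (m + 1)) x = 0)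
    (hy : (N ^ (m + 1)) y = 0) (hxy : ∀ s, A ((N ^ s) x) y = if s = m then 1 else 0) :
    IsOrthogonalBlock A B (nabSkew 1) (nabSkew (Jord F (m + 1) lam))
      (Sum.elim (fun i : Fin (m + 1) => (N ^ (i : ℕ)) x) (fun j : Fin (m + 1) => (N ^ (m - j)) y))
      (Sum.elim (fun i : Fin (m + 1) => -A ((N ^ (m - i)) y))
        (fun j : Fin (m + 1) => A ((N ^ (j : ℕ)) x))) := by
  have hBpow : ∀ k u, B ((N ^ k) u) = lam • A ((N ^ k) u) + A ((N ^ (k + 1)) u) := by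
    intro k u
    rw [hBN, ← Module.End.mul_apply, ← pow_succ']
  have hAxx := apply_pow_self_eq_zero h2 hA hN x
  have hAyy := apply_pow_self_eq_zero h2 hA hN y
  have hAxy : ∀ i j, A ((N ^ i) x) ((N ^ j) y) = if j + i = m then 1 else 0 := by
    intro i j
    rw [← apply_pow_comm hN, ← Module.End.mul_apply, ← pow_add, hxy]
  have hBxy : ∀ i j, B ((N ^ i) x) ((N ^ j) y) =
      lam * (if j + i = m then 1 else 0) + if j + (i + 1) = m then 1 else 0 := by
    intro i j
    rw [hBpow, LinearMap.add_apply, LinearMap.smul_apply, hAxy, hAxy, smul_eq_mul]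
  have hJ : ∀ i j : Fin (m + 1), Jord F (m + 1) lam i j =
      lam * (if m - (j : ℕ) + i = m then 1 else 0) +
        if m - (j : ℕ) + ((i : ℕ) + 1) = m then 1 else 0 := by
    rintro ⟨i, hi⟩ ⟨j, hj⟩
    simp only [Jord, Fin.mk.injEq]
    rcases eq_or_ne i j with rfl | h
    · rw [if_pos rfl, if_pos (by omega), if_neg (by omega)]
      simp
    · rw [if_neg h, if_neg (show ¬(m - j + i = m) by omega), mul_zero, zero_add]
      exact if_congr (by omega) rfl rfl
  have horth : ∀ u, (∀ i : Fin (m + 1), (-A ((N ^ (m - i)) y)) u = 0) →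
      (∀ j : Fin (m + 1), A ((N ^ (j : ℕ)) x) u = 0) →
      ∀ k, A ((N ^ k) x) u = 0 ∧ A ((N ^ k) y) u = 0 := by
    intro u h1 h3 k
    rcases lt_or_ge k (m + 1) with hk | hk
    · refine ⟨h3 ⟨k, hk⟩, ?_⟩
      have := h1 ⟨m - k, by omega⟩
      simpa [show m - (m - k) = k by omega] using this
    · obtain ⟨k, rfl⟩ := Nat.exists_eq_add_of_le' hk
      simp [pow_add _ k, Module.End.mul_apply, hx, hy]
  constructor
  · rintro (i | i) (j | j)
    · simp only [Sum.elim_inl, LinearMap.neg_apply, hA.neg, Sum.inl.injEq, hAxy]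
      exact if_congr (by omega) rfl rfl
    · simp [hAyy]
    · simp [hAxx]
    · simp only [Sum.elim_inr, Sum.inr.injEq, hAxy]
      exact if_congr (by omega) rfl rfl
  · rintro (i | i) (j | j)
    · simp [nabSkew, hAxx]
    · simp only [nabSkew, Sum.elim_inl, Sum.elim_inr, Matrix.fromBlocks_apply₁₂, hAxy,
        Matrix.one_apply]
      exact if_congr (by omega) rfl rfl
    · simp only [nabSkew, Sum.elim_inl, Sum.elim_inr, Matrix.fromBlocks_apply₂₁,
        Matrix.neg_apply, Matrix.transpose_apply, Matrix.one_apply]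
      rw [← hA.neg, hAxy]
      exact congrArg _ (if_congr (by omega) rfl rfl)
    · simp [nabSkew, hAyy]
  · rintro (i | i) (j | j)
    · simp [nabSkew, hBpow, hAxx]
    · simp only [nabSkew, Sum.elim_inl, Sum.elim_inr, Matrix.fromBlocks_apply₁₂, hBxy, hJ]
    · simp only [nabSkew, Sum.elim_inl, Sum.elim_inr, Matrix.fromBlocks_apply₂₁,
        Matrix.neg_apply, Matrix.transpose_apply, hJ]
      rw [← hB.neg, hBxy]
    · simp [nabSkew, hBpow, hAyy]
  · rintro (k | k) u hu
    · exact (horth u (fun i => hu (Sum.inl i)) (fun i => hu (Sum.inr i)) _).1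
    · exact (horth u (fun i => hu (Sum.inl i)) (fun i => hu (Sum.inr i)) _).2
  · rintro (k | k) u hu
    · have := fun k => (horth u (fun i => hu (Sum.inl i)) (fun i => hu (Sum.inr i)) k).1
      simp [hBpow, this]
    · have := fun k => (horth u (fun i => hu (Sum.inl i)) (fun i => hu (Sum.inr i)) k).2
      simp [hBpow, this]

theorem exists_maximal_height [Module.Finite F V] {N : Module.End F V} {v : V} (hv : v ≠ 0)
    (hNv : N v = 0) : ∃ m x, (N ^ (m + 1)) x = 0 ∧ (N ^ m) x ∉ LinearMap.range (N ^ (m + 1)) := by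
  classical
  have hex : ∃ k, LinearMap.ker (N ^ (k + 1)) ≤ LinearMap.ker (N ^ k) :=
    ⟨Module.finrank F V,
      (Module.End.ker_pow_eq_ker_pow_finrank_of_le (Nat.le_succ _)).le⟩
  have hspec := Nat.find_spec hex
  have hmin := fun k => Nat.find_min hex (m := k)
  generalize Nat.find hex = k at hspec hmin
  rcases k with _ | m
  · exact absurd (hspec (show v ∈ LinearMap.ker (N ^ (0 + 1)) by simpa using hNv))
      (by simpa using hv)
  · obtain ⟨x, hx, hx'⟩ := SetLike.not_le_iff_exists.1 (hmin m (by omega))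
    refine ⟨m, x, hx, ?_⟩
    rintro ⟨z, hz⟩
    have hz' : z ∈ LinearMap.ker (N ^ (m + 1 + 1)) := by
      rw [LinearMap.mem_ker, pow_succ', Module.End.mul_apply, hz, ← Module.End.mul_apply,
        ← pow_succ']
      exact hx
    exact hx' (hz.symm.trans (hspec hz'))

theorem exists_jordan_block [IsAlgClosed F] [Module.Finite F V] [Nontrivial V]
    {A B : V →ₗ[F] V →ₗ[F] F} (h2 : (2 : F) ≠ 0) (hA : A.IsAlt) (hB : B.IsAlt)
    (hinj : ∀ v, A v = 0 → v = 0) :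
    ∃ (l : ℕ) (lam : F) (c : Fin l ⊕ Fin l → V) (φ : Fin l ⊕ Fin l → V →ₗ[F] F), 1 ≤ l ∧
      IsOrthogonalBlock A B (nabSkew 1) (nabSkew (Jord F l lam)) c φ := by
  have hinj' : Function.Injective A := (injective_iff_map_eq_zero A).2 hinj
  let e : V ≃ₗ[F] (V →ₗ[F] F) :=
    LinearMap.linearEquivOfInjective A hinj' Subspace.dual_finrank_eq.symm
  have hbij : Function.Bijective A := e.bijective
  let T : Module.End F V := e.symm.toLinearMap ∘ₗ B
  have hT : ∀ u, A (T u) = B u := fun u => e.apply_symm_apply (B u)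
  obtain ⟨lam, hlam⟩ := Module.End.exists_eigenvalue T
  obtain ⟨v, hv⟩ := hlam.exists_hasEigenvector
  let N : Module.End F V := T - algebraMap F (Module.End F V) lam
  have hAN : ∀ u, A (N u) = B u - lam • A u := by
    intro u
    simp [N, hT]
  have hN : ∀ u v, A (N u) v = A u (N v) := by
    intro u v
    rw [← hA.neg (N v), hAN, hAN]
    simp only [LinearMap.sub_apply, LinearMap.smul_apply, smul_eq_mul]
    rw [← hA.neg u v, ← hB.neg u v]
    ring
  have hNv : N v = 0 := by
    simp [N, hv.apply_eq_smul]
  obtain ⟨m, x, hx, hx'⟩ := exists_maximal_height hv.2 hNv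
  obtain ⟨y, hy, hxy⟩ := exists_dual_pair hbij hA hN hx hx'
  exact ⟨m + 1, lam, _, _, by omega, isOrthogonalBlock_jordan h2 hA hB hN
    (fun u => by rw [hAN]; abel) hx hy hxy⟩

end JordanBlock

section CanonicalBasis

variable {V : Type} [AddCommGroup V] [Module F V]

/-- The forms `A` and `B` are simultaneously in canonical form in some basis. -/
def HasCanonicalBasis (A B : V →ₗ[F] V →ₗ[F] F) : Prop :=
  ∃ (p q : ℕ) (l : Fin p → ℕ) (r : Fin q → ℕ) (lam : Fin p → F),
    (∀ i, 1 ≤ l i) ∧ (∀ j, 1 ≤ r j) ∧ ∃ b : Module.Basis (CIdx p q l r) F V,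
      (∀ x y, A (b x) (b y) = canA F p q l r x y) ∧
      (∀ x y, B (b x) (b y) = canB F p q l r lam x y)

/-- Splitting off the first summand of a sigma type indexed by `Fin (p + 1)`. -/
noncomputable def sigmaConsEquiv (T : ℕ → Type) {p : ℕ} (l₀ : ℕ) (l : Fin p → ℕ) :
    (T l₀ ⊕ Σ i, T (l i)) ≃ Σ i : Fin (p + 1), T ((Fin.cons l₀ l : Fin (p + 1) → ℕ) i) :=
  Equiv.ofBijective (Sum.elim (fun k => ⟨0, k⟩) (fun s => ⟨s.1.succ, s.2⟩)) (by
    refine ⟨?_, ?_⟩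
    · rintro (k | ⟨i, k⟩) (k' | ⟨i', k'⟩) h
      · have h' : k = k' := eq_of_heq (Sigma.mk.inj h).2
        rw [h']
      · exact absurd (congrArg Sigma.fst h) (Fin.succ_ne_zero i').symm
      · exact absurd (congrArg Sigma.fst h) (Fin.succ_ne_zero i)
      · obtain rfl : i = i' := Fin.succ_injective _ (congrArg Sigma.fst h)
        have h' : k = k' := eq_of_heq (Sigma.mk.inj h).2
        rw [h']
    · rintro ⟨i, k⟩
      refine Fin.cases (fun k => ⟨Sum.inl k, rfl⟩) (fun i k => ⟨Sum.inr ⟨i, k⟩, rfl⟩) i k)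

theorem blockDiagonal'_sigmaConsEquiv {T : ℕ → Type} {p : ℕ} {l₀ : ℕ}
    {l : Fin p → ℕ} (M : ∀ i, Matrix (T ((Fin.cons l₀ l : Fin (p + 1) → ℕ) i))
      (T ((Fin.cons l₀ l : Fin (p + 1) → ℕ) i)) F)
    (M₀ : Matrix (T l₀) (T l₀) F) (hM₀ : M 0 = M₀)
    (M' : ∀ i, Matrix (T (l i)) (T (l i)) F) (hM' : ∀ i, M i.succ = M' i)
    (x y : T l₀ ⊕ Σ i, T (l i)) :
    Matrix.blockDiagonal' M (sigmaConsEquiv T l₀ l x) (sigmaConsEquiv T l₀ l y) =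
      Matrix.fromBlocks M₀ 0 0 (Matrix.blockDiagonal' M') x y := by
  subst hM₀
  obtain k | ⟨i, k⟩ := x <;> obtain k' | ⟨i', k'⟩ := y
  · exact Matrix.blockDiagonal'_apply_eq M 0 k k'
  · exact Matrix.blockDiagonal'_apply_ne M _ _ (Fin.succ_ne_zero i').symm
  · exact Matrix.blockDiagonal'_apply_ne M _ _ (Fin.succ_ne_zero i)
  · by_cases h : i = i'
    · subst h
      exact (Matrix.blockDiagonal'_apply_eq M i.succ k k').trans
        ((congrFun (congrFun (hM' i) k) k').trans
          (Matrix.blockDiagonal'_apply_eq M' i k k').symm)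
    · exact (Matrix.blockDiagonal'_apply_ne M _ _ fun h' => h (Fin.succ_injective _ h')).trans
        (Matrix.blockDiagonal'_apply_ne M' k k' h).symm

theorem gram_eq_fromBlocks {K J : Type} {A : V →ₗ[F] V →ₗ[F] F} (hA : A.IsAlt)
    {M : Matrix K K F} {N : Matrix J J F} {φ : K → V →ₗ[F] F} {c : K → V}
    (hM : ∀ i j, A (c i) (c j) = M i j)
    (horth : ∀ k u, (∀ i, φ i u = 0) → A (c k) u = 0)
    {b : J → LinearMap.ker (LinearMap.pi φ)}
    (hN : ∀ i j, A (b i) (b j) = N i j) {b' : K ⊕ J → V} (hl : ∀ k, b' (Sum.inl k) = c k)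
    (hr : ∀ j, b' (Sum.inr j) = b j) (x y : K ⊕ J) :
    A (b' x) (b' y) = Matrix.fromBlocks M 0 0 N x y := by
  have h (k : K) (j : J) : A (c k) (b j) = 0 := horth k _ (apply_eq_zero_of_mem_ker _)
  obtain x | x := x <;> obtain y | y := y
  · simp [hl, hM]
  · simp [hl, hr, h]
  · rw [← hA.neg]
    simp [hl, hr, h]
  · simp [hr, hN]

theorem HasCanonicalBasis.of_jordan_block {A B : V →ₗ[F] V →ₗ[F] F} (hA : A.IsAlt) (hB : B.IsAlt)
    {l₀ : ℕ} {lam₀ : F} (hl₀ : 1 ≤ l₀) {c : Fin l₀ ⊕ Fin l₀ → V}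
    {φ : Fin l₀ ⊕ Fin l₀ → V →ₗ[F] F}
    (H : IsOrthogonalBlock A B (nabSkew 1) (nabSkew (Jord F l₀ lam₀)) c φ)
    (hrec : HasCanonicalBasis
      (A.domRestrict₁₂ (LinearMap.ker (LinearMap.pi φ)) (LinearMap.ker (LinearMap.pi φ)))
      (B.domRestrict₁₂ (LinearMap.ker (LinearMap.pi φ)) (LinearMap.ker (LinearMap.pi φ)))) :
    HasCanonicalBasis A B := by
  obtain ⟨p, q, l, r, lam, hl, hr, b, hbA, hbB⟩ := hrec
  obtain ⟨b', hb'l, hb'r⟩ := exists_basis_sum c φ H.dual b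
  have hbA' := gram_eq_fromBlocks hA H.gram_left H.orth_left hbA hb'l hb'r
  have hbB' := gram_eq_fromBlocks hB H.gram_right H.orth_right hbB hb'l hb'r
  let E := (Equiv.sumAssoc (Fin l₀ ⊕ Fin l₀) (Σ i, Fin (l i) ⊕ Fin (l i))
    (Σ j, Fin (r j - 1) ⊕ Fin (r j))).symm.trans
      ((sigmaConsEquiv (fun n => Fin n ⊕ Fin n) l₀ l).sumCongr (Equiv.refl _))
  refine ⟨p + 1, q, Fin.cons l₀ l, r, Fin.cons lam₀ lam, Fin.cases hl₀ hl, hr, b'.reindex E,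
    fun x y => ?_, fun x y => ?_⟩
  · obtain ⟨x, rfl⟩ := E.surjective x
    obtain ⟨y, rfl⟩ := E.surjective y
    have key := blockDiagonal'_sigmaConsEquiv (T := fun n => Fin n ⊕ Fin n) (l₀ := l₀) (l := l)
      (fun i => nabSkew (1 : Matrix (Fin ((Fin.cons l₀ l : Fin (p + 1) → ℕ) i)) _ F))
      (nabSkew 1) rfl (fun i => nabSkew 1) (fun _ => rfl)
    rw [Module.Basis.reindex_apply, Module.Basis.reindex_apply, E.symm_apply_apply,
      E.symm_apply_apply, hbA']
    obtain x | x | x := x <;> obtain y | y | y := y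
    · exact (key (Sum.inl x) (Sum.inl y)).symm
    · exact (key (Sum.inl x) (Sum.inr y)).symm
    · rfl
    · exact (key (Sum.inr x) (Sum.inl y)).symm
    · exact (key (Sum.inr x) (Sum.inr y)).symm
    all_goals rfl
  · obtain ⟨x, rfl⟩ := E.surjective x
    obtain ⟨y, rfl⟩ := E.surjective y
    have key := blockDiagonal'_sigmaConsEquiv (T := fun n => Fin n ⊕ Fin n) (l₀ := l₀) (l := l)
      (fun i => nabSkew (Jord F ((Fin.cons l₀ l : Fin (p + 1) → ℕ) i)
        ((Fin.cons lam₀ lam : Fin (p + 1) → F) i)))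
      (nabSkew (Jord F l₀ lam₀)) rfl (fun i => nabSkew (Jord F (l i) (lam i))) (fun _ => rfl)
    rw [Module.Basis.reindex_apply, Module.Basis.reindex_apply, E.symm_apply_apply,
      E.symm_apply_apply, hbB']
    obtain x | x | x := x <;> obtain y | y | y := y
    · exact (key (Sum.inl x) (Sum.inl y)).symm
    · exact (key (Sum.inl x) (Sum.inr y)).symm
    · rfl
    · exact (key (Sum.inr x) (Sum.inl y)).symm
    · exact (key (Sum.inr x) (Sum.inr y)).symm
    all_goals rfl

theorem HasCanonicalBasis.of_singular_block {A B : V →ₗ[F] V →ₗ[F] F} (hA : A.IsAlt)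
    (hB : B.IsAlt) {r₀ : ℕ} (hr₀ : 1 ≤ r₀) {c : Fin (r₀ - 1) ⊕ Fin r₀ → V}
    {φ : Fin (r₀ - 1) ⊕ Fin r₀ → V →ₗ[F] F}
    (H : IsOrthogonalBlock A B (nabSkew (Fmat F r₀)) (nabSkew (Gmat F r₀)) c φ)
    (hrec : HasCanonicalBasis
      (A.domRestrict₁₂ (LinearMap.ker (LinearMap.pi φ)) (LinearMap.ker (LinearMap.pi φ)))
      (B.domRestrict₁₂ (LinearMap.ker (LinearMap.pi φ)) (LinearMap.ker (LinearMap.pi φ)))) :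
    HasCanonicalBasis A B := by
  obtain ⟨p, q, l, r, lam, hl, hr, b, hbA, hbB⟩ := hrec
  obtain ⟨b', hb'l, hb'r⟩ := exists_basis_sum c φ H.dual b
  have hbA' := gram_eq_fromBlocks hA H.gram_left H.orth_left hbA hb'l hb'r
  have hbB' := gram_eq_fromBlocks hB H.gram_right H.orth_right hbB hb'l hb'r
  let E := (Equiv.sumAssoc (Fin (r₀ - 1) ⊕ Fin r₀) (Σ i, Fin (l i) ⊕ Fin (l i))
    (Σ j, Fin (r j - 1) ⊕ Fin (r j))).symm.trans
      (((Equiv.sumComm _ _).sumCongr (Equiv.refl _)).trans ((Equiv.sumAssoc _ _ _).trans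
        ((Equiv.refl _).sumCongr (sigmaConsEquiv (fun n => Fin (n - 1) ⊕ Fin n) r₀ r))))
  refine ⟨p, q + 1, l, Fin.cons r₀ r, lam, hl, Fin.cases hr₀ hr, b'.reindex E,
    fun x y => ?_, fun x y => ?_⟩
  · obtain ⟨x, rfl⟩ := E.surjective x
    obtain ⟨y, rfl⟩ := E.surjective y
    have key := blockDiagonal'_sigmaConsEquiv (T := fun n => Fin (n - 1) ⊕ Fin n) (l₀ := r₀)
      (l := r) (fun i => nabSkew (Fmat F ((Fin.cons r₀ r : Fin (q + 1) → ℕ) i)))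
      (nabSkew (Fmat F r₀)) rfl (fun i => nabSkew (Fmat F (r i))) (fun _ => rfl)
    rw [Module.Basis.reindex_apply, Module.Basis.reindex_apply, E.symm_apply_apply,
      E.symm_apply_apply, hbA']
    obtain x | x | x := x <;> obtain y | y | y := y
    · exact (key (Sum.inl x) (Sum.inl y)).symm
    · rfl
    · exact (key (Sum.inl x) (Sum.inr y)).symm
    · rfl
    · rfl
    · rfl
    · exact (key (Sum.inr x) (Sum.inl y)).symm
    · rfl
    · exact (key (Sum.inr x) (Sum.inr y)).symm
  · obtain ⟨x, rfl⟩ := E.surjective x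
    obtain ⟨y, rfl⟩ := E.surjective y
    have key := blockDiagonal'_sigmaConsEquiv (T := fun n => Fin (n - 1) ⊕ Fin n) (l₀ := r₀)
      (l := r) (fun i => nabSkew (Gmat F ((Fin.cons r₀ r : Fin (q + 1) → ℕ) i)))
      (nabSkew (Gmat F r₀)) rfl (fun i => nabSkew (Gmat F (r i))) (fun _ => rfl)
    rw [Module.Basis.reindex_apply, Module.Basis.reindex_apply, E.symm_apply_apply,
      E.symm_apply_apply, hbB']
    obtain x | x | x := x <;> obtain y | y | y := y
    · exact (key (Sum.inl x) (Sum.inl y)).symm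
    · rfl
    · exact (key (Sum.inl x) (Sum.inr y)).symm
    · rfl
    · rfl
    · rfl
    · exact (key (Sum.inr x) (Sum.inl y)).symm
    · rfl
    · exact (key (Sum.inr x) (Sum.inr y)).symm

end CanonicalBasis

theorem KernelChains.hasCanonicalBasis [IsAlgClosed F] (h2 : (2 : F) ≠ 0) (d : ℕ) :
    ∀ {V : Type} [AddCommGroup V] [Module F V] [Module.Finite F V] {A B : V →ₗ[F] V →ₗ[F] F},
      A.IsAlt → B.IsAlt → KernelChains A B → Module.finrank F V = d → HasCanonicalBasis A B := by
  induction d using Nat.strong_induction_on with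
  | _ d ih =>
  intro V _ _ _ A B hA hB hG hd
  by_cases hinj : ∀ v, A v = 0 → v = 0
  · rcases subsingleton_or_nontrivial V with hV | hV
    · exact ⟨0, 0, Fin.elim0, Fin.elim0, Fin.elim0, fun i => i.elim0, fun i => i.elim0,
        Module.Basis.empty V, fun x => isEmptyElim x, fun x => isEmptyElim x⟩
    · obtain ⟨l, lam, c, φ, hl, H⟩ := exists_jordan_block h2 hA hB hinj
      have : Nonempty (Fin l ⊕ Fin l) := ⟨Sum.inl ⟨0, hl⟩⟩
      exact .of_jordan_block hA hB hl H (ih _ (hd ▸ finrank_ker_lt c φ H.dual)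
        (fun u => hA u) (fun u => hB u) (H.kernelChains hA hG) rfl)
  · push Not at hinj
    obtain ⟨v, hAv, hv⟩ := hinj
    obtain ⟨r, c, φ, hr, H⟩ := hG.exists_singular_block hA hB hv hAv
    have : Nonempty (Fin (r - 1) ⊕ Fin r) := ⟨Sum.inr ⟨0, hr⟩⟩
    exact .of_singular_block hA hB hr H (ih _ (hd ▸ finrank_ker_lt c φ H.dual)
      (fun u => hA u) (fun u => hB u) (H.kernelChains hA hG) rfl)

section CentralExtension

theorem bilin_apply_eq_sum {V J : Type} [AddCommGroup V] [Module F V] [Fintype J]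
    (A : V →ₗ[F] V →ₗ[F] F) (b : Module.Basis J F V) {M : Matrix J J F}
    (hM : ∀ x y, A (b x) (b y) = M x y) (u v : V) :
    A u v = ∑ x, ∑ y, b.repr u x * M x y * b.repr v y := by
  conv_lhs => rw [← b.sum_repr u, ← b.sum_repr v]
  simp only [map_sum, map_smul, LinearMap.sum_apply, LinearMap.smul_apply, hM, smul_eq_mul]
  simp only [Finset.mul_sum]
  rw [Finset.sum_comm]
  refine Finset.sum_congr rfl fun x _ => Finset.sum_congr rfl fun y _ => ?_
  ring

/-- The automorphism of `F²` sending `f` to `(f₀ + c f₁, f₁)`. -/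
def shear (c : F) : (Fin 2 → F) ≃ₗ[F] (Fin 2 → F) where
  toFun f := ![f 0 + c * f 1, f 1]
  invFun f := ![f 0 - c * f 1, f 1]
  map_add' f g := by
    ext i
    fin_cases i
    · simp
      ring
    · simp
  map_smul' a f := by
    ext i
    fin_cases i
    · simp
      ring
    · simp
  left_inv f := by
    ext i
    fin_cases i <;> simp
  right_inv f := by
    ext i
    fin_cases i <;> simp

theorem canB_eq_smul_canA (p q : ℕ) (l : Fin p → ℕ) (r : Fin q → ℕ) (lam : Fin p → F) (μ : F)
    (hlam : ∀ i, lam i = μ) (hl : ∀ i, l i = 1) (hr : ∀ j, r j = 1) :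
    canB F p q l r lam = μ • canA F p q l r := by
  obtain rfl : l = fun _ => 1 := funext hl
  obtain rfl : r = fun _ => 1 := funext hr
  obtain rfl : lam = fun _ => μ := funext hlam
  have hJ : Jord F 1 μ = μ • 1 := by
    ext i j
    simp [Jord, Subsingleton.elim i j]
  have hN : nabSkew (Jord F 1 μ) = μ • nabSkew 1 := by
    simp [hJ, nabSkew, Matrix.fromBlocks_smul]
  have hG : nabSkew (Gmat F 1) = μ • nabSkew (Fmat F 1) := by
    ext x y
    obtain x | x := x <;> obtain y | y := y
    · exact x.elim0
    · exact x.elim0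
    · exact y.elim0
    · simp [nabSkew]
  rw [canA, canB, hN, hG, Matrix.fromBlocks_smul, smul_zero, smul_zero]
  congr 1
  · exact Matrix.blockDiagonal'_smul μ fun _ => nabSkew (1 : Matrix (Fin 1) (Fin 1) F)
  · exact Matrix.blockDiagonal'_smul μ fun _ => nabSkew (Fmat F 1)

end CentralExtension

/-- Theorem 5 (existence part): every Lie algebra over an algebraically closed field of
characteristic ≠ 2 whose commutator subalgebra is central of dimension 2 is isomorphic to a
Lie algebra on `F^n` given by a canonical pair of skew-symmetric (n−2)×(n−2) matrices
`⊕ᵢ (I_{lᵢ}, J_{lᵢ}(λᵢ))^▽ ⊕ ⊕ⱼ (F_{rⱼ}, G_{rⱼ})^▽`, excluding the degenerate case where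
all λᵢ coincide and all lᵢ and rⱼ equal 1. -/
theorem stmt16 [IsAlgClosed F] (hchar : ringChar F ≠ 2)
    (L : Type) [LieRing L] [LieAlgebra F L] [Module.Finite F L]
    (n : ℕ) (hdim : Module.finrank F L = n)
    (hcentral : ∀ a b c : L, ⁅⁅a, b⁆, c⁆ = 0)
    (hdim2 : Module.finrank F
        ↥(Submodule.span F {x : L | ∃ a b : L, ⁅a, b⁆ = x}) = 2) :
    ∃ (p q : ℕ) (l : Fin p → ℕ) (r : Fin q → ℕ) (lam : Fin p → F),
      (∀ i, 1 ≤ l i) ∧ (∀ j, 1 ≤ r j) ∧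
      Fintype.card (CIdx p q l r) + 2 = n ∧
      ¬ ((∀ i i', lam i = lam i') ∧ (∀ i, l i = 1) ∧ (∀ j, r j = 1)) ∧
      ∃ e : L ≃ₗ[F] ((Fin 2 ⊕ CIdx p q l r) → F),
        ∀ a b : L, e ⁅a, b⁆ = canBr F p q l r lam (e a) (e b) := by
  have h2 : (2 : F) ≠ 0 := Ring.two_ne_zero hchar
  set Z := Submodule.span F {x : L | ∃ a b : L, ⁅a, b⁆ = x}
  have hmem (a b : L) : ⁅a, b⁆ ∈ Z := Submodule.subset_span ⟨a, b, rfl⟩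
  have hZl (z : Z) (x : L) : ⁅(z : L), x⁆ = 0 := by
    obtain ⟨z, hz⟩ := z
    induction hz using Submodule.span_induction with
    | mem y hy =>
      obtain ⟨a, b, rfl⟩ := hy
      exact hcentral a b x
    | zero => exact zero_lie x
    | add y y' _ _ hy hy' => simp_all
    | smul t y _ hy => simp_all
  have hZr (x : L) (z : Z) : ⁅x, (z : L)⁆ = 0 := by rw [← lie_skew, hZl, neg_zero]
  obtain ⟨C, hC⟩ := Z.exists_isCompl
  let ez : Z ≃ₗ[F] (Fin 2 → F) := LinearEquiv.ofFinrankEq _ _ (by simp [hdim2])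
  let β : L →ₗ[F] L →ₗ[F] Z :=
    LinearMap.mk₂ F (fun a b => ⟨⁅a, b⁆, hmem a b⟩)
      (fun a a' b => Subtype.ext (add_lie a a' b)) (fun t a b => Subtype.ext (smul_lie t a b))
      (fun a b b' => Subtype.ext (lie_add a b b')) (fun t a b => Subtype.ext (lie_smul t a b))
  let form (k : Fin 2) : C →ₗ[F] C →ₗ[F] F :=
    (β.compr₂ (LinearMap.proj k ∘ₗ ez.toLinearMap)).domRestrict₁₂ C C
  have hform (k : Fin 2) : (form k).IsAlt := fun a => by
    have : (⟨⁅(a : L), (a : L)⁆, hmem a a⟩ : Z) = 0 := Subtype.ext (lie_self _)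
    change ez ⟨⁅(a : L), (a : L)⁆, hmem a a⟩ k = 0
    rw [this, map_zero, Pi.zero_apply]
  have : Infinite F := IsAlgClosed.instInfinite
  obtain ⟨c, hc⟩ := exists_kernelChains_add_smul (form 0) (form 1)
  obtain ⟨p, q, l, r, lam, hl, hr, b, hbA, hbB⟩ := KernelChains.hasCanonicalBasis h2 _
    (A := form 0 + c • form 1) (fun a => by simp [hform 0 a, hform 1 a]) (hform 1) hc rfl
  let ez' := ez.trans (shear c)
  let s := Submodule.prodEquivOfIsCompl Z C hC
  let e : L ≃ₗ[F] ((Fin 2 ⊕ CIdx p q l r) → F) :=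
    s.symm.trans ((ez'.prodCongr b.equivFun).trans
      (LinearEquiv.sumArrowLequivProdArrow (Fin 2) (CIdx p q l r) F F).symm)
  have heZ (z : Z) : e z = Sum.elim (ez' z) 0 := by
    have : s.symm z = (z, 0) := by simp [s]
    ext (k | k)
    · simp [e, this]
    · simp [e, this]
  have he_inr (a : L) (x : CIdx p q l r) : e a (Sum.inr x) = b.repr (s.symm a).2 x := by
    simp [e]
  have hbr (a b : L) : ⁅a, b⁆ = ⁅((s.symm a).2 : L), ((s.symm b).2 : L)⁆ := by
    have h (a : L) : a = ((s.symm a).1 : L) + ((s.symm a).2 : L) :=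
      (s.apply_symm_apply a).symm
    conv_lhs => rw [h a, h b]
    simp [hZl, hZr]
  have he (a b : L) : e ⁅a, b⁆ = canBr F p q l r lam (e a) (e b) := by
    have := heZ ⟨⁅a, b⁆, hmem a b⟩
    rw [this]
    ext (k | k)
    · simp only [canBr, Sum.elim_inl, he_inr]
      fin_cases k
      · refine Eq.trans ?_ (bilin_apply_eq_sum _ _ hbA _ _)
        simp only [hbr a b]
        rfl
      · refine Eq.trans ?_ (bilin_apply_eq_sum _ _ hbB _ _)
        simp only [hbr a b]
        rfl
    · rfl
  refine ⟨p, q, l, r, lam, hl, hr, ?_, ?_, e, he⟩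
  · have := e.finrank_eq
    rw [hdim, Module.finrank_fintype_fun_eq_card, Fintype.card_sum, Fintype.card_fin] at this
    omega
  · rintro ⟨hlam, hl1, hr1⟩
    obtain ⟨μ, hμ⟩ : ∃ μ, ∀ i, lam i = μ := by
      rcases isEmpty_or_nonempty (Fin p) with hp | ⟨⟨i⟩⟩
      · exact ⟨0, fun i => hp.elim i⟩
      · exact ⟨lam i, fun i' => hlam i' i⟩
    have hrel (z : Z) : e z (Sum.inl 1) = μ * e z (Sum.inl 0) := by
      obtain ⟨z, hz⟩ := z
      induction hz using Submodule.span_induction with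
      | mem y hy =>
        obtain ⟨a, b, rfl⟩ := hy
        simp only [he, canBr, Sum.elim_inl, Matrix.cons_val_zero, Matrix.cons_val_one,
          canB_eq_smul_canA p q l r lam μ hμ hl1 hr1, Matrix.smul_apply, smul_eq_mul,
          Finset.mul_sum]
        refine Finset.sum_congr rfl fun x _ => Finset.sum_congr rfl fun y _ => ?_
        ring
      | zero => simp
      | add y y' _ _ hy hy' =>
        simp only [map_add, Pi.add_apply] at hy hy' ⊢
        rw [hy, hy']
        ring
      | smul t y _ hy =>
        simp only [map_smul, Pi.smul_apply, smul_eq_mul] at hy ⊢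
        rw [hy]
        ring
    obtain ⟨z, hz⟩ := ez'.surjective ![0, 1]
    have := hrel z
    rw [heZ, hz] at this
    simp at this
end

section
/- Let F be an algebraically closed field of characteristic not 2. Suppose two pairs of skew-symmetric (n−2)×(n−2) matrices over F, each of the canonical form ⊕_{i=1}^{p}(I_{l_i}, J_{l_i}(λ_i))^▽ ⊕ ⊕_{j=1}^{q}(F_{r_j}, G_{r_j})^▽ (with ε = −1, and not of the degenerate form where all λ_i are equal and all l_i and r_j equal 1), define isomorphic Lie algebras on F^n via the bracket [u,v] := (uᵀ[[0₂,0],[0,A]]v, uᵀ[[0₂,0],[0,B]]v, 0,…,0)ᵀ. Then the two canonical forms coincide up to a permutation of the direct summands and a simultaneous linear-fractional transformation of the eigenvalue sequence, (λ₁,…,λ_p) ↦ ((γ+δλ₁)/(α+βλ₁), …, (γ+δλ_p)/(α+βλ_p)), where all α+βλ_i are nonzero and αδ − βγ ≠ 0. -/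
open Matrix

variable {F : Type} [Field F]

/-- The increasing chain `0 ⊆ C⁻¹(D 0) ⊆ C⁻¹(D(C⁻¹(D 0))) ⊆ …` of subspaces attached to a
matrix pencil with coefficients `C` and `D`. -/
def pencilChain {m n : Type} [Fintype n] (C D : Matrix m n F) : ℕ → Submodule F (n → F)
  | 0 => ⊥
  | k + 1 => ((pencilChain C D k).map D.mulVecLin).comap C.mulVecLin

section Chain

variable {m n m' n' : Type} [Fintype n] [Fintype n']

lemma mem_pencilChain_zero {C D : Matrix m n F} {v : n → F} :
    v ∈ pencilChain C D 0 ↔ v = 0 := by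
  simp [pencilChain]

lemma mem_pencilChain_succ {C D : Matrix m n F} {k : ℕ} {v : n → F} :
    v ∈ pencilChain C D (k + 1) ↔ ∃ u ∈ pencilChain C D k, C *ᵥ v = D *ᵥ u := by
  simp [pencilChain, eq_comm]

lemma mem_pencilChain_one {C D : Matrix m n F} {v : n → F} :
    v ∈ pencilChain C D 1 ↔ C *ᵥ v = 0 := by
  simp [mem_pencilChain_succ, mem_pencilChain_zero]

lemma pencilChain_le_succ (C D : Matrix m n F) (k : ℕ) :
    pencilChain C D k ≤ pencilChain C D (k + 1) := by
  induction k with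
  | zero => exact bot_le
  | succ k ih =>
    intro v hv
    obtain ⟨u, hu, h⟩ := mem_pencilChain_succ.1 hv
    exact mem_pencilChain_succ.2 ⟨u, ih hu, h⟩

lemma pencilChain_mono (C D : Matrix m n F) : Monotone (pencilChain C D) :=
  monotone_nat_of_le_succ (pencilChain_le_succ C D)

lemma pencilChain_eq_bot {C D : Matrix m n F} (hC : ∀ v, C *ᵥ v = 0 → v = 0) (k : ℕ) :
    pencilChain C D k = ⊥ := by
  induction k with
  | zero => rfl
  | succ k ih =>
    rw [eq_bot_iff]
    intro v hv
    obtain ⟨u, hu, h⟩ := mem_pencilChain_succ.1 hv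
    rw [ih, Submodule.mem_bot] at hu
    subst hu
    exact (Submodule.mem_bot F).2 (hC v (by simpa using h))

lemma pencilChain_change_le (C D : Matrix m n F) {a : F} (ha : a ≠ 0) (c d : F) (k : ℕ) :
    pencilChain (a • C) (c • C + d • D) k ≤ pencilChain C D k := by
  induction k with
  | zero => exact le_rfl
  | succ k ih =>
    intro v hv
    obtain ⟨u, hu, h⟩ := mem_pencilChain_succ.1 hv
    replace hu := ih hu
    have hmem : v - (a⁻¹ * c) • u ∈ pencilChain C D (k + 1) := by
      refine mem_pencilChain_succ.2 ⟨(a⁻¹ * d) • u, Submodule.smul_mem _ _ hu, ?_⟩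
      have h' : C *ᵥ v = a⁻¹ • (a • C *ᵥ v) := by rw [smul_smul, inv_mul_cancel₀ ha, one_smul]
      rw [smul_mulVec] at h
      rw [mulVec_sub, h', h]
      simp only [add_mulVec, smul_mulVec, mulVec_smul, smul_add, smul_smul]
      abel
    have := Submodule.add_mem _ hmem
      (Submodule.smul_mem _ (a⁻¹ * c) (pencilChain_le_succ C D k hu))
    rwa [sub_add_cancel] at this

/-- The chain only depends on the point `C` of the projective line of the pencil. -/
lemma pencilChain_change (C D : Matrix m n F) {a c d : F} (ha : a ≠ 0) (hd : d ≠ 0) (k : ℕ) :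
    pencilChain (a • C) (c • C + d • D) k = pencilChain C D k := by
  refine le_antisymm (pencilChain_change_le C D ha c d k) ?_
  have h := pencilChain_change_le (a • C) (c • C + d • D) (inv_ne_zero ha)
    (-(d⁻¹ * c * a⁻¹)) d⁻¹ k
  have hC : a⁻¹ • a • C = C := by rw [smul_smul, inv_mul_cancel₀ ha, one_smul]
  have hD : -(d⁻¹ * c * a⁻¹) • a • C + d⁻¹ • (c • C + d • D) = D := by
    rw [smul_add, smul_smul, smul_smul, smul_smul, inv_mul_cancel₀ hd, one_smul, ← add_assoc,
      ← add_smul]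
    have : -(d⁻¹ * c * a⁻¹) * a + d⁻¹ * c = 0 := by field_simp; ring
    rw [this, zero_smul, zero_add]
  rwa [hC, hD] at h

lemma finrank_pencilChain_congr {C D : Matrix n n F} {C' D' : Matrix n' n' F}
    (S : (n → F) ≃ₗ[F] (n' → F))
    (hC : ∀ x y, S x ⬝ᵥ C' *ᵥ S y = x ⬝ᵥ C *ᵥ y)
    (hD : ∀ x y, S x ⬝ᵥ D' *ᵥ S y = x ⬝ᵥ D *ᵥ y) (k : ℕ) :
    Module.finrank F (pencilChain C' D' k) = Module.finrank F (pencilChain C D k) := by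
  have key : ∀ k y, y ∈ pencilChain C D k ↔ S y ∈ pencilChain C' D' k := by
    intro k
    induction k with
    | zero => intro y; simp [mem_pencilChain_zero]
    | succ k ih =>
      intro y
      have hiff : ∀ u, C *ᵥ y = D *ᵥ u ↔ C' *ᵥ S y = D' *ᵥ S u := by
        intro u
        constructor
        · intro h
          refine dotProduct_eq _ _ fun x => ?_
          obtain ⟨x, rfl⟩ := S.surjective x
          rw [dotProduct_comm, hC, h, ← hD, dotProduct_comm]
        · intro h
          refine dotProduct_eq _ _ fun x => ?_
          rw [dotProduct_comm, ← hC, h, hD, dotProduct_comm]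
      simp only [mem_pencilChain_succ, hiff]
      constructor
      · rintro ⟨u, hu, h⟩
        exact ⟨S u, (ih u).1 hu, h⟩
      · rintro ⟨u, hu, h⟩
        obtain ⟨u, rfl⟩ := S.surjective u
        exact ⟨u, (ih u).2 hu, h⟩
  have : pencilChain C' D' k = (pencilChain C D k).map (S : (n → F) →ₗ[F] (n' → F)) := by
    ext y
    obtain ⟨y, rfl⟩ := S.surjective y
    rw [← key, Submodule.mem_map]
    constructor
    · intro h; exact ⟨y, h, rfl⟩
    · rintro ⟨z, hz, h⟩
      rwa [← S.injective h]
  rw [this]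
  exact LinearEquiv.finrank_map_eq S _

/-- A pair of submodules of function spaces, glued along a sum type. -/
lemma finrank_of_mem_iff_sum {U : Submodule F (n ⊕ n' → F)} {V : Submodule F (n → F)}
    {W : Submodule F (n' → F)}
    (h : ∀ v, v ∈ U ↔ v ∘ Sum.inl ∈ V ∧ v ∘ Sum.inr ∈ W) :
    Module.finrank F U = Module.finrank F V + Module.finrank F W := by
  rw [← Module.finrank_prod]
  refine LinearEquiv.finrank_eq
    { toFun := fun v => (⟨v.1 ∘ Sum.inl, ((h _).1 v.2).1⟩, ⟨v.1 ∘ Sum.inr, ((h _).1 v.2).2⟩)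
      invFun := fun w => ⟨Sum.elim w.1.1 w.2.1, (h _).2 ⟨by simp, by simp⟩⟩
      map_add' := fun _ _ => rfl
      map_smul' := fun _ _ => rfl
      left_inv := fun v => by ext x; cases x <;> rfl
      right_inv := fun w => rfl }

lemma finrank_pencilChain_diag (C D : Matrix m n F) (C' D' : Matrix m' n' F) (k : ℕ) :
    Module.finrank F (pencilChain (fromBlocks C 0 0 C') (fromBlocks D 0 0 D') k) =
      Module.finrank F (pencilChain C D k) + Module.finrank F (pencilChain C' D' k) := by
  apply finrank_of_mem_iff_sum
  induction k with
  | zero =>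
    intro v
    simp only [mem_pencilChain_zero, funext_iff, Sum.forall]; rfl
  | succ k ih =>
    intro v
    simp only [mem_pencilChain_succ, ih, fromBlocks_mulVec, Sum.elim_eq_iff, zero_mulVec,
      add_zero, zero_add]
    constructor
    · rintro ⟨u, ⟨h1, h2⟩, h3, h4⟩
      exact ⟨⟨_, h1, h3⟩, _, h2, h4⟩
    · rintro ⟨⟨u, h1, h3⟩, w, h2, h4⟩
      exact ⟨Sum.elim u w, ⟨by simpa, by simpa⟩, by simpa, by simpa⟩

lemma finrank_pencilChain_antidiag (C D : Matrix m n' F) (C' D' : Matrix m' n F) (k : ℕ) :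
    Module.finrank F (pencilChain (fromBlocks 0 C C' 0) (fromBlocks 0 D D' 0) k) =
      Module.finrank F (pencilChain C' D' k) + Module.finrank F (pencilChain C D k) := by
  apply finrank_of_mem_iff_sum
  induction k with
  | zero =>
    intro v
    simp only [mem_pencilChain_zero, funext_iff, Sum.forall]; rfl
  | succ k ih =>
    intro v
    simp only [mem_pencilChain_succ, ih, fromBlocks_mulVec, Sum.elim_eq_iff, zero_mulVec,
      add_zero, zero_add]
    constructor
    · rintro ⟨u, ⟨h1, h2⟩, h3, h4⟩
      exact ⟨⟨_, h1, h4⟩, _, h2, h3⟩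
    · rintro ⟨⟨u, h1, h3⟩, w, h2, h4⟩
      exact ⟨Sum.elim u w, ⟨by simpa, by simpa⟩, by simpa, by simpa⟩

end Chain

lemma blockDiagonal'_mulVec_apply {o : Type} [Fintype o] [DecidableEq o] {m n : o → Type}
    [∀ i, Fintype (n i)] (C : ∀ i, Matrix (m i) (n i) F) (v : (Σ i, n i) → F) (i : o) (x : m i) :
    (blockDiagonal' C *ᵥ v) ⟨i, x⟩ = (C i *ᵥ fun y => v ⟨i, y⟩) x := by
  simp only [mulVec, dotProduct, Fintype.sum_sigma]
  rw [Finset.sum_eq_single i]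
  · simp [blockDiagonal'_apply_eq]
  · intro j _ hj
    simp [blockDiagonal'_apply_ne _ _ _ (Ne.symm hj)]
  · simp

lemma finrank_pencilChain_blockDiagonal' {o : Type} [Fintype o] [DecidableEq o] {m n : o → Type}
    [∀ i, Fintype (n i)] (C D : ∀ i, Matrix (m i) (n i) F) (k : ℕ) :
    Module.finrank F (pencilChain (blockDiagonal' C) (blockDiagonal' D) k) =
      ∑ i, Module.finrank F (pencilChain (C i) (D i) k) := by
  have h : ∀ k v, v ∈ pencilChain (blockDiagonal' C) (blockDiagonal' D) k ↔
      ∀ i, (fun y => v ⟨i, y⟩) ∈ pencilChain (C i) (D i) k := by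
    intro k
    induction k with
    | zero =>
      intro v
      simp only [mem_pencilChain_zero, funext_iff, Sigma.forall]; rfl
    | succ k ih =>
      intro v
      simp only [mem_pencilChain_succ, ih, funext_iff, Sigma.forall, blockDiagonal'_mulVec_apply]
      constructor
      · rintro ⟨u, h1, h2⟩ i
        exact ⟨_, h1 i, h2 i⟩
      · intro h
        choose u h1 h2 using h
        exact ⟨fun x => u x.1 x.2, h1, h2⟩
  rw [← Module.finrank_pi_fintype]
  refine LinearEquiv.finrank_eq
    { toFun := fun v i => ⟨fun y => v.1 ⟨i, y⟩, (h k _).1 v.2 i⟩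
      invFun := fun w => ⟨fun x => (w x.1).1 x.2, (h k _).2 fun i => (w i).2⟩
      map_add' := fun _ _ => rfl
      map_smul' := fun _ _ => rfl
      left_inv := fun v => rfl
      right_inv := fun w => rfl }

section Blocks

lemma finrank_of_initial_coords {l k : ℕ} (hk : k ≤ l) (U : Submodule F (Fin l → F))
    (hinj : ∀ y ∈ U, (∀ i : Fin l, (i : ℕ) < k → y i = 0) → y = 0)
    (hsurj : ∀ c : ℕ → F, ∃ y ∈ U, ∀ i : Fin l, (i : ℕ) < k → y i = c i) :
    Module.finrank F U = k := by
  let f : U →ₗ[F] (Fin k → F) := (LinearMap.funLeft F F (Fin.castLE hk)).comp U.subtype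
  have hf : Function.Bijective f := by
    constructor
    · rw [← LinearMap.ker_eq_bot, LinearMap.ker_eq_bot']
      intro y hy
      refine Subtype.ext (hinj y.1 y.2 fun i hi => ?_)
      exact congrFun hy ⟨i, hi⟩
    · intro c
      obtain ⟨y, hy, h⟩ := hsurj fun i => if h : i < k then c ⟨i, h⟩ else 0
      refine ⟨⟨y, hy⟩, funext fun i => ?_⟩
      have := h (Fin.castLE hk i) i.2
      simpa [f, LinearMap.funLeft] using this
  rw [(LinearEquiv.ofBijective f hf).finrank_eq, Module.finrank_fin_fun]

lemma pencilChain_eq_top_of_le {m n : Type} [Fintype n] {C D : Matrix m n F} {k k' : ℕ}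
    (h : Module.finrank F (pencilChain C D k) = Fintype.card n) (hk : k ≤ k') :
    pencilChain C D k' = ⊤ := by
  have htop : pencilChain C D k = ⊤ := Submodule.eq_top_of_finrank_eq (by simpa using h)
  exact top_le_iff.1 (htop ▸ pencilChain_mono C D hk)

lemma finrank_pencilChain_min {m : Type} {l : ℕ} {C D : Matrix m (Fin l) F}
    (h : ∀ k ≤ l, Module.finrank F (pencilChain C D k) = k) (k : ℕ) :
    Module.finrank F (pencilChain C D k) = min l k := by
  rcases le_total k l with hk | hk
  · rw [h k hk, min_eq_right hk]
  · rw [pencilChain_eq_top_of_le (by simpa using h l le_rfl) hk, min_eq_left hk]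
    simp

lemma Jord_mulVec_apply (l : ℕ) (lam : F) (v : Fin l → F) (i : Fin l) :
    (Jord F l lam *ᵥ v) i = lam * v i + if h : (i : ℕ) + 1 < l then v ⟨i + 1, h⟩ else 0 := by
  have h1 : ∀ j, Jord F l lam i j * v j =
      (if i = j then lam * v j else 0) + if (i : ℕ) + 1 = (j : ℕ) then v j else 0 := by
    intro j
    unfold Jord
    by_cases h : i = j
    · subst h; simp
    · simp [h]
  simp only [mulVec, dotProduct, h1, Finset.sum_add_distrib, Finset.sum_ite_eq,
    Finset.mem_univ, if_true]
  congr 1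
  split_ifs with h
  · rw [Finset.sum_eq_single ⟨i + 1, h⟩]
    · simp
    · intro j _ hj
      rw [if_neg]
      intro h'
      exact hj (Fin.ext h'.symm)
    · simp
  · refine Finset.sum_eq_zero fun j _ => if_neg ?_
    have := j.2
    omega

lemma Jord_sub_smul_one (l : ℕ) (lam mu : F) :
    Jord F l lam - mu • (1 : Matrix (Fin l) (Fin l) F) = Jord F l (lam - mu) := by
  ext i j
  by_cases h : i = j
  · subst h; simp [Jord]
  · simp [Jord, h]

lemma det_Jord (l : ℕ) (lam : F) : (Jord F l lam).det = lam ^ l := by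
  rw [det_of_isUpperTriangular]
  · simp [Jord]
  · intro i j hij
    have hij' : (j : ℕ) < i := hij
    have h1 : i ≠ j := by rintro rfl; exact lt_irrefl _ hij'
    have h2 : (i : ℕ) + 1 ≠ j := by omega
    simp [Jord, h1, h2]

lemma mulVec_eq_zero_of_det_ne_zero {n : Type} [Fintype n] [DecidableEq n] {M : Matrix n n F}
    (hM : M.det ≠ 0) (v : n → F) (hv : M *ᵥ v = 0) : v = 0 := by
  by_contra hne
  exact hM (exists_mulVec_eq_zero_iff.1 ⟨v, hne, hv⟩)

lemma mem_pencilChain_Jord_zero (l k : ℕ) (v : Fin l → F) :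
    v ∈ pencilChain (Jord F l 0) 1 k ↔ ∀ i : Fin l, k ≤ i → v i = 0 := by
  induction k generalizing v with
  | zero => simp [mem_pencilChain_zero, funext_iff]
  | succ k ih =>
    simp only [mem_pencilChain_succ, one_mulVec, exists_eq_right', ih, Jord_mulVec_apply,
      zero_mul, zero_add]
    constructor
    · intro h i hi
      have := h ⟨i - 1, by omega⟩ (by simp; omega)
      have hlt : (i : ℕ) - 1 + 1 < l := by omega
      rw [dif_pos hlt] at this
      rw [← this]
      congr 1
      ext
      simp
      omega
    · intro h i hi
      split_ifs with hlt
      · exact h _ (by simpa using hi)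
      · rfl

lemma finrank_pencilChain_Jord_zero (l k : ℕ) :
    Module.finrank F (pencilChain (Jord F l 0) 1 k) = min l k := by
  refine finrank_pencilChain_min (fun k hk => finrank_of_initial_coords hk _ ?_ ?_) k
  · intro y hy h
    rw [mem_pencilChain_Jord_zero] at hy
    exact funext fun i => (lt_or_ge (i : ℕ) k).elim (h i) (hy i)
  · intro c
    refine ⟨fun i => if (i : ℕ) < k then c i else 0,
      (mem_pencilChain_Jord_zero _ _ _).2 fun i hi => if_neg (by omega), fun i hi => if_pos hi⟩

lemma finrank_pencilChain_transpose {n : Type} [Fintype n] [DecidableEq n] (C : Matrix n n F)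
    (k : ℕ) :
    Module.finrank F (pencilChain Cᵀ 1 k) = Module.finrank F (pencilChain C 1 k) := by
  have h : ∀ C : Matrix n n F, ∀ k, pencilChain C 1 k = LinearMap.ker (C ^ k).mulVecLin := by
    intro C k
    induction k with
    | zero => ext v; simp [mem_pencilChain_zero]
    | succ k ih =>
      ext v
      rw [mem_pencilChain_succ, ih]
      simp [pow_succ, mulVec_mulVec]
  have h1 := LinearMap.finrank_range_add_finrank_ker (C ^ k).mulVecLin
  have h2 := LinearMap.finrank_range_add_finrank_ker (Cᵀ ^ k).mulVecLin
  have h3 := rank_transpose (C ^ k)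
  rw [transpose_pow] at h3
  rw [h, h]
  unfold rank at h3
  omega

lemma pencilChain_neg {m n : Type} [Fintype n] (C D : Matrix m n F) (k : ℕ) :
    pencilChain (-C) (-D) k = pencilChain C D k := by
  have := pencilChain_change C D (a := -1) (c := 0) (d := -1) (by simp) (by simp) k
  simpa using this

lemma nabSkew_sub_smul {I J : Type} (X Y : Matrix I J F) (mu : F) :
    nabSkew X - mu • nabSkew Y = nabSkew (X - mu • Y) := by
  ext (i | i) (j | j) <;> simp [nabSkew]; ring

lemma finrank_pencilChain_nabSkew {I J : Type} [Fintype I] [Fintype J] (X Y : Matrix I J F)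
    (k : ℕ) :
    Module.finrank F (pencilChain (nabSkew X) (nabSkew Y) k) =
      Module.finrank F (pencilChain Xᵀ Yᵀ k) + Module.finrank F (pencilChain X Y k) := by
  unfold nabSkew
  rw [finrank_pencilChain_antidiag, pencilChain_neg]

open Classical in
lemma finrank_pencilChain_Jord (l : ℕ) (lam mu : F) (k : ℕ) :
    Module.finrank F (pencilChain (nabSkew (Jord F l lam) - mu • nabSkew 1) (nabSkew 1) k) =
      2 * if lam = mu then min l k else 0 := by
  rw [nabSkew_sub_smul, Jord_sub_smul_one, finrank_pencilChain_nabSkew, transpose_one,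
    finrank_pencilChain_transpose]
  split_ifs with h
  · rw [h, sub_self, finrank_pencilChain_Jord_zero, two_mul]
  · rw [pencilChain_eq_bot (mulVec_eq_zero_of_det_ne_zero _)]
    · simp
    · rw [det_Jord]
      exact pow_ne_zero _ (sub_ne_zero.2 h)

lemma Fmat_mulVec_apply (s : ℕ) (v : Fin (s + 1) → F) (i : Fin s) :
    (Fmat F (s + 1) *ᵥ v) i = v i.castSucc := by
  simp only [mulVec, dotProduct]
  rw [Finset.sum_eq_single i.castSucc]
  · simp [Fmat]
  · intro j _ hj
    have : ¬ (i : ℕ) = j := fun h => hj (Fin.ext h.symm)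
    simp [Fmat, this]
  · simp

lemma Gmat_mulVec_apply (s : ℕ) (v : Fin (s + 1) → F) (i : Fin s) :
    (Gmat F (s + 1) *ᵥ v) i = v i.succ := by
  simp only [mulVec, dotProduct]
  rw [Finset.sum_eq_single i.succ]
  · simp [Gmat]
  · intro j _ hj
    have : ¬ (i : ℕ) + 1 = j := fun h => hj (Fin.ext (by simpa using h.symm))
    simp [Gmat, this]
  · simp

lemma Gmat_sub_smul_Fmat_mulVec_apply (s : ℕ) (mu : F) (v : Fin (s + 1) → F) (i : Fin s) :
    ((Gmat F (s + 1) - mu • Fmat F (s + 1)) *ᵥ v) i = v i.succ - mu * v i.castSucc := by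
  rw [sub_mulVec, smul_mulVec, Pi.sub_apply, Pi.smul_apply, Gmat_mulVec_apply,
    Fmat_mulVec_apply, smul_eq_mul]

lemma dotProduct_Gmat_sub_smul_Fmat_transpose (s : ℕ) (mu : F) (x : Fin s → F) (v : Fin (s + 1) → F) :
    v ⬝ᵥ ((Gmat F (s + 1) - mu • Fmat F (s + 1))ᵀ *ᵥ x) =
      ∑ i, (v i.succ - mu * v i.castSucc) * x i := by
  rw [dotProduct_mulVec, vecMul_transpose, dotProduct]
  exact Finset.sum_congr rfl fun i _ => by rw [← Gmat_sub_smul_Fmat_mulVec_apply]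

lemma mem_pencilChain_Gmat_succ (s : ℕ) (mu : F) (k : ℕ) (v : Fin (s + 1) → F) :
    v ∈ pencilChain (Gmat F (s + 1) - mu • Fmat F (s + 1)) (Fmat F (s + 1)) (k + 1) ↔
      ∃ u ∈ pencilChain (Gmat F (s + 1) - mu • Fmat F (s + 1)) (Fmat F (s + 1)) k,
        ∀ i : Fin s, v i.succ - mu * v i.castSucc = u i.castSucc := by
  rw [mem_pencilChain_succ]
  refine exists_congr fun u => and_congr_right fun _ => ?_
  rw [funext_iff]
  exact forall_congr' fun i => by
    rw [← Gmat_sub_smul_Fmat_mulVec_apply, ← Fmat_mulVec_apply s u]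

lemma eq_zero_of_recurrence {s : ℕ} {mu : F} {v : Fin (s + 1) → F} (h0 : v 0 = 0)
    (h : ∀ i : Fin s, v i.succ - mu * v i.castSucc = 0) : v = 0 := by
  funext i
  induction i using Fin.induction with
  | zero => exact h0
  | succ i ih =>
    have := h i
    rw [ih] at this
    simpa using this

lemma finrank_pencilChain_Gmat (s : ℕ) (mu : F) (k : ℕ) :
    Module.finrank F (pencilChain (Gmat F (s + 1) - mu • Fmat F (s + 1)) (Fmat F (s + 1)) k) =
      min (s + 1) k := by
  refine finrank_pencilChain_min (fun k hk => finrank_of_initial_coords hk _ ?_ ?_) k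
  · induction k with
    | zero => intro y hy _; exact mem_pencilChain_zero.1 hy
    | succ k ih =>
      intro y hy h
      obtain ⟨u, hu, hyu⟩ := (mem_pencilChain_Gmat_succ _ _ _ _).1 hy
      have hu0 : u = 0 := by
        refine ih (by omega) u hu fun i hi => ?_
        have := hyu ⟨i, by omega⟩
        rw [h _ (by simpa using hi), h _ (by simp; omega)] at this
        simpa using this.symm
      subst hu0
      exact eq_zero_of_recurrence (h 0 (by simp)) fun i => by simpa using hyu i
  · induction k with
    | zero => intro c; exact ⟨0, Submodule.zero_mem _, fun i hi => absurd hi (by omega)⟩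
    | succ k ih =>
      intro c
      obtain ⟨u, hu, h⟩ := ih (by omega) fun i => c (i + 1) - mu * c i
      let y : Fin (s + 1) → F :=
        Fin.induction (c 0) fun i z => mu * z + u i.castSucc
      have hy : ∀ i : Fin s, y i.succ = mu * y i.castSucc + u i.castSucc := fun i => by
        simp [y]
      refine ⟨y, (mem_pencilChain_Gmat_succ _ _ _ _).2 ⟨u, hu, fun i => by rw [hy]; ring⟩, ?_⟩
      intro i
      induction i using Fin.induction with
      | zero => intro _; simp [y]
      | succ i ihi =>
        intro hi
        rw [Fin.val_succ] at hi
        rw [hy, ihi (by simp; omega), h _ (by simpa using hi)]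
        simp

lemma Gmat_sub_smul_Fmat_transpose_injective (s : ℕ) (mu : F) (x : Fin s → F)
    (hx : (Gmat F (s + 1) - mu • Fmat F (s + 1))ᵀ *ᵥ x = 0) : x = 0 := by
  funext j
  obtain ⟨v, hv⟩ : ∃ v : Fin (s + 1) → F,
      ∀ i : Fin s, v i.succ - mu * v i.castSucc = if i = j then 1 else 0 :=
    ⟨Fin.induction 0 fun i z => mu * z + if i = j then 1 else 0, fun i => by simp⟩
  have := dotProduct_Gmat_sub_smul_Fmat_transpose s mu x v
  rw [hx, dotProduct_zero] at this
  simpa [hv] using this.symm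

lemma finrank_pencilChain_Gmat_nabSkew {r : ℕ} (hr : 1 ≤ r) (mu : F) (k : ℕ) :
    Module.finrank F
      (pencilChain (nabSkew (Gmat F r) - mu • nabSkew (Fmat F r)) (nabSkew (Fmat F r)) k) =
      min r k := by
  obtain ⟨s, rfl⟩ := Nat.exists_eq_add_of_le' hr
  rw [nabSkew_sub_smul, finrank_pencilChain_nabSkew,
    pencilChain_eq_bot (Gmat_sub_smul_Fmat_transpose_injective s mu), finrank_pencilChain_Gmat]
  simp

lemma Fmat_transpose_injective (s : ℕ) (x : Fin s → F) (hx : (Fmat F (s + 1))ᵀ *ᵥ x = 0) :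
    x = 0 := by
  funext j
  have h : (Fmat F (s + 1) *ᵥ Pi.single j.castSucc 1) ⬝ᵥ x = 0 := by
    rw [← vecMul_transpose, ← dotProduct_mulVec, hx, dotProduct_zero]
  have h' : Fmat F (s + 1) *ᵥ Pi.single j.castSucc 1 = Pi.single j 1 := by
    funext i
    rw [Fmat_mulVec_apply]
    simp [Pi.single_apply]
  simpa [h'] using h

lemma finrank_pencilChain_Fmat_nabSkew {r : ℕ} (hr : 1 ≤ r) (D : Matrix (Fin (r - 1)) (Fin r) F) :
    Module.finrank F (pencilChain (nabSkew (Fmat F r)) (nabSkew D) 1) = 1 := by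
  obtain ⟨s, rfl⟩ := Nat.exists_eq_add_of_le' hr
  rw [finrank_pencilChain_nabSkew, pencilChain_eq_bot (Fmat_transpose_injective s), finrank_bot,
    zero_add]
  have e : ∀ v, v ∈ pencilChain (Fmat F (s + 1)) D 1 ↔ ∀ i : Fin s, v i.castSucc = 0 := by
    intro v
    rw [mem_pencilChain_one, funext_iff]
    exact forall_congr' fun i => by rw [← Fmat_mulVec_apply s v]; rfl
  have hs := finrank_eq_one_iff' (K := F) (V := pencilChain (Fmat F (s + 1)) D 1)
  refine hs.2 ⟨⟨Pi.single (Fin.last s) 1, (e _).2 fun i => by simp⟩, ?_, ?_⟩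
  · intro h
    have := congrFun (congrArg Subtype.val h) (Fin.last s)
    simp at this
  · rintro ⟨w, hw⟩
    rw [e] at hw
    refine ⟨w (Fin.last s), Subtype.ext (funext fun i => ?_)⟩
    induction i using Fin.lastCases with
    | last => simp
    | cast i => simp [hw i]

end Blocks

section Canonical

variable {p q : ℕ} {l : Fin p → ℕ} {r : Fin q → ℕ} {lam : Fin p → F}

open Classical in
lemma finrank_pencilChain_can (hr : ∀ j, 1 ≤ r j) (mu : F) (k : ℕ) :
    Module.finrank F (pencilChain (canB F p q l r lam - mu • canA F p q l r) (canA F p q l r) k) =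
      2 * (∑ i, if lam i = mu then min (l i) k else 0) + ∑ j, min (r j) k := by
  have h : canB F p q l r lam - mu • canA F p q l r = fromBlocks
      (blockDiagonal' fun i => nabSkew (Jord F (l i) (lam i)) - mu • nabSkew 1) 0 0
      (blockDiagonal' fun j => nabSkew (Gmat F (r j)) - mu • nabSkew (Fmat F (r j))) := by
    have h1 := blockDiagonal'_sub (fun i => nabSkew (Jord F (l i) (lam i)))
      (mu • fun i => nabSkew (1 : Matrix (Fin (l i)) (Fin (l i)) F))
    have h2 := blockDiagonal'_sub (fun j => nabSkew (Gmat F (r j)))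
      (mu • fun j => nabSkew (Fmat F (r j)))
    rw [blockDiagonal'_smul] at h1 h2
    refine Eq.trans ?_ (congrArg₂ (fun X Y => fromBlocks X 0 0 Y) h1.symm h2.symm)
    unfold canA canB
    rw [fromBlocks_smul, sub_eq_add_neg, fromBlocks_neg, fromBlocks_add]
    simp [sub_eq_add_neg]
  rw [h]
  unfold canA
  rw [finrank_pencilChain_diag, finrank_pencilChain_blockDiagonal',
    finrank_pencilChain_blockDiagonal']
  simp only [finrank_pencilChain_Jord, finrank_pencilChain_Gmat_nabSkew (hr _), Finset.mul_sum]

lemma finrank_pencilChain_canA (hr : ∀ j, 1 ≤ r j) :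
    Module.finrank F (pencilChain (canA F p q l r) (canB F p q l r lam) 1) = q := by
  unfold canA canB
  rw [finrank_pencilChain_diag, finrank_pencilChain_blockDiagonal',
    finrank_pencilChain_blockDiagonal']
  have h1 : ∀ i, Module.finrank F (pencilChain (nabSkew (1 : Matrix (Fin (l i)) (Fin (l i)) F))
      (nabSkew (Jord F (l i) (lam i))) 1) = 0 := fun i => by
    rw [finrank_pencilChain_nabSkew, transpose_one,
      pencilChain_eq_bot (by simp), pencilChain_eq_bot (by simp), finrank_bot]
  simp [h1, finrank_pencilChain_Fmat_nabSkew (hr _)]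

end Canonical

section Counting

lemma card_filter_eq_add_min {ι : Type} (s : Finset ι) (f : ι → ℕ) (m : ℕ) :
    (s.filter fun i => f i = m + 1).card + ∑ i ∈ s, min (f i) m + ∑ i ∈ s, min (f i) (m + 2) =
      2 * ∑ i ∈ s, min (f i) (m + 1) := by
  rw [Finset.card_filter, ← Finset.sum_add_distrib, ← Finset.sum_add_distrib, Finset.mul_sum]
  refine Finset.sum_congr rfl fun i _ => ?_
  split_ifs <;> omega

/-- A multiset of positive numbers is determined by its sums of truncations. -/
lemma card_filter_eq_of_sum_min_eq {ι κ : Type} {s : Finset ι} {t : Finset κ} {f : ι → ℕ}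
    {g : κ → ℕ} (hf : ∀ i, 1 ≤ f i) (hg : ∀ j, 1 ≤ g j)
    (h : ∀ k, ∑ i ∈ s, min (f i) k = ∑ j ∈ t, min (g j) k) (m : ℕ) :
    (s.filter fun i => f i = m).card = (t.filter fun j => g j = m).card := by
  cases m with
  | zero =>
    rw [Finset.filter_false_of_mem fun i _ => by have := hf i; omega,
      Finset.filter_false_of_mem fun j _ => by have := hg j; omega]
    simp
  | succ m =>
    have h1 := card_filter_eq_add_min s f m
    have h2 := card_filter_eq_add_min t g m
    rw [h, h, h] at h1
    omega

lemma exists_equiv_of_card_fiber_eq {ι κ σ : Type} [Fintype ι] [Fintype κ] [DecidableEq σ]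
    {f : ι → σ} {g : κ → σ}
    (h : ∀ c, (Finset.univ.filter fun i => f i = c).card =
      (Finset.univ.filter fun j => g j = c).card) :
    ∃ π : ι ≃ κ, ∀ i, g (π i) = f i := by
  have e : ∀ c, Nonempty ({i // f i = c} ≃ {j // g j = c}) := fun c => by
    rw [← Fintype.card_eq, Fintype.card_subtype, Fintype.card_subtype, h]
  exact ⟨Equiv.ofFiberEquiv fun c => (e c).some, Equiv.ofFiberEquiv_map _⟩

end Counting

section Congruence

variable {p q p' q' : ℕ} {l : Fin p → ℕ} {r : Fin q → ℕ} {lam : Fin p → F}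
  {l' : Fin p' → ℕ} {r' : Fin q' → ℕ} {lam' : Fin p' → F}

/-- The second canonical pair is congruent, via `S`, to the linear recombination of the first
canonical pair with coefficients `α β γ δ`. -/
def IsCanCongruence (l : Fin p → ℕ) (r : Fin q → ℕ) (lam : Fin p → F)
    (l' : Fin p' → ℕ) (r' : Fin q' → ℕ) (lam' : Fin p' → F)
    (S : (CIdx p q l r → F) ≃ₗ[F] (CIdx p' q' l' r' → F)) (α β γ δ : F) : Prop :=
  (∀ x y, S x ⬝ᵥ (canA F p' q' l' r' *ᵥ S y) =
    x ⬝ᵥ ((α • canA F p q l r + β • canB F p q l r lam) *ᵥ y)) ∧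
  (∀ x y, S x ⬝ᵥ (canB F p' q' l' r' lam' *ᵥ S y) =
    x ⬝ᵥ ((γ • canA F p q l r + δ • canB F p q l r lam) *ᵥ y))

variable {S : (CIdx p q l r → F) ≃ₗ[F] (CIdx p' q' l' r' → F)} {α β γ δ : F}

lemma IsCanCongruence.symm (h : IsCanCongruence l r lam l' r' lam' S α β γ δ)
    (hdet : α * δ - β * γ ≠ 0) :
    IsCanCongruence l' r' lam' l r lam S.symm (δ / (α * δ - β * γ)) (-β / (α * δ - β * γ))
      (-γ / (α * δ - β * γ)) (α / (α * δ - β * γ)) := by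
  obtain ⟨hA, hB⟩ := h
  constructor
  all_goals
    intro x y
    obtain ⟨x, rfl⟩ := S.surjective x
    obtain ⟨y, rfl⟩ := S.surjective y
    simp only [add_mulVec, smul_mulVec, dotProduct_add, dotProduct_smul, smul_eq_mul, hA, hB,
      LinearEquiv.symm_apply_apply]
    generalize x ⬝ᵥ (canA F p q l r *ᵥ y) = a
    generalize x ⬝ᵥ (canB F p q l r lam *ᵥ y) = b
    generalize hD : α * δ - β * γ = D at hdet
    field_simp
    rw [← hD]
    ring

lemma IsCanCongruence.finrank_eq (h : IsCanCongruence l r lam l' r' lam' S α β γ δ)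
    (hdet : α * δ - β * γ ≠ 0) {mu : F} (hmu : α + β * mu ≠ 0) (k : ℕ) :
    Module.finrank F (pencilChain (canB F p' q' l' r' lam' -
        ((γ + δ * mu) / (α + β * mu)) • canA F p' q' l' r') (canA F p' q' l' r') k) =
      Module.finrank F
        (pencilChain (canB F p q l r lam - mu • canA F p q l r) (canA F p q l r) k) := by
  obtain ⟨hA, hB⟩ := h
  rw [← pencilChain_change (canB F p q l r lam - mu • canA F p q l r) (canA F p q l r)
    (a := (α * δ - β * γ) / (α + β * mu)) (c := β) (d := α + β * mu)
    (div_ne_zero hdet hmu) hmu]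
  refine finrank_pencilChain_congr S ?_ ?_ k
  · intro x y
    simp only [sub_mulVec, add_mulVec, smul_mulVec, dotProduct_add, dotProduct_sub,
      dotProduct_smul, smul_eq_mul, hA, hB]
    generalize x ⬝ᵥ (canA F p q l r *ᵥ y) = a
    generalize x ⬝ᵥ (canB F p q l r lam *ᵥ y) = b
    generalize hX : α + β * mu = X at hmu
    field_simp
    rw [← hX]
    ring
  · intro x y
    simp only [sub_mulVec, add_mulVec, smul_mulVec, dotProduct_add, dotProduct_sub,
      dotProduct_smul, smul_eq_mul, hA]
    ring

variable [Infinite F]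

lemma IsCanCongruence.sum_min_eq (h : IsCanCongruence l r lam l' r' lam' S α β γ δ)
    (hdet : α * δ - β * γ ≠ 0) (hr : ∀ j, 1 ≤ r j) (hr' : ∀ j, 1 ≤ r' j) (k : ℕ) :
    ∑ j, min (r j) k = ∑ j, min (r' j) k := by
  classical
  obtain ⟨mu, hmu⟩ := Infinite.exists_notMem_finset
    (Finset.univ.image lam ∪ {-α / β} ∪
      Finset.univ.image fun i => (α * lam' i - γ) / (δ - β * lam' i))
  simp only [Finset.mem_union, Finset.mem_image, Finset.mem_univ, true_and,
    Finset.mem_singleton, not_or, not_exists] at hmu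
  obtain ⟨⟨h1, h2⟩, h3⟩ := hmu
  have hne : α + β * mu ≠ 0 := by
    intro h0
    by_cases hβ : β = 0
    · subst hβ
      have : α = 0 := by simpa using h0
      simp [this] at hdet
    · apply h2
      field_simp
      linear_combination h0
  have hlam' : ∀ i, lam' i ≠ (γ + δ * mu) / (α + β * mu) := by
    intro i hi
    apply h3 i
    have hi' : lam' i * (α + β * mu) = γ + δ * mu := by rw [hi, div_mul_cancel₀ _ hne]
    have hd : δ - β * lam' i ≠ 0 := by
      intro h0
      apply hdet
      linear_combination (α + β * mu) * h0 + β * hi'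
    rw [div_eq_iff hd]
    linear_combination hi'
  have := h.finrank_eq hdet hne k
  rw [finrank_pencilChain_can hr', finrank_pencilChain_can hr] at this
  simpa [hlam', h1] using this.symm

lemma IsCanCongruence.add_mul_ne_zero (h : IsCanCongruence l r lam l' r' lam' S α β γ δ)
    (hdet : α * δ - β * γ ≠ 0) (hl : ∀ i, 1 ≤ l i) (hr : ∀ j, 1 ≤ r j) (hr' : ∀ j, 1 ≤ r' j)
    (i : Fin p) : α + β * lam i ≠ 0 := by
  classical
  intro h0
  have hq : q = q' := by
    have := h.sum_min_eq hdet hr hr' 1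
    simpa [hr, hr'] using this
  have hβ : β ≠ 0 := by
    rintro rfl
    have : α = 0 := by simpa using h0
    simp [this] at hdet
  have h1 := finrank_pencilChain_canA (F := F) (l := l') (lam := lam') hr'
  have hd : γ + δ * lam i ≠ 0 := by
    intro h2
    apply hdet
    linear_combination δ * h0 - β * h2
  have h2 := finrank_pencilChain_congr (C := β • (canB F p q l r lam - lam i • canA F p q l r))
    (D := δ • (canB F p q l r lam - lam i • canA F p q l r) + (γ + δ * lam i) • canA F p q l r)
    (C' := canA F p' q' l' r') (D' := canB F p' q' l' r' lam') S ?_ ?_ 1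
  · rw [pencilChain_change _ _ hβ hd, h1, finrank_pencilChain_can hr] at h2
    have h3 : ∑ j, min (r j) 1 = q := by simp [hr]
    have h4 : (if lam i = lam i then min (l i) 1 else 0) ≤
        ∑ i', if lam i' = lam i then min (l i') 1 else 0 :=
      Finset.single_le_sum (f := fun i' => if lam i' = lam i then min (l i') 1 else 0)
        (fun _ _ => Nat.zero_le _) (Finset.mem_univ i)
    have := hl i
    rw [if_pos rfl] at h4
    omega
  · intro x y
    simp only [sub_mulVec, add_mulVec, smul_mulVec, dotProduct_add, dotProduct_sub,
      dotProduct_smul, smul_eq_mul, h.1]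
    linear_combination (x ⬝ᵥ (canA F p q l r *ᵥ y)) * h0
  · intro x y
    simp only [sub_mulVec, add_mulVec, smul_mulVec, dotProduct_add, dotProduct_sub,
      dotProduct_smul, smul_eq_mul, h.2]
    ring

/-- Uniqueness of the canonical form up to recombination of the pair. -/
lemma IsCanCongruence.exists_equiv (h : IsCanCongruence l r lam l' r' lam' S α β γ δ)
    (hdet : α * δ - β * γ ≠ 0) (hl : ∀ i, 1 ≤ l i) (hr : ∀ j, 1 ≤ r j)
    (hl' : ∀ i, 1 ≤ l' i) (hr' : ∀ j, 1 ≤ r' j) :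
    ∃ (π : Fin p ≃ Fin p') (ρ : Fin q ≃ Fin q'),
      (∀ i, l' (π i) = l i ∧ lam' (π i) = (γ + δ * lam i) / (α + β * lam i)) ∧
      (∀ j, r' (ρ j) = r j) := by
  classical
  have hne := h.add_mul_ne_zero hdet hl hr hr'
  have hne' : ∀ i, δ - β * lam' i ≠ 0 := by
    intro i h0
    have hdet' : δ / (α * δ - β * γ) * (α / (α * δ - β * γ)) -
        -β / (α * δ - β * γ) * (-γ / (α * δ - β * γ)) ≠ 0 := by
      have : δ / (α * δ - β * γ) * (α / (α * δ - β * γ)) -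
        -β / (α * δ - β * γ) * (-γ / (α * δ - β * γ)) = (α * δ - β * γ)⁻¹ := by
        field_simp
      rw [this]
      exact inv_ne_zero hdet
    refine (h.symm hdet).add_mul_ne_zero hdet' hl' hr' hr i ?_
    have : δ / (α * δ - β * γ) + -β / (α * δ - β * γ) * lam' i =
      (δ - β * lam' i) / (α * δ - β * γ) := by ring
    rw [this, h0, zero_div]
  have hsum := h.sum_min_eq hdet hr hr'
  obtain ⟨ρ, hρ⟩ := exists_equiv_of_card_fiber_eq
    (card_filter_eq_of_sum_min_eq hr hr' hsum)
  have hfib : ∀ c : F × ℕ,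
      (Finset.univ.filter fun i => ((γ + δ * lam i) / (α + β * lam i), l i) = c).card =
      (Finset.univ.filter fun i => (lam' i, l' i) = c).card := by
    rintro ⟨ν, m⟩
    by_cases hν : δ - β * ν = 0
    · rw [Finset.filter_false_of_mem, Finset.filter_false_of_mem]
      · simp
      · rintro i - hi
        apply hne' i
        rw [(Prod.mk.inj hi).1, hν]
      · rintro i - hi
        have h1 := (Prod.mk.inj hi).1
        rw [div_eq_iff (hne i)] at h1
        apply hdet
        linear_combination (α + β * lam i) * hν - β * h1
    · obtain ⟨mu, hmu⟩ : ∃ mu, mu = (α * ν - γ) / (δ - β * ν) := ⟨_, rfl⟩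
      rw [eq_div_iff hν] at hmu
      have hmu0 : α + β * mu ≠ 0 := by
        intro h0
        apply hdet
        linear_combination (δ - β * ν) * h0 - β * hmu
      have hphi : (γ + δ * mu) / (α + β * mu) = ν := by
        rw [div_eq_iff hmu0]
        linear_combination hmu
      have hiff : ∀ i, (γ + δ * lam i) / (α + β * lam i) = ν ↔ lam i = mu := by
        intro i
        rw [div_eq_iff (hne i)]
        constructor
        · intro h1
          apply mul_right_cancel₀ hν
          linear_combination h1 - hmu
        · intro h1
          rw [h1]
          linear_combination hmu
      simp only [Prod.mk.injEq, hiff, ← Finset.filter_filter]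
      refine card_filter_eq_of_sum_min_eq hl hl' (fun k => ?_) m
      have := h.finrank_eq hdet hmu0 k
      rw [hphi, finrank_pencilChain_can hr', finrank_pencilChain_can hr, hsum] at this
      rw [Finset.sum_filter, Finset.sum_filter]
      omega
  obtain ⟨π, hπ⟩ := exists_equiv_of_card_fiber_eq hfib
  exact ⟨π, ρ, fun i => ⟨(Prod.mk.inj (hπ i)).2, (Prod.mk.inj (hπ i)).1⟩, hρ⟩

end Congruence

section LieAlgebra

variable {p q : ℕ} {l : Fin p → ℕ} {r : Fin q → ℕ} {lam : Fin p → F}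

/-- Outside the degenerate form the two canonical matrices are linearly independent. -/
lemma can_linearIndependent
    (hnd : ¬ ((∀ i i', lam i = lam i') ∧ (∀ i, l i = 1) ∧ (∀ j, r j = 1)))
    (hl : ∀ i, 1 ≤ l i) (hr : ∀ j, 1 ≤ r j) {a b : F}
    (h : a • canA F p q l r + b • canB F p q l r lam = 0) : a = 0 ∧ b = 0 := by
  by_contra hab
  have hdiag : ∀ i, a + b * lam i = 0 := fun i => by
    have := congrFun (congrFun h (Sum.inl ⟨i, Sum.inl ⟨0, hl i⟩⟩)) (Sum.inl ⟨i, Sum.inr ⟨0, hl i⟩⟩)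
    simpa [canA, canB, nabSkew, blockDiagonal'_apply_eq, Jord] using this
  apply hnd
  refine ⟨fun i i' => ?_, fun i => ?_, fun j => ?_⟩
  · have hb : b ≠ 0 := by
      rintro rfl
      exact hab ⟨by simpa using hdiag i, rfl⟩
    apply mul_left_cancel₀ hb
    linear_combination hdiag i - hdiag i'
  · by_contra hne
    have h1 : 1 < l i := by have := hl i; omega
    have := congrFun (congrFun h (Sum.inl ⟨i, Sum.inl ⟨0, hl i⟩⟩)) (Sum.inl ⟨i, Sum.inr ⟨1, h1⟩⟩)
    have hb : b = 0 := by
      simpa [canA, canB, nabSkew, blockDiagonal'_apply_eq, Jord] using this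
    have ha := hdiag i
    rw [hb] at ha
    exact hab ⟨by simpa using ha, hb⟩
  · by_contra hne
    have h1 : 1 < r j := by have := hr j; omega
    have h2 : 0 < r j - 1 := by omega
    have e1 := congrFun (congrFun h (Sum.inr ⟨j, Sum.inl ⟨0, h2⟩⟩)) (Sum.inr ⟨j, Sum.inr ⟨0, hr j⟩⟩)
    have e2 := congrFun (congrFun h (Sum.inr ⟨j, Sum.inl ⟨0, h2⟩⟩)) (Sum.inr ⟨j, Sum.inr ⟨1, h1⟩⟩)
    refine hab ⟨?_, ?_⟩
    · simpa [canA, canB, nabSkew, blockDiagonal'_apply_eq, Fmat, Gmat] using e1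
    · simpa [canA, canB, nabSkew, blockDiagonal'_apply_eq, Fmat, Gmat] using e2

lemma canBr_eq (u v : Fin 2 ⊕ CIdx p q l r → F) :
    canBr F p q l r lam u v = Sum.elim
      ![(u ∘ Sum.inr) ⬝ᵥ (canA F p q l r *ᵥ (v ∘ Sum.inr)),
        (u ∘ Sum.inr) ⬝ᵥ (canB F p q l r lam *ᵥ (v ∘ Sum.inr))] 0 := by
  have h : ∀ M : Matrix (CIdx p q l r) (CIdx p q l r) F,
      ∑ x, ∑ y, u (Sum.inr x) * M x y * v (Sum.inr y) =
        (u ∘ Sum.inr) ⬝ᵥ (M *ᵥ (v ∘ Sum.inr)) := by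
    intro M
    simp only [mulVec, dotProduct, Finset.mul_sum, Function.comp_apply, mul_assoc]
  funext k
  rcases k with k | k
  · fin_cases k
    · exact h _
    · exact h _
  · rfl

variable {p' q' : ℕ} {l' : Fin p' → ℕ} {r' : Fin q' → ℕ} {lam' : Fin p' → F}

lemma exists_isCanCongruence_of_equiv
    (hl : ∀ i, 1 ≤ l i) (hr : ∀ j, 1 ≤ r j)
    (hnd : ¬ ((∀ i i', lam i = lam i') ∧ (∀ i, l i = 1) ∧ (∀ j, r j = 1)))
    (e : ((Fin 2 ⊕ CIdx p q l r) → F) ≃ₗ[F] ((Fin 2 ⊕ CIdx p' q' l' r') → F))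
    (he : ∀ u v, e (canBr F p q l r lam u v) = canBr F p' q' l' r' lam' (e u) (e v)) :
    ∃ (S : (CIdx p q l r → F) ≃ₗ[F] (CIdx p' q' l' r' → F)) (α β γ δ : F),
      α * δ - β * γ ≠ 0 ∧ IsCanCongruence l r lam l' r' lam' S α β γ δ := by
  obtain ⟨z, hz⟩ : ∃ z : Fin 2 → (Fin 2 ⊕ CIdx p' q' l' r') → F,
      ∀ k, z k = e (Sum.elim (Pi.single k 1) 0) := ⟨_, fun _ => rfl⟩
  have hexp : ∀ a b : F, e (Sum.elim ![a, b] 0) = a • z 0 + b • z 1 := by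
    intro a b
    rw [hz, hz, ← map_smul, ← map_smul, ← map_add]
    congr 1
    funext k
    rcases k with k | k
    · fin_cases k <;> simp
    · simp
  have hz0 : ∀ k t, z k (Sum.inr t) = 0 := by
    intro k t
    have hlin : z 0 (Sum.inr t) • canA F p q l r + z 1 (Sum.inr t) • canB F p q l r lam = 0 := by
      ext x y
      have h1 := congrFun (he (Sum.elim 0 (Pi.single x 1)) (Sum.elim 0 (Pi.single y 1)))
        (Sum.inr t)
      rw [canBr_eq, canBr_eq, hexp] at h1
      simp only [Sum.elim_comp_inr] at h1
      simp at h1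
      simp only [Matrix.add_apply, Matrix.smul_apply, Matrix.zero_apply, smul_eq_mul]
      linear_combination h1
    have h01 := can_linearIndependent hnd hl hr hlin
    fin_cases k
    · exact h01.1
    · exact h01.2
  have hcentral : ∀ w : Fin 2 → F, ∀ t, e (Sum.elim w 0) (Sum.inr t) = 0 := by
    intro w t
    have hw : w = ![w 0, w 1] := by funext k; fin_cases k <;> rfl
    rw [hw, hexp]
    simp [hz0]
  let incl : (CIdx p q l r → F) →ₗ[F] (Fin 2 ⊕ CIdx p q l r → F) :=
    { toFun := fun v => Sum.elim 0 v
      map_add' := fun v w => by funext k; cases k <;> simp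
      map_smul' := fun c v => by funext k; cases k <;> simp }
  let S₀ : (CIdx p q l r → F) →ₗ[F] (CIdx p' q' l' r' → F) :=
    (LinearMap.funLeft F F Sum.inr).comp (e.toLinearMap.comp incl)
  have hsplit : ∀ u, e u ∘ Sum.inr = S₀ (u ∘ Sum.inr) := by
    intro u
    have hu : u = Sum.elim (u ∘ Sum.inl) (0 : CIdx p q l r → F) +
        Sum.elim (0 : Fin 2 → F) (u ∘ Sum.inr) := by
      funext k; cases k <;> simp
    funext t
    conv_lhs => rw [hu]
    rw [map_add]
    have := hcentral (u ∘ Sum.inl) t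
    simp only [Function.comp_apply, Pi.add_apply, this, zero_add]
    rfl
  have hdet : z 0 (Sum.inl 0) * z 1 (Sum.inl 1) - z 1 (Sum.inl 0) * z 0 (Sum.inl 1) ≠ 0 := by
    intro h0
    have hd : (!![z 0 (Sum.inl 0), z 1 (Sum.inl 0); z 0 (Sum.inl 1), z 1 (Sum.inl 1)]).det = 0 := by
      rw [det_fin_two_of]; exact h0
    obtain ⟨w, hw, hw0⟩ := exists_mulVec_eq_zero_iff.2 hd
    apply hw
    have hzero : e (Sum.elim ![w 0, w 1] 0) = 0 := by
      rw [hexp]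
      funext k
      rcases k with k | k
      · have := congrFun hw0 k
        fin_cases k
        · simp [mulVec, dotProduct, Fin.sum_univ_two] at this ⊢
          linear_combination this
        · simp [mulVec, dotProduct, Fin.sum_univ_two] at this ⊢
          linear_combination this
      · simp [hz0]
    have h2 := (LinearEquiv.map_eq_zero_iff e).1 hzero
    funext k
    have := congrFun h2 (Sum.inl k)
    fin_cases k <;> simpa using this
  have hsurj : Function.Surjective S₀ := by
    intro y
    refine ⟨(e.symm (Sum.elim 0 y)) ∘ Sum.inr, ?_⟩
    rw [← hsplit, LinearEquiv.apply_symm_apply]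
    rfl
  have hrank : Module.finrank F (CIdx p q l r → F) = Module.finrank F (CIdx p' q' l' r' → F) := by
    have := e.finrank_eq
    simp only [Module.finrank_fintype_fun_eq_card, Fintype.card_sum (α := Fin 2)] at this ⊢
    omega
  have hinj : Function.Injective S₀ :=
    (LinearMap.injective_iff_surjective_of_finrank_eq_finrank hrank).2 hsurj
  refine ⟨LinearEquiv.ofBijective S₀ ⟨hinj, hsurj⟩, z 0 (Sum.inl 0), z 1 (Sum.inl 0),
    z 0 (Sum.inl 1), z 1 (Sum.inl 1), hdet, ?_, ?_⟩
  all_goals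
    intro x y
    have h1 := he (Sum.elim 0 x) (Sum.elim 0 y)
    rw [canBr_eq, canBr_eq, hexp, hsplit, hsplit] at h1
    simp only [Sum.elim_comp_inr] at h1
    change S₀ x ⬝ᵥ (_ *ᵥ S₀ y) = _
    simp only [add_mulVec, smul_mulVec, dotProduct_add, dotProduct_smul, smul_eq_mul]
  · have h2 := congrFun h1 (Sum.inl 0)
    simp at h2
    linear_combination -h2
  · have h2 := congrFun h1 (Sum.inl 1)
    simp at h2
    linear_combination -h2

end LieAlgebra

/-- Theorem 5 (uniqueness part): if two canonical pairs of skew-symmetric (n−2)×(n−2)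
matrices (not of the degenerate form) define isomorphic Lie algebras on `F^n`, then the
canonical forms coincide up to a permutation of the summands and a linear-fractional
transformation of the sequence of eigenvalues. -/
theorem stmt17 [IsAlgClosed F] (hchar : ringChar F ≠ 2) (n : ℕ)
    (p q : ℕ) (l : Fin p → ℕ) (r : Fin q → ℕ) (lam : Fin p → F)
    (p' q' : ℕ) (l' : Fin p' → ℕ) (r' : Fin q' → ℕ) (lam' : Fin p' → F)
    (hl : ∀ i, 1 ≤ l i) (hr : ∀ j, 1 ≤ r j)
    (hl' : ∀ i, 1 ≤ l' i) (hr' : ∀ j, 1 ≤ r' j)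
    (hcard : Fintype.card (CIdx p q l r) + 2 = n)
    (hcard' : Fintype.card (CIdx p' q' l' r') + 2 = n)
    (hnd : ¬ ((∀ i i', lam i = lam i') ∧ (∀ i, l i = 1) ∧ (∀ j, r j = 1)))
    (hnd' : ¬ ((∀ i i', lam' i = lam' i') ∧ (∀ i, l' i = 1) ∧ (∀ j, r' j = 1)))
    (hiso : ∃ e : ((Fin 2 ⊕ CIdx p q l r) → F) ≃ₗ[F] ((Fin 2 ⊕ CIdx p' q' l' r') → F),
        ∀ u v, e (canBr F p q l r lam u v) = canBr F p' q' l' r' lam' (e u) (e v)) :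
    ∃ α β γ δ : F, α * δ - β * γ ≠ 0 ∧ (∀ i, α + β * lam i ≠ 0) ∧
      ∃ (π : Fin p ≃ Fin p') (ρ : Fin q ≃ Fin q'),
        (∀ i, l' (π i) = l i ∧
            lam' (π i) = (γ + δ * lam i) / (α + β * lam i)) ∧
        (∀ j, r' (ρ j) = r j) := by
  obtain ⟨e, he⟩ := hiso
  obtain ⟨S, α, β, γ, δ, hdet, h⟩ := exists_isCanCongruence_of_equiv hl hr hnd e he
  exact ⟨α, β, γ, δ, hdet, h.add_mul_ne_zero hdet hl hr hr',
    h.exists_equiv hdet hl hr hl' hr'⟩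
end

section
/- Let F be an algebraically closed field of characteristic not 2 and let L be a Lie algebra over F of dimension n whose commutator subalgebra L² is central and has dimension 1. Then L is isomorphic to exactly one Lie algebra on F^n with bracket [u,v] := (uᵀ·M·v, 0, …, 0)ᵀ, where M = diag(0_p, [[0,I_q],[−I_q,0]]) for natural numbers p, q with p + 2q = n; that is, such p and q exist and are uniquely determined by L. -/
open Matrix

variable {F : Type} [Field F]

/-- The n×n block-diagonal matrix `diag(0_p, [[0, I_q],[−I_q, 0]])` (where `p + 2q = n`). -/
def M18 (F : Type) [Field F] (n p q : ℕ) : Matrix (Fin n) (Fin n) F :=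
  fun i j =>
    if p ≤ (i : ℕ) ∧ p ≤ (j : ℕ) then
      (if (j : ℕ) = (i : ℕ) + q then 1 else if (i : ℕ) = (j : ℕ) + q then -1 else 0)
    else 0

/-- The Lie bracket on `F^n` given by `[u,v] = (uᵀ·M·v, 0, …, 0)ᵀ` with
`M = diag(0_p, [[0, I_q],[−I_q, 0]])`. -/
def br18 (F : Type) [Field F] (n p q : ℕ) (u v : Fin n → F) : Fin n → F :=
  fun k => if (k : ℕ) = 0 then ∑ i, ∑ j, u i * M18 F n p q i j * v j else 0

/-- Two families form a hyperbolic system for `B` when they are totally isotropic and dual to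
each other. -/
def IsHyperbolicPair {K V ι : Type*} [Field K] [AddCommGroup V] [Module K V] [DecidableEq ι]
    (B : LinearMap.BilinForm K V) (x y : ι → V) : Prop :=
  (∀ i j, B (x i) (x j) = 0) ∧ (∀ i j, B (y i) (y j) = 0) ∧
    ∀ i j, B (x i) (y j) = if i = j then 1 else 0

namespace IsHyperbolicPair

variable {K V ι κ : Type*} [Field K] [AddCommGroup V] [Module K V] [DecidableEq ι] [Fintype ι]
  [Fintype κ] {B : LinearMap.BilinForm K V} {x y : ι → V}

theorem linearIndependent (h : IsHyperbolicPair B x y) {r : κ → V} (hr : LinearIndependent K r)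
    (hry : ∀ k i, B (r k) (y i) = 0) (hxr : ∀ k i, B (x i) (r k) = 0) :
    LinearIndependent K (Sum.elim r (Sum.elim x y)) := by
  obtain ⟨hxx, hyy, hxy⟩ := h
  rw [Fintype.linearIndependent_iff] at hr ⊢
  intro c hc
  simp only [Fintype.sum_sum_type, Sum.elim_inl, Sum.elim_inr] at hc
  have hcx : ∀ i, c (.inr (.inl i)) = 0 := fun i => by
    have := congrArg (fun v => B v (y i)) hc
    simpa [hry, hyy, hxy] using this
  have hcy : ∀ i, c (.inr (.inr i)) = 0 := fun i => by
    have := congrArg (fun v => B (x i) v) hc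
    simpa [hxr, hxx, hxy] using this
  have hcr := hr (fun k => c (.inl k)) (by simpa [hcx, hcy] using hc)
  rintro (k | i | i)
  exacts [hcr k, hcx i, hcy i]

/-- Subtracting the hyperbolic components of a vector makes it orthogonal to the system. -/
theorem exists_decomposition (h : IsHyperbolicPair B x y) (hB : B.IsAlt) (v : V) :
    ∃ w ∈ Submodule.span K (Set.range (Sum.elim x y)),
      ∀ i, B (x i) (v - w) = 0 ∧ B (v - w) (x i) = 0 ∧
        B (y i) (v - w) = 0 ∧ B (v - w) (y i) = 0 := by
  obtain ⟨hxx, hyy, hxy⟩ := h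
  refine ⟨∑ i, B v (y i) • x i + ∑ i, B (x i) v • y i, ?_, fun i => ?_⟩
  · exact add_mem
      (sum_mem fun i _ => Submodule.smul_mem _ _ (Submodule.subset_span ⟨.inl i, rfl⟩))
      (sum_mem fun i _ => Submodule.smul_mem _ _ (Submodule.subset_span ⟨.inr i, rfl⟩))
  · have h1 : B (x i) (v - (∑ i, B v (y i) • x i + ∑ i, B (x i) v • y i)) = 0 := by
      simp [hxx, hxy]
    have h2 : B (v - (∑ i, B v (y i) • x i + ∑ i, B (x i) v • y i)) (y i) = 0 := by
      simp [hyy, hxy]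
    exact ⟨h1, hB.isRefl _ _ h1, hB.isRefl _ _ h2, h2⟩

end IsHyperbolicPair

/-- An alternating form on a finite-dimensional space has a hyperbolic system whose orthogonal
complement is the radical. -/
theorem exists_maximal_isHyperbolicPair {K V : Type*} [Field K] [AddCommGroup V] [Module K V]
    [Module.Finite K V] {B : LinearMap.BilinForm K V} (hB : B.IsAlt) :
    ∃ (q : ℕ) (x y : Fin q → V), IsHyperbolicPair B x y ∧
      ∀ v, (∀ i, B (x i) v = 0 ∧ B (y i) v = 0) → ∀ w, B v w = 0 := by
  by_contra! hmax
  have hall : ∀ q : ℕ, ∃ x y : Fin q → V, IsHyperbolicPair B x y := by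
    intro q
    induction q with
    | zero => exact ⟨Fin.elim0, Fin.elim0, fun i => i.elim0, fun i => i.elim0, fun i => i.elim0⟩
    | succ q ih =>
      obtain ⟨x, y, h⟩ := ih
      obtain ⟨v, hv, w, hvw⟩ := hmax q x y h
      obtain ⟨s, hs, hws⟩ := h.exists_decomposition hB w
      have hvs : B v s = 0 := by
        have : Submodule.span K (Set.range (Sum.elim x y)) ≤ LinearMap.ker (B v) := by
          rw [Submodule.span_le]
          rintro _ ⟨i | i, rfl⟩
          exacts [hB.isRefl _ _ (hv i).1, hB.isRefl _ _ (hv i).2]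
        exact this hs
      obtain ⟨hxx, hyy, hxy⟩ := h
      have hvx : ∀ i, B v (x i) = 0 := fun i => hB.isRefl _ _ (hv i).1
      have hvy : ∀ i, B v (y i) = 0 := fun i => hB.isRefl _ _ (hv i).2
      refine ⟨Fin.snoc x v, Fin.snoc y ((B v w)⁻¹ • (w - s)), ?_, ?_, ?_⟩
      · intro i j
        induction i using Fin.lastCases <;> induction j using Fin.lastCases <;>
          simp only [Fin.snoc_last, Fin.snoc_castSucc, hxx, hvx, (hv _).1, hB v]
      · intro i j
        induction i using Fin.lastCases <;> induction j using Fin.lastCases <;>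
          simp only [Fin.snoc_last, Fin.snoc_castSucc, hyy, hws, hB (w - s), map_smul,
            LinearMap.smul_apply, smul_zero]
      · intro i j
        induction i using Fin.lastCases <;> induction j using Fin.lastCases
        · simp only [Fin.snoc_last, map_smul, map_sub, hvs, sub_zero, if_true, smul_eq_mul]
          exact inv_mul_cancel₀ hvw
        · simp [hvy, (Fin.castSucc_lt_last _).ne']
        · simp only [Fin.snoc_last, Fin.snoc_castSucc, map_smul, (hws _).1, smul_zero,
            (Fin.castSucc_lt_last _).ne, if_false]
        · simp [hxy]
  obtain ⟨x, y, h⟩ := hall (Module.finrank K V + 1)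
  have hli := (h.linearIndependent (κ := Empty) (r := Empty.elim) linearIndependent_empty_type
    (fun k => k.elim) (fun k => k.elim)).comp (Sum.inr ∘ Sum.inl)
    (Sum.inr_injective.comp Sum.inl_injective)
  have := hli.fintype_card_le_finrank
  simp at this

/-- A nonzero vector of a finite-dimensional space is the first vector of some basis. -/
theorem exists_basis_fin_zero_eq {K V : Type*} [Field K] [AddCommGroup V] [Module K V]
    [Module.Finite K V] {z : V} (hz : z ≠ 0) :
    ∃ (m : ℕ) (b : Module.Basis (Fin (m + 1)) K V), b 0 = z := by
  have hs : LinearIndepOn K id ({z} : Set V) := LinearIndepOn.singleton hz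
  let b := Module.Basis.extend hs
  have : Fintype (hs.extend (Set.subset_univ _)) := FiniteDimensional.fintypeBasisIndex b
  let i₀ : hs.extend (Set.subset_univ _) := ⟨z, hs.subset_extend _ rfl⟩
  obtain ⟨m, hm⟩ := Nat.exists_eq_succ_of_ne_zero (Fintype.card_pos_iff.2 ⟨i₀⟩).ne'
  let e := Fintype.equivFinOfCardEq hm
  refine ⟨m, b.reindex (e.trans (Equiv.swap (e i₀) 0)), ?_⟩
  have : (e.trans (Equiv.swap (e i₀) 0)).symm 0 = i₀ := by
    rw [Equiv.symm_apply_eq]; simp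
  rw [Module.Basis.reindex_apply, this]
  exact Module.Basis.extend_apply_self hs i₀

/-- A normal form for alternating forms, with a prescribed nonzero vector of the radical as first
basis vector. -/
theorem exists_basis_eq_M18 {V : Type*} [AddCommGroup V] [Module F V] [Module.Finite F V]
    {B : LinearMap.BilinForm F V} (hB : B.IsAlt) {z : V} (hz : z ≠ 0) (hzB : ∀ w, B z w = 0) :
    ∃ (m q : ℕ) (b : Module.Basis (Fin (m + 1 + (q + q))) F V), b 0 = z ∧
      ∀ i j, B (b i) (b j) = M18 F _ (m + 1) q i j := by
  obtain ⟨q, x, y, h, hrad⟩ := exists_maximal_isHyperbolicPair hB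
  obtain ⟨m, r, hr⟩ := exists_basis_fin_zero_eq (K := F) (V := LinearMap.ker B)
    (z := ⟨z, LinearMap.ext hzB⟩) (fun h => hz (congrArg Subtype.val h))
  have hrB : ∀ k w, B (r k) w = 0 := fun k w => by
    have := (r k).2
    rw [LinearMap.mem_ker] at this
    rw [this, LinearMap.zero_apply]
  have hBr : ∀ k w, B w (r k) = 0 := fun k w => hB.isRefl _ _ (hrB k w)
  have hli := h.linearIndependent (r := fun k => (r k : V))
    (r.linearIndependent.map' (LinearMap.ker B).subtype (Submodule.ker_subtype _))
    (fun k i => hrB k _) (fun k i => hBr k _)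
  have hspan : ⊤ ≤ Submodule.span F
      (Set.range (Sum.elim (fun k => (r k : V)) (Sum.elim x y))) := by
    intro v _
    obtain ⟨w, hw, hvw⟩ := h.exists_decomposition hB v
    have hk : v - w ∈ LinearMap.ker B :=
      LinearMap.ext (hrad _ fun i => ⟨(hvw i).1, (hvw i).2.2.1⟩)
    rw [Set.Sum.elim_range, Submodule.span_union, ← sub_add_cancel v w]
    refine Submodule.add_mem_sup ?_ hw
    have hmem : (⟨v - w, hk⟩ : LinearMap.ker B) ∈ Submodule.span F (Set.range r) := by
      rw [r.span_eq]; trivial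
    have := Submodule.mem_map_of_mem (f := (LinearMap.ker B).subtype) hmem
    rwa [Submodule.map_span, ← Set.range_comp] at this
  let b := (Module.Basis.mk hli hspan).reindex
    ((Equiv.sumCongr (Equiv.refl _) finSumFinEquiv).trans finSumFinEquiv)
  have hb1 : ∀ k : Fin (m + 1), b (Fin.castAdd _ k) = r k := fun k => by simp [b]
  have hb2 : ∀ k : Fin q, b (Fin.natAdd _ (Fin.castAdd _ k)) = x k := fun k => by simp [b]
  have hb3 : ∀ k : Fin q, b (Fin.natAdd _ (Fin.natAdd _ k)) = y k := fun k => by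
    simp [b, -Fin.natAdd_eq_addNat]
  obtain ⟨hxx, hyy, hxy⟩ := h
  have hyx : ∀ i j, B (y i) (x j) = if i = j then -1 else 0 := fun i j => by
    rw [← hB.neg_eq, hxy]; split_ifs <;> simp_all
  refine ⟨m, q, b, ?_, fun i j => ?_⟩
  · have := hb1 0
    rw [hr] at this
    exact this
  · induction i using Fin.addCases with
    | left i =>
      rw [hb1, hrB, M18, if_neg fun h => h.1.not_gt i.2]
    | right i =>
      induction j using Fin.addCases with
      | left j =>
        rw [hb1, hBr, M18, if_neg fun h => h.2.not_gt j.2]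
      | right j =>
        induction i using Fin.addCases with
        | left i =>
          induction j using Fin.addCases with
          | left j =>
            rw [hb2, hb2, hxx]
            simp only [M18, Fin.val_natAdd, Fin.val_castAdd]
            grind
          | right j =>
            rw [hb2, hb3, hxy]
            simp only [M18, Fin.val_natAdd, Fin.val_castAdd, Fin.ext_iff]
            grind
        | right i =>
          induction j using Fin.addCases with
          | left j =>
            rw [hb3, hb2, hyx]
            simp only [M18, Fin.val_natAdd, Fin.val_castAdd, Fin.ext_iff]
            grind
          | right j =>
            rw [hb3, hb3, hyy]
            simp only [M18, Fin.val_natAdd]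
            grind

theorem exists_column_M18 {n p q : ℕ} (hn : p + 2 * q = n) (i : Fin n) (hi : p ≤ (i : ℕ)) :
    ∃ (j : Fin n) (ε : F), ε ≠ 0 ∧ ∀ k, M18 F n p q k j = if k = i then ε else 0 := by
  by_cases hiq : (i : ℕ) < p + q
  · refine ⟨⟨i + q, by omega⟩, 1, one_ne_zero, fun k => ?_⟩
    have := k.2
    simp only [M18, Fin.ext_iff]
    grind
  · refine ⟨⟨i - q, by omega⟩, -1, neg_ne_zero.2 one_ne_zero, fun k => ?_⟩
    have := k.2
    simp only [M18, Fin.ext_iff]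
    grind

theorem forall_br18_eq_zero_iff {n p q : ℕ} (hn : p + 2 * q = n) (h0 : 0 < n) (u : Fin n → F) :
    (∀ v, br18 F n p q u v = 0) ↔ ∀ i : Fin n, p ≤ (i : ℕ) → u i = 0 := by
  constructor
  · intro h i hi
    obtain ⟨j, ε, hε, hcol⟩ := exists_column_M18 (F := F) hn i hi
    have := congrFun (h (Pi.single j 1)) ⟨0, h0⟩
    simpa [br18, Pi.single_apply, hcol, hε] using this
  · intro h v
    funext k
    simp only [br18, Pi.zero_apply, ite_eq_right_iff]
    refine fun _ => Finset.sum_eq_zero fun i _ => Finset.sum_eq_zero fun j _ => ?_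
    by_cases hi : p ≤ (i : ℕ)
    · simp [h i hi]
    · simp [M18, hi]

theorem finrank_vanishing_above {n p : ℕ} (hp : p ≤ n) (W : Submodule F (Fin n → F))
    (hW : ∀ u, u ∈ W ↔ ∀ i : Fin n, p ≤ (i : ℕ) → u i = 0) : Module.finrank F W = p := by
  let f := LinearMap.funLeft F F (Subtype.val : {i : Fin n // p ≤ (i : ℕ)} → Fin n)
  have hWf : W = LinearMap.ker f := by
    ext u
    rw [hW, LinearMap.mem_ker, funext_iff]
    simp [f, LinearMap.funLeft_apply]
  have hf : LinearMap.range f = ⊤ := LinearMap.range_eq_top.2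
    (LinearMap.funLeft_surjective_of_injective F F _ Subtype.val_injective)
  have hrank := f.finrank_range_add_finrank_ker
  have hcard : Fintype.card {i : Fin n // p ≤ (i : ℕ)} = n - p :=
    (Fintype.card_congr
      { toFun := fun i => ⟨i.1 - p, by omega⟩
        invFun := fun k => ⟨⟨k + p, by omega⟩, by simp⟩
        left_inv := fun i => Subtype.ext (Fin.ext (Nat.sub_add_cancel i.2))
        right_inv := fun k => Fin.ext (Nat.add_sub_cancel _ _) }).trans (Fintype.card_fin _)
  rw [hf, finrank_top, Module.finrank_fintype_fun_eq_card, Module.finrank_fintype_fun_eq_card,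
    Fintype.card_fin, hcard, ← hWf] at hrank
  omega

/-- The parameter `p` of a normal form is the dimension of the center. -/
theorem finrank_center_eq_of_equiv_br18 {L : Type*} [LieRing L] [LieAlgebra F L] {n p q : ℕ}
    (hn : p + 2 * q = n) (h0 : 0 < n) (e : L ≃ₗ[F] (Fin n → F))
    (he : ∀ a b : L, e ⁅a, b⁆ = br18 F n p q (e a) (e b)) :
    Module.finrank F (LinearMap.ker (LieModule.toEnd F L L : L →ₗ[F] Module.End F L)) = p := by
  rw [← e.finrank_map_eq]
  refine finrank_vanishing_above (by omega) _ fun u => ?_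
  rw [← forall_br18_eq_zero_iff hn h0]
  obtain ⟨a, rfl⟩ := e.surjective u
  have hbr : (∀ v, br18 F n p q (e a) v = 0) ↔ ∀ b : L, ⁅a, b⁆ = 0 := by
    rw [e.surjective.forall]
    exact forall_congr' fun b => by rw [← he, map_eq_zero_iff e e.injective]
  have hmem : e a ∈ Submodule.map (e : L →ₗ[F] Fin n → F)
      (LinearMap.ker (LieModule.toEnd F L L : L →ₗ[F] Module.End F L)) ↔
      a ∈ LinearMap.ker (LieModule.toEnd F L L : L →ₗ[F] Module.End F L) := by
    rw [Submodule.mem_map_equiv, LinearEquiv.symm_apply_apply]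
  rw [hbr, hmem, LinearMap.mem_ker, LinearMap.ext_iff]
  rfl

theorem exists_equiv_br18 {L : Type*} [LieRing L] [LieAlgebra F L] [Module.Finite F L]
    (hcentral : ∀ a b c : L, ⁅⁅a, b⁆, c⁆ = 0)
    (hdim1 : Module.finrank F
        ↥(Submodule.span F {x : L | ∃ a b : L, ⁅a, b⁆ = x}) = 1) :
    ∃ p q : ℕ, p + 2 * q = Module.finrank F L ∧ ∃ e : L ≃ₗ[F] (Fin (Module.finrank F L) → F),
      ∀ a b : L, e ⁅a, b⁆ = br18 F (Module.finrank F L) p q (e a) (e b) := by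
  obtain ⟨⟨z, hzmem⟩, hz, hspan⟩ := finrank_eq_one_iff'.1 hdim1
  replace hz : z ≠ 0 := fun h => hz (Subtype.ext h)
  have hzc : ∀ w : L, ⁅z, w⁆ = 0 := fun w => by
    clear hspan hz
    induction hzmem using Submodule.span_induction with
    | mem x hx => obtain ⟨a, b, rfl⟩ := hx; exact hcentral a b w
    | zero => exact zero_lie w
    | add x y _ _ hx hy => rw [add_lie, hx, hy, add_zero]
    | smul c x _ hx => rw [smul_lie, hx, smul_zero]
  obtain ⟨f, hf⟩ := Module.Projective.exists_dual_ne_zero F hz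
  let B : LinearMap.BilinForm F L :=
    (LieModule.toEnd F L L : L →ₗ[F] Module.End F L).compr₂ ((f z)⁻¹ • f)
  have hBdef : ∀ a b, B a b = (f z)⁻¹ * f ⁅a, b⁆ := fun a b => rfl
  have hbr : ∀ a b : L, ⁅a, b⁆ = B a b • z := fun a b => by
    obtain ⟨c, hc⟩ := hspan ⟨⁅a, b⁆, Submodule.subset_span ⟨a, b, rfl⟩⟩
    have hc : c • z = ⁅a, b⁆ := congrArg Subtype.val hc
    rw [hBdef, ← hc, map_smul, smul_eq_mul, mul_comm c, inv_mul_cancel_left₀ hf]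
  obtain ⟨m, q, b, hb0, hb⟩ := exists_basis_eq_M18 (B := B) (fun a => by simp [hBdef]) hz
    (fun w => by simp [hBdef, hzc])
  have hn : Module.finrank F L = m + 1 + (q + q) := by
    rw [Module.finrank_eq_card_basis b, Fintype.card_fin]
  rw [hn]
  refine ⟨m + 1, q, by omega, b.equivFun, fun u v => ?_⟩
  have hsum : B u v = ∑ i, ∑ j, b.equivFun u i * M18 F _ (m + 1) q i j * b.equivFun v j := by
    conv_lhs => rw [← b.sum_equivFun u, ← b.sum_equivFun v]
    simp only [map_sum, map_smul, LinearMap.sum_apply, LinearMap.smul_apply, smul_eq_mul, hb,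
      Finset.mul_sum]
    rw [Finset.sum_comm]
    refine Finset.sum_congr rfl fun i _ => Finset.sum_congr rfl fun j _ => by ring
  funext k
  rw [hbr, map_smul, ← hb0, Pi.smul_apply, Module.Basis.equivFun_self, smul_eq_mul]
  simp only [br18, ← hsum]
  have : (0 = k) ↔ (k : ℕ) = 0 := by rw [eq_comm, Fin.ext_iff]; rfl
  simp [this]

/-- A Lie algebra over an algebraically closed field of characteristic ≠ 2 whose commutator
subalgebra is central of dimension 1 is isomorphic to exactly one Lie algebra on `F^n` with
bracket `[u,v] = (uᵀ·diag(0_p, [[0,I_q],[−I_q,0]])·v, 0, …, 0)ᵀ`, `p + 2q = n`; i.e. such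
`p`, `q` exist and are uniquely determined by `L`. -/
theorem stmt18 [IsAlgClosed F] (hchar : ringChar F ≠ 2)
    (L : Type) [LieRing L] [LieAlgebra F L] [Module.Finite F L]
    (n : ℕ) (hdim : Module.finrank F L = n)
    (hcentral : ∀ a b c : L, ⁅⁅a, b⁆, c⁆ = 0)
    (hdim1 : Module.finrank F
        ↥(Submodule.span F {x : L | ∃ a b : L, ⁅a, b⁆ = x}) = 1) :
    ∃! pq : ℕ × ℕ, pq.1 + 2 * pq.2 = n ∧
      ∃ e : L ≃ₗ[F] (Fin n → F),
        ∀ a b : L, e ⁅a, b⁆ = br18 F n pq.1 pq.2 (e a) (e b) := by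
  subst hdim
  have h0 : 0 < Module.finrank F L := by
    have := Submodule.finrank_le (Submodule.span F {x : L | ∃ a b : L, ⁅a, b⁆ = x})
    omega
  obtain ⟨p, q, hpq, e, he⟩ := exists_equiv_br18 hcentral hdim1
  refine ⟨(p, q), ⟨hpq, e, he⟩, ?_⟩
  rintro ⟨p', q'⟩ ⟨hpq', e', he'⟩
  have hp := finrank_center_eq_of_equiv_br18 hpq h0 e he
  have hp' := finrank_center_eq_of_equiv_br18 hpq' h0 e' he'
  have hpp : p' = p := hp'.symm.trans hp
  simp only at hpq hpq'
  exact Prod.ext hpp (by simp only; omega)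
end
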